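/- Let w=(w₁,w₂) be a pair of real numbers with w₁ ≥ w₂ > 0 and w₁+w₂ = 1. There exists a constant C > 0 such that for all ε with 0 < ε ≤ 2^{−5/w₂}, the Hausdorff dimension of DI(w,ε) satisfies 2 − 1/(1+w₁) ≤ dim_H DI(w,ε) ≤ 2 − 1/(1+w₁) + C√ε. -/

import Mathlib

open MeasureTheory

/-- `DI w₁ w₂ ε` is the set of `x ∈ ℝ²` for which the `(w₁,w₂)`-weighted Dirichlet
theorem is `ε`-improvable: for all sufficiently large `T` the system of inequalities
admits an integer solution. -/
def DI (w₁ w₂ ε : ℝ) : Set (EuclideanSpace ℝ (Fin 2)) :=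
  {x | ∃ T₀ : ℝ, ∀ T : ℝ, T₀ < T →
    ∃ p₁ p₂ q : ℤ,
      |(q : ℝ) * x 0 - (p₁ : ℝ)| < ε ^ w₁ * T ^ (-w₁) ∧
      |(q : ℝ) * x 1 - (p₂ : ℝ)| < ε ^ w₂ * T ^ (-w₂) ∧
      0 < q ∧ (q : ℝ) < T}

/-- An integer vector `(p, q)` represents the rational point `p / q`. -/
abbrev RVec := (Fin 2 → ℤ) × ℤ

/-- The displacement of `z` from the line through `u`. -/
noncomputable def offs (j : Fin 2) (u z : RVec) : ℝ := z.1 j - z.2 * (u.1 j / u.2)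

def det3 (u v t : RVec) : ℤ :=
  u.1 0 * (v.1 1 * t.2 - v.2 * t.1 1) - u.1 1 * (v.1 0 * t.2 - v.2 * t.1 0)
    + u.2 * (v.1 0 * t.1 1 - v.1 1 * t.1 0)

lemma det3_eq_offs (u v t : RVec) (hu : u.2 ≠ 0) :
    (det3 u v t : ℝ) = u.2 * (offs 0 u v * offs 1 u t - offs 1 u v * offs 0 u t) := by
  have : (u.2 : ℝ) ≠ 0 := by exact_mod_cast hu
  simp only [det3, offs]; push_cast; field_simp; ring

lemma offs_add (j : Fin 2) (u z z' : RVec) : offs j u (z + z') = offs j u z + offs j u z' := by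
  simp [offs]; ring

lemma offs_smul (j : Fin 2) (u z : RVec) (a : ℤ) : offs j u (a • z) = a * offs j u z := by
  simp [offs]; ring

lemma offs_sub (j : Fin 2) (u z z' : RVec) : offs j u (z - z') = offs j u z - offs j u z' := by
  simp [offs]; ring

lemma offs_self (j : Fin 2) (u : RVec) (hu : u.2 ≠ 0) : offs j u u = 0 := by
  have : (u.2 : ℝ) ≠ 0 := by exact_mod_cast hu
  simp [offs]; field_simp; ring

/-- `z` is the real combination `α a + β b`. -/
def IsComb (α : ℝ) (a : RVec) (β : ℝ) (b z : RVec) : Prop :=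
  (∀ j, (z.1 j : ℝ) = α * a.1 j + β * b.1 j) ∧ (z.2 : ℝ) = α * a.2 + β * b.2

lemma isComb_of_det3 (a b c : RVec) (ha : a.2 ≠ 0) (hab : ∃ j, offs j a b ≠ 0)
    (h : det3 a b c = 0) : ∃ α β : ℝ, IsComb α a β b c := by
  have ha' : (a.2 : ℝ) ≠ 0 := by exact_mod_cast ha
  have hd := det3_eq_offs a b c ha
  rw [h] at hd
  have hd' : offs 0 a b * offs 1 a c - offs 1 a b * offs 0 a c = 0 := by
    have : (a.2 : ℝ) * (offs 0 a b * offs 1 a c - offs 1 a b * offs 0 a c) = 0 := by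
      rw [← hd]; simp
    exact (mul_eq_zero.mp this).resolve_left ha'
  obtain ⟨β, hβ⟩ : ∃ β : ℝ, ∀ j, offs j a c = β * offs j a b := by
    obtain ⟨j, hj⟩ := hab
    refine ⟨offs j a c / offs j a b, fun i => ?_⟩
    rw [div_mul_eq_mul_div, eq_div_iff hj]
    fin_cases j <;> fin_cases i <;> simp <;> linarith
  refine ⟨(c.2 - β * b.2) / a.2, β, fun j => ?_, ?_⟩
  · have := hβ j
    simp only [offs] at this
    field_simp
    field_simp at this
    linarith
  · field_simp; ring

/-- Signed error of the approximation `z` of `x`. -/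
def serr (x : Fin 2 → ℝ) (z : RVec) (j : Fin 2) : ℝ := z.2 * x j - z.1 j

lemma serr_neg (x : Fin 2 → ℝ) (z : RVec) (j : Fin 2) : serr x (-z) j = - serr x z j := by
  simp [serr]; ring

lemma offs_eq_serr (x : Fin 2 → ℝ) (u z : RVec) (j : Fin 2) (hu : u.2 ≠ 0) :
    offs j u z = z.2 / u.2 * serr x u j - serr x z j := by
  have : (u.2 : ℝ) ≠ 0 := by exact_mod_cast hu
  simp only [offs, serr]; field_simp; ring

lemma IsComb.serr {α β : ℝ} {a b z : RVec} (h : IsComb α a β b z) (x : Fin 2 → ℝ) (j : Fin 2) :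
    serr x z j = α * serr x a j + β * serr x b j := by
  simp only [_root_.serr, h.1 j, h.2]; ring

/-- Weighted size of the approximation error. -/
noncomputable def werr (w x : Fin 2 → ℝ) (z : RVec) : ℝ :=
  max (|serr x z 0| ^ (1 / w 0)) (|serr x z 1| ^ (1 / w 1))

lemma werr_neg (w x : Fin 2 → ℝ) (z : RVec) : werr w x (-z) = werr w x z := by
  simp [werr, serr_neg]

lemma werr_nonneg (w x : Fin 2 → ℝ) (z : RVec) : 0 ≤ werr w x z :=
  le_max_of_le_left (by positivity)

lemma werr_le_iff {w : Fin 2 → ℝ} (hw : ∀ j, 0 < w j) (x : Fin 2 → ℝ) (z : RVec) {r : ℝ}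
    (hr : 0 ≤ r) : werr w x z ≤ r ↔ ∀ j, |serr x z j| ≤ r ^ w j := by
  simp only [werr, max_le_iff, Fin.forall_fin_two, one_div]
  rw [Real.rpow_inv_le_iff_of_pos (abs_nonneg _) hr (hw 0),
    Real.rpow_inv_le_iff_of_pos (abs_nonneg _) hr (hw 1)]

lemma werr_lt_iff {w : Fin 2 → ℝ} (hw : ∀ j, 0 < w j) (x : Fin 2 → ℝ) (z : RVec) {r : ℝ}
    (hr : 0 ≤ r) : werr w x z < r ↔ ∀ j, |serr x z j| < r ^ w j := by
  simp only [werr, max_lt_iff, Fin.forall_fin_two, one_div]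
  rw [Real.rpow_inv_lt_iff_of_pos (abs_nonneg _) hr (hw 0),
    Real.rpow_inv_lt_iff_of_pos (abs_nonneg _) hr (hw 1)]

lemma exists_serr_eq {w : Fin 2 → ℝ} (hw : ∀ j, 0 < w j) (x : Fin 2 → ℝ) (z : RVec) :
    ∃ j, |serr x z j| = werr w x z ^ w j := by
  by_contra! h
  have h1 := (werr_le_iff hw x z (werr_nonneg w x z)).1 le_rfl
  have h2 := (werr_lt_iff hw x z (werr_nonneg w x z)).2 fun j => lt_of_le_of_ne (h1 j) (h j)
  exact lt_irrefl _ h2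

/-- `U` is a sequence of best approximations of `x`. -/
structure BestSeq (w x : Fin 2 → ℝ) (ε : ℝ) (U : ℕ → RVec) : Prop where
  pos : ∀ k, 0 < (U k).2
  mono : ∀ k, (U k).2 < (U (k + 1)).2
  dec : ∀ k, werr w x (U (k + 1)) < werr w x (U k)
  small : ∀ k, werr w x (U k) < ε / (U (k + 1)).2
  best : ∀ k z, 0 < z.2 → z.2 < (U (k + 1)).2 → werr w x (U k) ≤ werr w x z

lemma exists_record (f : ℕ → ℝ) (hf : ∀ q, 1 ≤ q → 0 < f q)
    (h : ∀ c, 0 < c → ∃ q, 1 ≤ q ∧ f q < c) :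
    ∃ Q : ℕ → ℕ, (∀ k, 1 ≤ Q k) ∧ (∀ k, Q k < Q (k + 1)) ∧ (∀ k, f (Q (k + 1)) < f (Q k)) ∧
      ∀ k q, 1 ≤ q → q < Q (k + 1) → f (Q k) ≤ f q := by
  classical
  have h' : ∀ n : {n : ℕ // 1 ≤ n}, ∃ q, 1 ≤ q ∧ f q < f n.1 := fun n => h _ (hf _ n.2)
  let nxt : {n : ℕ // 1 ≤ n} → {n : ℕ // 1 ≤ n} := fun n =>
    ⟨Nat.find (h' n), (Nat.find_spec (h' n)).1⟩
  let Q : ℕ → {n : ℕ // 1 ≤ n} := fun k => nxt^[k] ⟨1, le_rfl⟩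
  have hQ : ∀ k, Q (k + 1) = nxt (Q k) := fun k => Function.iterate_succ_apply' _ _ _
  have hdec : ∀ k, f (Q (k + 1)).1 < f (Q k).1 := by
    intro k; rw [hQ]; exact (Nat.find_spec (h' (Q k))).2
  have hmin : ∀ k q, 1 ≤ q → q < (Q (k + 1)).1 → f (Q k).1 ≤ f q := by
    intro k q hq1 hq
    rw [hQ] at hq
    have := Nat.find_min (h' (Q k)) hq
    by_contra! hc
    exact this ⟨hq1, hc⟩
  refine ⟨fun k => (Q k).1, fun k => (Q k).2, fun k => ?_, hdec, hmin⟩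
  by_contra! hc
  rcases Nat.eq_zero_or_pos k with rfl | hk
  · have h1 : (Q 0).1 = 1 := rfl
    have h2 := (Q 1).2
    have h3 : (Q 1).1 = (Q 0).1 := by
      simp only [zero_add] at hc; omega
    have := hdec 0
    simp only [zero_add] at this
    rw [h3] at this; exact lt_irrefl _ this
  · obtain ⟨m, rfl⟩ : ∃ m, k = m + 1 := ⟨k - 1, by omega⟩
    rcases hc.lt_or_eq with hc | hc
    · have := hmin m _ (Q (m + 1 + 1)).2 hc
      have h1 := hdec m
      have h2 := hdec (m + 1)
      linarith
    · have := hdec (m + 1)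
      rw [hc] at this; exact lt_irrefl _ this

lemma exists_bestSeq {w x : Fin 2 → ℝ} {ε : ℝ} (hw : ∀ j, 0 < w j)
    (hx : ∀ a b c : ℤ, a * x 0 + b * x 1 + c = 0 → a = 0 ∧ b = 0)
    (hD : ∃ T₀ : ℝ, ∀ T : ℝ, T₀ < T → ∃ z : RVec, 0 < z.2 ∧ (z.2 : ℝ) < T ∧
      werr w x z < ε / T) : ∃ U, BestSeq w x ε U := by
  obtain ⟨T₀, hT₀⟩ := hD
  let g : ℕ → RVec := fun q => (fun j => round (q * x j), q)
  have hg : ∀ z : RVec, 0 < z.2 → werr w x (g z.2.toNat) ≤ werr w x z := by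
    intro z hz
    rw [werr_le_iff hw _ _ (werr_nonneg _ _ _)]
    intro j
    refine le_trans ?_ ((werr_le_iff hw x z (werr_nonneg w x z)).1 le_rfl j)
    have h1 : ((z.2.toNat : ℕ) : ℝ) = z.2 := by
      have : ((z.2.toNat : ℕ) : ℤ) = z.2 := Int.toNat_of_nonneg hz.le
      exact_mod_cast this
    simp only [serr, g, h1]
    have := round_le ((z.2 : ℝ) * x j) (z.1 j)
    have h2 : (((z.2.toNat : ℕ) : ℤ) : ℝ) = z.2 := by exact_mod_cast h1
    rw [h2]
    exact this
  have hpos : ∀ z : RVec, 0 < z.2 → 0 < werr w x z := by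
    intro z hz
    refine lt_of_le_of_ne (werr_nonneg _ _ _) fun h0 => ?_
    have h1 := (werr_le_iff hw x z le_rfl).1 h0.ge 0
    rw [Real.zero_rpow (hw 0).ne'] at h1
    have h2 : serr x z 0 = 0 := abs_eq_zero.1 (le_antisymm h1 (abs_nonneg _))
    have h3 := hx z.2 0 (-z.1 0) (by
      simp only [serr] at h2; push_cast; linarith)
    exact hz.ne' h3.1
  obtain ⟨Q, hQ1, hQm, hQd, hQb⟩ := exists_record (fun q => werr w x (g q))
    (fun q hq => hpos _ (by simp only [g]; omega)) (by
      intro c hc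
      obtain ⟨z, hz, hzT, hzN⟩ := hT₀ (max (T₀ + 1) (max 1 (ε / c)))
        (lt_of_lt_of_le (by linarith) (le_max_left _ _))
      refine ⟨z.2.toNat, by omega, (hg z hz).trans_lt (hzN.trans_le ?_)⟩
      have h1 : 0 < max (T₀ + 1) (max 1 (ε / c)) :=
        lt_of_lt_of_le one_pos ((le_max_left _ _).trans (le_max_right _ _))
      have h2 : ε / c ≤ max (T₀ + 1) (max 1 (ε / c)) := (le_max_right _ _).trans (le_max_right _ _)
      rw [div_le_iff₀ h1]
      rw [div_le_iff₀ hc] at h2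
      linarith)
  have hQmono : StrictMono Q := strictMono_nat_of_lt_succ hQm
  obtain ⟨m, hm⟩ := exists_nat_gt T₀
  have hbest : ∀ k z, 0 < z.2 → z.2 < ((Q (k + 1) : ℕ) : ℤ) →
      werr w x (g (Q k)) ≤ werr w x z := by
    intro k z hz hzk
    exact (hQb k z.2.toNat (by omega) (by omega)).trans (hg z hz)
  refine ⟨fun k => g (Q (k + m)), ⟨fun k => ?_, fun k => ?_, fun k => ?_, fun k => ?_,
    fun k z hz hzk => ?_⟩⟩
  · have := hQ1 (k + m); simp only [g]; omega
  · have := hQm (k + m); simp only [g]; rw [add_right_comm]; exact_mod_cast this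
  · have := hQd (k + m); rw [add_right_comm] at this; simpa using this
  · have h1 : m ≤ Q (k + m + 1) := by
      have := hQmono.id_le (k + m + 1); simp only [id] at this; omega
    obtain ⟨z, hz, hzT, hzN⟩ := hT₀ (Q (k + m + 1)) (hm.trans_le (by exact_mod_cast h1))
    have := hbest (k + m) z hz (by exact_mod_cast hzT)
    rw [add_right_comm k 1 m]
    simpa [g] using this.trans_lt hzN
  · refine hbest (k + m) z hz ?_
    rw [add_right_comm] at hzk
    simpa [g] using hzk

/-- A transition between consecutive turning points of a sequence of best approximations. -/
structure TStep (w : Fin 2 → ℝ) (ε : ℝ) (y y' v u : RVec) (a g : ℤ) : Prop where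
  pos : 0 < y.2
  two : 2 * y.2 ≤ u.2
  le : u.2 ≤ y'.2
  offs_u : ∀ j, |offs j y u| ≤ 2 * (u.2 / y.2) * (ε / u.2) ^ w j
  offs_v : ∀ j, |offs j y v| ≤ 2 * (ε / y.2) ^ w j
  det : det3 y v u ≠ 0
  eq : y' = a • y + g • u
  bound : |g| * u.2 ≤ 4 * y'.2

def IsPrim (y : RVec) : Prop := ∀ z, (∀ j, offs j y z = 0) → ∃ a : ℤ, z = a • y

lemma IsComb.trans {a b c d z : RVec} {α β α₁ β₁ α₂ β₂ : ℝ} (h : IsComb α c β d z)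
    (h₁ : IsComb α₁ a β₁ b c) (h₂ : IsComb α₂ a β₂ b d) :
    IsComb (α * α₁ + β * α₂) a (α * β₁ + β * β₂) b z := by
  refine ⟨fun j => ?_, ?_⟩
  · rw [h.1, h₁.1, h₂.1]; ring
  · rw [h.2, h₁.2, h₂.2]; ring

namespace BestSeq

variable {w x : Fin 2 → ℝ} {ε : ℝ} {U : ℕ → RVec}

lemma anti (h : BestSeq w x ε U) {k l : ℕ} (hkl : k ≤ l) : werr w x (U l) ≤ werr w x (U k) :=
  antitone_nat_of_succ_le (f := fun k => werr w x (U k)) (fun n => (h.dec n).le) hkl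

lemma den_mono (h : BestSeq w x ε U) : StrictMono fun k => (U k).2 :=
  strictMono_nat_of_lt_succ h.mono

lemma werr_pos (h : BestSeq w x ε U) (k : ℕ) : 0 < werr w x (U k) :=
  (werr_nonneg w x _).trans_lt (h.dec k)

lemma serr_le (h : BestSeq w x ε U) (hw : ∀ j, 0 < w j) {k l : ℕ} (hkl : k ≤ l) (j : Fin 2) :
    |serr x (U l) j| ≤ werr w x (U k) ^ w j :=
  (werr_le_iff hw x (U l) (werr_nonneg w x _)).1 (h.anti hkl) j

lemma den_pos (h : BestSeq w x ε U) (k : ℕ) : (0 : ℝ) < (U k).2 := by exact_mod_cast h.pos k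

lemma serr_le' (h : BestSeq w x ε U) (hw : ∀ j, 0 < w j) {k l m : ℕ} (hkl : k ≤ l)
    (hm : m ≤ k + 1) (hε : 0 < ε) (j : Fin 2) :
    |serr x (U l) j| ≤ (ε / (U m).2) ^ w j := by
  refine (h.serr_le hw hkl j).trans
    (Real.rpow_le_rpow (werr_nonneg _ _ _) ((h.small k).le.trans ?_) (hw j).le)
  have : ((U m).2 : ℝ) ≤ (U (k + 1)).2 := by exact_mod_cast h.den_mono.monotone hm
  have := h.den_pos m
  gcongr

lemma eq_zero_of_isComb (h : BestSeq w x ε U) (hw : ∀ j, 0 < w j) {k : ℕ} {α β : ℝ}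
    (hc : IsComb α (U k) β (U (k + 1)) 0) : α = 0 ∧ β = 0 := by
  have hq := h.den_pos k
  have hq1 := h.den_pos (k + 1)
  have hlt : ((U k).2 : ℝ) < (U (k + 1)).2 := by exact_mod_cast h.mono k
  have h2 := hc.2
  simp only [Prod.snd_zero, Int.cast_zero] at h2
  by_cases hα : α = 0
  · subst hα
    refine ⟨rfl, ?_⟩
    have : β * (U (k + 1)).2 = 0 := by linarith
    exact (mul_eq_zero.1 this).resolve_right hq1.ne'
  exfalso
  have key : ∀ j, |serr x (U k) j| ≤ |serr x (U (k + 1)) j| := by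
    intro j
    have h3 := hc.serr x j
    have h0 : serr x 0 j = 0 := by simp [_root_.serr]
    rw [h0] at h3
    have h4 : serr x (U k) j * (U (k + 1)).2 = (U k).2 * serr x (U (k + 1)) j := by
      apply mul_left_cancel₀ hα
      linear_combination (-(U (k+1)).2 : ℝ) * h3 + serr x (U (k + 1)) j * h2
    have h5 : |serr x (U k) j| * (U (k + 1)).2 = (U k).2 * |serr x (U (k + 1)) j| := by
      have := congrArg abs h4
      rwa [abs_mul, abs_mul, abs_of_pos hq, abs_of_pos hq1] at this
    nlinarith [abs_nonneg (serr x (U (k + 1)) j)]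
  have := (werr_le_iff hw x (U k) (werr_nonneg w x (U (k + 1)))).2 fun j =>
    (key j).trans (h.serr_le hw le_rfl j)
  exact absurd (h.dec k) (not_lt.2 this)

lemma exists_offs_ne (h : BestSeq w x ε U) (hw : ∀ j, 0 < w j) (k : ℕ) :
    ∃ j, offs j (U k) (U (k + 1)) ≠ 0 := by
  by_contra! hc
  have hq := h.den_pos k
  have := h.eq_zero_of_isComb hw (k := k) (α := (U (k + 1)).2 / (U k).2) (β := -1)
    ⟨fun j => ?_, ?_⟩
  · exact absurd this.2 (by norm_num)
  · have := hc j
    simp only [offs] at this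
    field_simp at this ⊢
    simp; linarith
  · field_simp; simp

lemma exists_int (h : BestSeq w x ε U) (hw : ∀ j, 0 < w j) (hε1 : ε ≤ 1) {k : ℕ}
    {α β : ℝ} {z : RVec} (hc : IsComb α (U k) β (U (k + 1)) z) :
    ∃ a b : ℤ, α = a ∧ β = b := by
  have hq := h.den_pos k
  have hq1 := h.den_pos (k + 1)
  have hlt : ((U k).2 : ℝ) < (U (k + 1)).2 := by exact_mod_cast h.mono k
  set α' := α - round α with hα'
  set β' := β - round β with hβ'
  have hα1 : |α'| ≤ 1 / 2 := abs_sub_round α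
  have hβ1 : |β'| ≤ 1 / 2 := abs_sub_round β
  set z' : RVec := z - round α • U k - round β • U (k + 1) with hz'
  have hc' : IsComb α' (U k) β' (U (k + 1)) z' := by
    refine ⟨fun j => ?_, ?_⟩
    · have := hc.1 j
      simp [hz', hα', hβ', this]; ring
    · have := hc.2
      simp [hz', hα', hβ', this]; ring
  have herr : werr w x z' < werr w x (U k) := by
    rw [werr_lt_iff hw _ _ (werr_nonneg _ _ _)]
    intro j
    rw [hc'.serr x j]
    have h1 := h.serr_le hw (le_refl k) j
    have h2 := (werr_lt_iff hw x (U (k + 1)) (werr_nonneg w x _)).1 (h.dec k) j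
    have h3 := abs_add_le (α' * serr x (U k) j) (β' * serr x (U (k + 1)) j)
    rw [abs_mul, abs_mul] at h3
    have h4 := mul_le_mul_of_nonneg_right hα1 (abs_nonneg (serr x (U k) j))
    have h5 := mul_le_mul_of_nonneg_right hβ1 (abs_nonneg (serr x (U (k + 1)) j))
    linarith
  have hden : |(z'.2 : ℝ)| < (U (k + 1)).2 := by
    rw [hc'.2]
    have h3 := abs_add_le (α' * (U k).2) (β' * (U (k + 1)).2)
    rw [abs_mul, abs_mul, abs_of_pos hq, abs_of_pos hq1] at h3
    have h4 := mul_le_mul_of_nonneg_right hα1 hq.le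
    have h5 := mul_le_mul_of_nonneg_right hβ1 hq1.le
    linarith
  have hden' := abs_lt.1 hden
  have hzero : z'.2 = 0 := by
    rcases lt_trichotomy z'.2 0 with hneg | h0 | hpos
    · have h1 := h.best k (-z') (by simpa using hneg) (by
        have : -((U (k + 1)).2 : ℝ) < z'.2 := hden'.1
        have : -((U (k + 1)).2) < z'.2 := by exact_mod_cast this
        simp only [Prod.snd_neg]; omega)
      rw [werr_neg] at h1
      exact absurd herr (not_lt.2 h1)
    · exact h0
    · have h1 := h.best k z' hpos (by exact_mod_cast hden'.2)
      exact absurd herr (not_lt.2 h1)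
  have hsmall : werr w x (U k) < 1 := by
    refine (h.small k).trans_le ?_
    rw [div_le_one hq1]
    have : (1 : ℝ) ≤ (U (k + 1)).2 := by exact_mod_cast h.pos (k + 1)
    linarith
  have hz0 : z' = 0 := by
    refine Prod.ext (funext fun j => ?_) hzero
    have h1 := (werr_lt_iff hw x z' zero_le_one).1 (herr.trans hsmall) j
    rw [Real.one_rpow] at h1
    simp only [serr, hzero, Int.cast_zero, zero_mul, zero_sub, abs_neg] at h1
    have : |z'.1 j| < 1 := by exact_mod_cast h1
    exact Int.abs_lt_one_iff.1 this
  rw [hz0] at hc'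
  obtain ⟨h1, h2⟩ := h.eq_zero_of_isComb hw hc'
  exact ⟨round α, round β, by linarith, by linarith⟩

lemma isPrim (h : BestSeq w x ε U) (hw : ∀ j, 0 < w j) (hε1 : ε ≤ 1) (k : ℕ) :
    IsPrim (U k) := by
  intro z hz
  have hq := h.den_pos k
  have hc : IsComb (z.2 / (U k).2) (U k) 0 (U (k + 1)) z := by
    refine ⟨fun j => ?_, ?_⟩
    · have := hz j
      simp only [offs] at this
      field_simp at this ⊢
      linarith
    · field_simp; simp
  obtain ⟨a, b, ha, hb⟩ := h.exists_int hw hε1 hc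
  refine ⟨a, Prod.ext (funext fun j => ?_) ?_⟩
  · have := hc.1 j
    rw [ha] at this
    simp only [zero_mul, add_zero] at this
    simp; exact_mod_cast this
  · have := hc.2
    rw [ha] at this
    simp only [zero_mul, add_zero] at this
    simp; exact_mod_cast this

/-- `U (i + 1)` is a turning point. -/
def Turn (U : ℕ → RVec) (i : ℕ) : Prop := det3 (U i) (U (i + 1)) (U (i + 2)) ≠ 0

lemma exists_isComb (h : BestSeq w x ε U) (hw : ∀ j, 0 < w j) {k m : ℕ} (hkm : k ≤ m)
    (hT : ∀ i, k ≤ i → i < m → ¬ Turn U i) :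
    (∃ α β, IsComb α (U k) β (U (k + 1)) (U m)) ∧
      ∃ α β, IsComb α (U k) β (U (k + 1)) (U (m + 1)) := by
  induction m, hkm using Nat.le_induction with
  | base => exact ⟨⟨1, 0, by constructor <;> simp⟩, ⟨0, 1, by constructor <;> simp⟩⟩
  | succ m hm ih =>
    obtain ⟨⟨α, β, h1⟩, ⟨α', β', h2⟩⟩ := ih fun i hi him => hT i hi (by omega)
    refine ⟨⟨α', β', h2⟩, ?_⟩
    have h3 := not_not.1 (hT m hm (by omega))
    obtain ⟨γ, δ, h4⟩ := isComb_of_det3 _ _ _ (h.pos m).ne' (h.exists_offs_ne hw m) h3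
    exact ⟨_, _, h4.trans h1 h2⟩

lemma exists_turn (h : BestSeq w x ε U) (hw : ∀ j, 0 < w j) (hε1 : ε ≤ 1)
    (hx : ∀ a b c : ℤ, a * x 0 + b * x 1 + c = 0 → a = 0 ∧ b = 0) (K : ℕ) :
    ∃ i, K ≤ i ∧ Turn U i := by
  by_contra! hc
  set a := U K
  set b := U (K + 1)
  have hq : (0 : ℝ) < a.2 := h.den_pos K
  have hdet : ∀ m, K ≤ m → det3 a b (U m) = 0 := by
    intro m hm
    obtain ⟨⟨α, β, h1⟩, -⟩ := h.exists_isComb hw hm fun i hi _ => hc i hi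
    have : (det3 a b (U m) : ℝ) = 0 := by
      simp only [det3]; push_cast
      rw [h1.1, h1.1, h1.2]; ring
    exact_mod_cast this
  set h0 := a.1 1 * b.2 - a.2 * b.1 1
  set h1 := a.2 * b.1 0 - a.1 0 * b.2
  set h2 := a.1 0 * b.1 1 - a.1 1 * b.1 0
  have hlin : ∀ m, K ≤ m → ((U m).2 : ℝ) * |h0 * x 0 + h1 * x 1 + h2| ≤ |(h0 : ℝ)| + |(h1 : ℝ)| := by
    intro m hm
    have e1 : (h0 * (U m).1 0 + h1 * (U m).1 1 + h2 * (U m).2 : ℝ) = 0 := by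
      have := hdet m hm
      simp only [det3] at this
      have e2 : (h0 * (U m).1 0 + h1 * (U m).1 1 + h2 * (U m).2) = 0 := by
        simp only [h0, h1, h2]; linear_combination this
      exact_mod_cast e2
    have hsm : ∀ j, |serr x (U m) j| ≤ 1 := by
      intro j
      refine (h.serr_le hw le_rfl j).trans (Real.rpow_le_one (werr_nonneg _ _ _) ?_ (hw j).le)
      refine (h.small m).le.trans ?_
      rw [div_le_one (h.den_pos _)]
      have : (1 : ℝ) ≤ (U (m + 1)).2 := by exact_mod_cast h.pos (m + 1)
      linarith
    rw [← abs_of_pos (h.den_pos m), ← abs_mul]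
    have e3 : ((U m).2 : ℝ) * (h0 * x 0 + h1 * x 1 + h2) =
        h0 * serr x (U m) 0 + h1 * serr x (U m) 1 := by
      simp only [serr]; linear_combination e1
    rw [e3]
    refine (abs_add_le _ _).trans ?_
    rw [abs_mul, abs_mul]
    have := mul_le_mul_of_nonneg_left (hsm 0) (abs_nonneg (h0 : ℝ))
    have := mul_le_mul_of_nonneg_left (hsm 1) (abs_nonneg (h1 : ℝ))
    linarith
  have hz : (h0 : ℝ) * x 0 + h1 * x 1 + h2 = 0 := by
    by_contra hne
    have hp := abs_pos.2 hne
    obtain ⟨n, hn⟩ := exists_nat_gt ((|(h0 : ℝ)| + |(h1 : ℝ)|) / |h0 * x 0 + h1 * x 1 + h2|)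
    rw [div_lt_iff₀ hp] at hn
    have e1 := hlin (max K n) (le_max_left _ _)
    have e2 : (n : ℤ) ≤ (U (max K n)).2 := by
      have : ∀ k : ℕ, (k : ℤ) ≤ (U k).2 := by
        intro k
        induction k with
        | zero => exact_mod_cast (h.pos 0).le
        | succ k ih => have := h.mono k; push_cast; omega
      exact (Int.ofNat_le.2 (le_max_right K n)).trans (this _)
    have e3 : (n : ℝ) ≤ (U (max K n)).2 := by exact_mod_cast e2
    nlinarith
  obtain ⟨z0, z1⟩ := hx h0 h1 h2 hz
  obtain ⟨j, hj⟩ := h.exists_offs_ne hw K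
  apply hj
  have r0 : (a.1 1 * b.2 - a.2 * b.1 1 : ℝ) = 0 := by exact_mod_cast z0
  have r1 : (a.2 * b.1 0 - a.1 0 * b.2 : ℝ) = 0 := by exact_mod_cast z1
  change (b.1 j : ℝ) - b.2 * (a.1 j / a.2) = 0
  fin_cases j
  · simp; field_simp; linarith
  · simp; field_simp; linarith

lemma tstep (h : BestSeq w x ε U) (hw : ∀ j, 0 < w j) (hs : w 0 + w 1 = 1) (hε : 0 < ε)
    (hε1 : ε ≤ 1 / 16) {i l : ℕ} (hil : i < l) (hi : Turn U i)
    (hT : ∀ m, i < m → m < l → ¬ Turn U m) :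
    ∃ a g, TStep w ε (U (i + 1)) (U (l + 1)) (U i) (U (i + 2)) a g := by
  set y := U (i + 1)
  set u := U (i + 2)
  set v := U i
  set y' := U (l + 1)
  have hq : (0 : ℝ) < y.2 := h.den_pos _
  have hqu : (0 : ℝ) < u.2 := h.den_pos _
  have hqv : (0 : ℝ) < v.2 := h.den_pos _
  have hq' : (0 : ℝ) < y'.2 := h.den_pos _
  have hqne : y.2 ≠ 0 := (h.pos _).ne'
  have hyu : (y.2 : ℝ) < u.2 := by exact_mod_cast h.mono (i + 1)
  have hvy : (v.2 : ℝ) < y.2 := by exact_mod_cast h.mono i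
  have huy' : u.2 ≤ y'.2 := h.den_mono.monotone (by omega : i + 2 ≤ l + 1)
  have hou : ∀ j, |offs j y u| ≤ 2 * (u.2 / y.2) * (ε / u.2) ^ w j := by
    intro j
    rw [offs_eq_serr x _ _ _ hqne]
    have e1 : |serr x y j| ≤ (ε / u.2) ^ w j := h.serr_le' hw le_rfl le_rfl hε j
    have e2 : |serr x u j| ≤ (ε / u.2) ^ w j := h.serr_le' hw (by omega : i + 1 ≤ i + 2) le_rfl hε j
    refine (abs_sub _ _).trans ?_
    rw [abs_mul, abs_of_pos (div_pos hqu hq)]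
    have e3 := mul_le_mul_of_nonneg_left e1 (div_pos hqu hq).le
    have e4 : 1 ≤ (u.2 : ℝ) / y.2 := by rw [one_le_div hq]; exact hyu.le
    have e5 : 0 ≤ (ε / u.2) ^ w j := by positivity
    nlinarith
  have hov : ∀ j, |offs j y v| ≤ 2 * (ε / y.2) ^ w j := by
    intro j
    rw [offs_eq_serr x _ _ _ hqne]
    have e1 : |serr x y j| ≤ (ε / y.2) ^ w j :=
      h.serr_le' hw (le_refl (i + 1)) (by omega) hε j
    have e2 : |serr x v j| ≤ (ε / y.2) ^ w j := h.serr_le' hw (le_refl i) le_rfl hε j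
    refine (abs_sub _ _).trans ?_
    rw [abs_mul, abs_of_pos (div_pos hqv hq)]
    have e4 : (v.2 : ℝ) / y.2 ≤ 1 := by rw [div_le_one hq]; exact hvy.le
    have e5 := mul_le_mul_of_nonneg_right e4 (abs_nonneg (serr x y j))
    linarith
  have hdet : det3 y v u ≠ 0 := by
    intro h0
    apply hi
    change det3 v y u = 0
    simp only [det3] at h0 ⊢; linarith
  have htwo : 2 * y.2 ≤ u.2 := by
    have e1 : (1 : ℝ) ≤ |(det3 y v u : ℝ)| := by exact_mod_cast Int.one_le_abs hdet
    rw [det3_eq_offs _ _ _ hqne, abs_mul, abs_of_pos hq] at e1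
    have e2 : |offs 0 y v * offs 1 y u - offs 1 y v * offs 0 y u| ≤ 8 * (ε / y.2) * (u.2 / y.2) := by
      refine (abs_sub _ _).trans ?_
      rw [abs_mul, abs_mul]
      have hmono : ∀ j, (ε / u.2) ^ w j ≤ (ε / y.2) ^ w j := fun j =>
        Real.rpow_le_rpow (by positivity) (by gcongr) (hw j).le
      have hou' : ∀ j, |offs j y u| ≤ 2 * (u.2 / y.2) * (ε / y.2) ^ w j := fun j =>
        (hou j).trans (by have := hmono j; gcongr)
      have hprod : (ε / y.2 : ℝ) ^ w 0 * (ε / y.2) ^ w 1 = ε / y.2 := by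
        rw [← Real.rpow_add (by positivity), hs, Real.rpow_one]
      have m1 := mul_le_mul (hov 0) (hou' 1) (abs_nonneg _) (by positivity)
      have m2 := mul_le_mul (hov 1) (hou' 0) (abs_nonneg _) (by positivity)
      calc _ ≤ _ := add_le_add m1 m2
        _ = 8 * ((ε / y.2 : ℝ) ^ w 0 * (ε / y.2) ^ w 1) * (u.2 / y.2) := by ring
        _ = _ := by rw [hprod]
    have e3 := mul_le_mul_of_nonneg_left e2 hq.le
    have e4 : (y.2 : ℝ) * (8 * (ε / y.2) * (u.2 / y.2)) = 8 * ε * u.2 / y.2 := by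
      field_simp
    rw [e4] at e3
    have e5 := e1.trans e3
    rw [le_div_iff₀ hq] at e5
    have : (2 * y.2 : ℝ) ≤ u.2 := by nlinarith
    exact_mod_cast this
  obtain ⟨-, α, β, hcomb⟩ := h.exists_isComb hw (k := i + 1) (m := l) (by omega)
    fun m hm hml => hT m (by omega) hml
  obtain ⟨a, g, rfl, rfl⟩ := h.exists_int hw (by linarith) hcomb
  have heq : y' = a • y + g • u := by
    refine Prod.ext (funext fun j => ?_) ?_
    · have := hcomb.1 j
      simp; exact_mod_cast this
    · have := hcomb.2
      simp; exact_mod_cast this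
  refine ⟨a, g, h.pos _, htwo, huy', hou, hov, hdet, heq, ?_⟩
  obtain ⟨j, hj⟩ := exists_serr_eq hw x y
  have hEpos : 0 < |serr x y j| := by rw [hj]; exact Real.rpow_pos_of_pos (h.werr_pos _) _
  have hoff : offs j y y' = g * offs j y u := by
    rw [heq, offs_add, offs_smul, offs_smul, offs_self _ _ hqne]; ring
  have e1 : |serr x y' j| ≤ |serr x y j| := by
    rw [hj]; exact h.serr_le hw (by omega : i + 1 ≤ l + 1) j
  have e2 : |serr x u j| ≤ |serr x y j| := by
    rw [hj]; exact h.serr_le hw (by omega : i + 1 ≤ i + 2) j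
  have htwo' : (2 * y.2 : ℝ) ≤ u.2 := by exact_mod_cast htwo
  have huy'' : (u.2 : ℝ) ≤ y'.2 := by exact_mod_cast huy'
  have e3 : |offs j y y'| ≤ 2 * (y'.2 / y.2) * |serr x y j| := by
    rw [offs_eq_serr x _ _ _ hqne]
    refine (abs_sub _ _).trans ?_
    rw [abs_mul, abs_of_pos (div_pos hq' hq)]
    have e4 : 1 ≤ (y'.2 : ℝ) / y.2 := by rw [one_le_div hq]; linarith
    nlinarith
  have e4 : 1 / 2 * (u.2 / y.2) * |serr x y j| ≤ |offs j y u| := by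
    rw [offs_eq_serr x _ _ _ hqne]
    have t := abs_sub_abs_le_abs_sub (u.2 / y.2 * serr x y j) (serr x u j)
    rw [abs_mul, abs_of_pos (div_pos hqu hq)] at t
    have e5 : 2 ≤ (u.2 : ℝ) / y.2 := by rw [le_div_iff₀ hq]; exact htwo'
    nlinarith
  rw [hoff, abs_mul] at e3
  have e5 := mul_le_mul_of_nonneg_left e4 (abs_nonneg (g : ℝ))
  have e6 := e5.trans e3
  have e7 : |(g : ℝ)| * u.2 ≤ 4 * y'.2 := by
    have e8 : |(g : ℝ)| * (1 / 2 * (u.2 / y.2) * |serr x y j|) =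
      (|(g : ℝ)| * u.2) * (|serr x y j| / (2 * y.2)) := by field_simp
    have e9 : 2 * (y'.2 / y.2) * |serr x y j| = (4 * y'.2) * (|serr x y j| / (2 * y.2)) := by
      field_simp; ring
    rw [e8, e9] at e6
    exact le_of_mul_le_mul_right e6 (by positivity)
  exact_mod_cast e7

lemma exists_chain (h : BestSeq w x ε U) (hw : ∀ j, 0 < w j) (hs : w 0 + w 1 = 1) (hε : 0 < ε)
    (hε1 : ε ≤ 1 / 16)
    (hx : ∀ a b c : ℤ, a * x 0 + b * x 1 + c = 0 → a = 0 ∧ b = 0) :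
    ∃ Y : ℕ → RVec, ∀ i, IsPrim (Y i) ∧ (∀ j, |serr x (Y i) j| ≤ (ε / (Y i).2) ^ w j) ∧
      ∃ v u a g, TStep w ε (Y i) (Y (i + 1)) v u a g := by
  classical
  have hinf : {i | Turn U i}.Infinite :=
    Set.infinite_of_forall_exists_gt fun K => by
      obtain ⟨i, hi, hT⟩ := h.exists_turn hw (by linarith) hx (K + 1)
      exact ⟨i, hT, by omega⟩
  have hmono := Nat.nth_strictMono hinf
  refine ⟨fun n => U (Nat.nth (Turn U) n + 1), fun n => ⟨h.isPrim hw (by linarith) _,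
    fun j => h.serr_le' hw le_rfl (by omega) hε j, U (Nat.nth (Turn U) n),
    U (Nat.nth (Turn U) n + 2), ?_⟩⟩
  refine h.tstep hw hs hε hε1 (hmono (Nat.lt_succ_self n)) (Nat.nth_mem_of_infinite hinf n) ?_
  intro m hm1 hm2 hm
  rw [← Nat.nth_count hm] at hm1 hm2
  have := hmono.lt_iff_lt.1 hm1
  have := hmono.lt_iff_lt.1 hm2
  omega

end BestSeq

/-- Representatives modulo `y` of the vectors whose offset from `y` is at most `K`. -/
def offsBox (y : RVec) (K : Fin 2 → ℝ) : Set RVec :=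
  {z | 0 ≤ z.2 ∧ z.2 < y.2 ∧ ∀ j, |offs j y z| ≤ K j}

lemma offsBox_finite (y : RVec) (hy : 0 < y.2) (K : Fin 2 → ℝ) : (offsBox y K).Finite := by
  have hfin : ((Set.univ.pi fun j : Fin 2 => Set.Icc (-⌈K j + |(y.1 j : ℝ)|⌉) ⌈K j + |(y.1 j : ℝ)|⌉)
      ×ˢ Set.Icc 0 y.2 : Set RVec).Finite :=
    (Set.Finite.pi fun j => Set.finite_Icc _ _).prod (Set.finite_Icc _ _)
  refine hfin.subset ?_
  rintro z ⟨h0, h1, h2⟩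
  refine ⟨fun j _ => ?_, h0, h1.le⟩
  have hq : (0 : ℝ) < y.2 := by exact_mod_cast hy
  have h0' : (0 : ℝ) ≤ z.2 := by exact_mod_cast h0
  have h1' : (z.2 : ℝ) < y.2 := by exact_mod_cast h1
  have e1 : |(z.1 j : ℝ)| ≤ K j + |(y.1 j : ℝ)| := by
    have e2 : (z.1 j : ℝ) = offs j y z + z.2 / y.2 * y.1 j := by
      simp only [offs]; field_simp; ring
    rw [e2]
    refine (abs_add_le _ _).trans (add_le_add (h2 j) ?_)
    rw [abs_mul, abs_of_nonneg (div_nonneg h0' hq.le)]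
    exact mul_le_of_le_one_left (abs_nonneg _) (by rw [div_le_one hq]; exact h1'.le)
  have e3 := abs_le.1 (e1.trans (Int.le_ceil _))
  constructor
  · exact_mod_cast e3.1
  · exact_mod_cast e3.2

lemma emod_mem_offsBox {y z : RVec} (hy : 0 < y.2) {K : Fin 2 → ℝ}
    (hz : ∀ j, |offs j y z| ≤ K j) : z - (z.2 / y.2) • y ∈ offsBox y K := by
  have e : ∀ j, offs j y (z - (z.2 / y.2) • y) = offs j y z := by
    intro j; rw [offs_sub, offs_smul, offs_self j y hy.ne']; ring
  refine ⟨?_, ?_, fun j => by rw [e]; exact hz j⟩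
  · have := Int.emod_nonneg z.2 hy.ne'
    rw [Int.emod_def] at this
    simpa [mul_comm] using this
  · have := Int.emod_lt_of_pos z.2 hy
    rw [Int.emod_def] at this
    simpa [mul_comm] using this

lemma det3_sub (u v a b : RVec) : det3 u v (a - b) = det3 u v a - det3 u v b := by
  simp only [det3, Prod.fst_sub, Prod.snd_sub, Pi.sub_apply]; ring

lemma ncard_offsBox_le {y : RVec} (hy : 0 < y.2) (hprim : IsPrim y) {K : Fin 2 → ℝ}
    (hK : ∀ j, 0 < K j) {v u : RVec} (hv : ∀ j, |offs j y v| ≤ K j)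
    (hu : ∀ j, |offs j y u| ≤ K j) (hdet : det3 y v u ≠ 0) :
    ((offsBox y K).ncard : ℝ) ≤ 24 * (y.2 * K 0 * K 1) := by
  have hq : (0 : ℝ) < y.2 := by exact_mod_cast hy
  have hfin := offsBox_finite y hy K
  set f : RVec → ℝ := fun z => max (|offs 0 y z| / K 0) (|offs 1 y z| / K 1) with hf
  have hfle : ∀ z r, f z ≤ r ↔ ∀ j, |offs j y z| ≤ r * K j := by
    intro z r
    simp only [hf, max_le_iff, Fin.forall_fin_two, div_le_iff₀ (hK _)]
  have hflt : ∀ z r, f z < r ↔ ∀ j, |offs j y z| < r * K j := by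
    intro z r
    simp only [hf, max_lt_iff, Fin.forall_fin_two, div_lt_iff₀ (hK _)]
  have hred : ∀ z j, offs j y (z - (z.2 / y.2) • y) = offs j y z := by
    intro z j; rw [offs_sub, offs_smul, offs_self j y hy.ne']; ring
  have hv0 : ∃ j, offs j y v ≠ 0 := by
    by_contra! hc
    apply hdet
    have := det3_eq_offs y v u hy.ne'
    rw [hc, hc] at this
    have : (det3 y v u : ℝ) = 0 := by rw [this]; ring
    exact_mod_cast this
  obtain ⟨z₁, ⟨hz₁, j₀, hj₀⟩, hmin⟩ := Set.exists_min_image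
    (offsBox y K ∩ {z | ∃ j, offs j y z ≠ 0}) f (hfin.subset Set.inter_subset_left)
    ⟨_, emod_mem_offsBox hy hv, by
      obtain ⟨j, hj⟩ := hv0
      exact ⟨j, by rw [hred]; exact hj⟩⟩
  set l := f z₁ with hl
  have hl1 : l ≤ 1 := (hfle z₁ 1).2 fun j => by rw [one_mul]; exact hz₁.2.2 j
  have hl0 : 0 < l := by
    have h1 := (hfle z₁ l).1 le_rfl j₀
    have h2 := abs_pos.2 hj₀
    exact pos_of_mul_pos_left (h2.trans_le h1) (hK _).le
  have hminall : ∀ z, f z < l → ∀ j, offs j y z = 0 := by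
    intro z hz
    by_contra! hc
    obtain ⟨j, hj⟩ := hc
    have h1 := hmin (z - (z.2 / y.2) • y) ⟨emod_mem_offsBox hy (fun j => by
      simpa using (hfle z 1).1 (hz.le.trans hl1) j), j, by rw [hred]; exact hj⟩
    have h2 : f (z - (z.2 / y.2) • y) = f z := by simp only [hf, hred]
    linarith
  obtain ⟨j, hj⟩ : ∃ j, |offs j y z₁| = l * K j := by
    by_contra! hc
    have h1 := (hfle z₁ l).1 le_rfl
    have := (hflt z₁ l).2 fun j => lt_of_le_of_ne (h1 j) (hc j)
    exact lt_irrefl _ this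
  have hjpos : 0 < |offs j y z₁| := by rw [hj]; exact mul_pos hl0 (hK j)
  have hjne : offs j y z₁ ≠ 0 := abs_pos.1 hjpos
  set D := 2 * (y.2 * l * (K 0 * K 1)) with hD
  have hdetle : ∀ p, (∀ j, |offs j y p| ≤ K j) → |(det3 y z₁ p : ℝ)| ≤ D := by
    intro p hp
    rw [det3_eq_offs _ _ _ hy.ne', abs_mul, abs_of_pos hq]
    have h1 := (hfle z₁ l).1 le_rfl
    have m1 := mul_le_mul (h1 0) (hp 1) (abs_nonneg _) (mul_pos hl0 (hK 0)).le
    have m2 := mul_le_mul (h1 1) (hp 0) (abs_nonneg _) (mul_pos hl0 (hK 1)).le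
    have := abs_sub (offs 0 y z₁ * offs 1 y p) (offs 1 y z₁ * offs 0 y p)
    rw [abs_mul, abs_mul] at this
    have := mul_le_mul_of_nonneg_left (this.trans (add_le_add m1 m2)) hq.le
    refine this.trans (le_of_eq ?_)
    rw [hD]; ring
  have hprop : ∀ d, det3 y z₁ d = 0 → ∀ i, offs i y d = offs j y d / offs j y z₁ * offs i y z₁ := by
    intro d hd i
    have h1 := det3_eq_offs y z₁ d hy.ne'
    rw [hd, Int.cast_zero] at h1
    have h2 := (mul_eq_zero.1 h1.symm).resolve_left hq.ne'
    rw [div_mul_eq_mul_div, eq_div_iff hjne]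
    fin_cases j <;> fin_cases i <;> simp <;> linarith
  have hD1 : 1 ≤ D := by
    by_contra! hc
    have hz : ∀ p, (∀ j, |offs j y p| ≤ K j) → det3 y z₁ p = 0 := by
      intro p hp
      have := (hdetle p hp).trans_lt hc
      exact Int.abs_lt_one_iff.1 (by exact_mod_cast this)
    have pv := hprop v (hz v hv)
    have pu := hprop u (hz u hu)
    apply hdet
    have h1 := det3_eq_offs y v u hy.ne'
    rw [pv 0, pv 1, pu 0, pu 1] at h1
    have : (det3 y v u : ℝ) = 0 := by rw [h1]; ring
    exact_mod_cast this
  have hcard : (offsBox y K).ncard ≤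
      (((Finset.Icc (-⌊D⌋) ⌊D⌋) ×ˢ (Finset.Icc ⌊-(1 / l)⌋ ⌊1 / l⌋) : Finset (ℤ × ℤ)) : Set (ℤ × ℤ)).ncard := by
    refine Set.ncard_le_ncard_of_injOn
      (fun p => (det3 y z₁ p, ⌊offs j y p / offs j y z₁⌋)) ?_ ?_ (Finset.finite_toSet _)
    · intro p hp
      have h1 := abs_le.1 (hdetle p hp.2.2)
      have h2 : |offs j y p / offs j y z₁| ≤ 1 / l := by
        rw [abs_div, hj, div_le_div_iff₀ (mul_pos hl0 (hK j)) hl0]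
        nlinarith [hp.2.2 j]
      have h3 := abs_le.1 h2
      simp only [Finset.coe_product, Finset.coe_Icc, Set.mem_prod, Set.mem_Icc]
      refine ⟨⟨?_, Int.le_floor.2 h1.2⟩, Int.floor_le_floor h3.1, Int.floor_le_floor h3.2⟩
      have : -(det3 y z₁ p) ≤ ⌊D⌋ := Int.le_floor.2 (by push_cast; linarith)
      linarith
    · intro p hp p' hp' heq
      simp only [Prod.mk.injEq] at heq
      have hd0 : det3 y z₁ (p - p') = 0 := by rw [det3_sub, heq.1, sub_self]
      have h1 := Int.abs_sub_lt_one_of_floor_eq_floor heq.2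
      rw [← sub_div, ← offs_sub] at h1
      have h2 := hminall (p - p') ((hflt _ _).2 fun i => by
        rw [hprop _ hd0 i, abs_mul]
        have h3 := (hfle z₁ l).1 le_rfl i
        have h4 := mul_pos hl0 (hK i)
        rcases (abs_nonneg (offs i y z₁)).eq_or_lt with h5 | h5
        · rw [← h5, mul_zero]; exact h4
        · nlinarith)
      obtain ⟨a, ha⟩ := hprim _ h2
      have ha2 : p.2 - p'.2 = a * y.2 := by
        have := congrArg Prod.snd ha
        simpa using this
      have ha0 : a = 0 := by
        have := hp.1; have := hp.2.1; have := hp'.1; have := hp'.2.1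
        have hlt : |a * y.2| < y.2 := by rw [← ha2, abs_lt]; constructor <;> linarith
        rw [abs_mul, abs_of_pos hy] at hlt
        have : |a| < 1 := by nlinarith
        exact Int.abs_lt_one_iff.1 this
      rw [ha0, zero_smul] at ha
      exact sub_eq_zero.1 ha
  have hcard' : ((offsBox y K).ncard : ℝ) ≤ (2 * D + 1) * (2 / l + 2) := by
    rw [Set.ncard_coe_finset, Finset.card_product, Int.card_Icc, Int.card_Icc] at hcard
    have h1 : ((⌊D⌋ + 1 - -⌊D⌋).toNat : ℝ) ≤ 2 * D + 1 := by
      have h2 : ((⌊D⌋ + 1 - -⌊D⌋).toNat : ℤ) = 2 * ⌊D⌋ + 1 := by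
        have : 0 ≤ ⌊D⌋ := Int.floor_nonneg.2 (by linarith)
        omega
      have h3 : ((⌊D⌋ + 1 - -⌊D⌋).toNat : ℝ) = 2 * ⌊D⌋ + 1 := by exact_mod_cast h2
      rw [h3]; linarith [Int.floor_le D]
    have h2 : ((⌊1 / l⌋ + 1 - ⌊-(1 / l)⌋).toNat : ℝ) ≤ 2 / l + 2 := by
      have hl' : 0 < 1 / l := by positivity
      have h2 : ((⌊1 / l⌋ + 1 - ⌊-(1 / l)⌋).toNat : ℤ) = ⌊1 / l⌋ + 1 - ⌊-(1 / l)⌋ := by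
        have : ⌊-(1 / l)⌋ ≤ ⌊1 / l⌋ := Int.floor_le_floor (by linarith)
        omega
      have h3 : ((⌊1 / l⌋ + 1 - ⌊-(1 / l)⌋).toNat : ℝ) = ⌊1 / l⌋ + 1 - ⌊-(1 / l)⌋ := by
        exact_mod_cast h2
      rw [h3]
      have := Int.floor_le (1 / l)
      have := Int.sub_one_lt_floor (-(1 / l))
      have : 2 / l = 2 * (1 / l) := by ring
      linarith
    have h3 : ((offsBox y K).ncard : ℝ) ≤
        ((⌊D⌋ + 1 - -⌊D⌋).toNat : ℝ) * ((⌊1 / l⌋ + 1 - ⌊-(1 / l)⌋).toNat : ℝ) := by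
      exact_mod_cast hcard
    exact h3.trans (mul_le_mul h1 h2 (by positivity) (by linarith))
  have e1 : 2 / l + 2 ≤ 4 / l := by
    have : 1 ≤ 1 / l := by rw [le_div_iff₀ hl0]; linarith
    have h2 : 2 / l = 2 * (1 / l) := by ring
    have h4 : 4 / l = 4 * (1 / l) := by ring
    linarith
  calc _ ≤ _ := hcard'
    _ ≤ (3 * D) * (4 / l) := by gcongr; linarith
    _ = _ := by rw [hD]; field_simp; ring

/-- The successors of `y` in the dyadic block `(i, j)`. -/
def dyadicSucc (w : Fin 2 → ℝ) (ε : ℝ) (y : RVec) (i j : ℕ) : Set RVec :=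
  {y' | ∃ v u a g, TStep w ε y y' v u a g ∧ 2 ^ i * y.2 ≤ u.2 ∧ u.2 < 2 ^ (i + 1) * y.2 ∧
    2 ^ j * y.2 ≤ y'.2 ∧ y'.2 < 2 ^ (j + 1) * y.2}

lemma dyadicSucc_bound {w : Fin 2 → ℝ} {ε : ℝ} (hw : ∀ j, 0 < w j) (hw1 : ∀ j, w j ≤ 1)
    (hs : w 0 + w 1 = 1) (hε : 0 < ε) {y : RVec} (hprim : IsPrim y) {i j : ℕ} (hij : i ≤ j) :
    (dyadicSucc w ε y i j).Finite ∧
      ((dyadicSucc w ε y i j).ncard : ℝ) ≤ 6144 * ε * 4 ^ j := by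
  rcases (dyadicSucc w ε y i j).eq_empty_or_nonempty with hempty | ⟨y₀, v₀, u₀, a₀, g₀, h₀, hi₀, hi₀', -⟩
  · rw [hempty]; simp; positivity
  have hy := h₀.pos
  have hq : (0 : ℝ) < y.2 := by exact_mod_cast hy
  set K : Fin 2 → ℝ := fun k => 4 * 2 ^ i * (ε / (2 ^ i * y.2)) ^ w k with hK
  have hKpos : ∀ k, 0 < K k := fun k => by simp only [hK]; positivity
  have hKu : ∀ y' v u a g, TStep w ε y y' v u a g → 2 ^ i * y.2 ≤ u.2 → u.2 < 2 ^ (i + 1) * y.2 →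
      ∀ k, |offs k y u| ≤ K k := by
    intro y' v u a g h h1 h2 k
    have h1' : (2 : ℝ) ^ i * y.2 ≤ u.2 := by exact_mod_cast h1
    have h2' : (u.2 : ℝ) ≤ 2 ^ (i + 1) * y.2 := by exact_mod_cast h2.le
    refine (h.offs_u k).trans ?_
    have e1 : (ε / u.2) ^ w k ≤ (ε / (2 ^ i * y.2)) ^ w k :=
      Real.rpow_le_rpow (div_nonneg hε.le (by linarith [mul_pos (pow_pos (two_pos (α := ℝ)) i) hq]))
        (by gcongr) (hw k).le
    have e2 : (u.2 : ℝ) / y.2 ≤ 2 ^ (i + 1) := by rw [div_le_iff₀ hq]; exact h2'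
    have e3 : 2 * (u.2 / y.2 : ℝ) ≤ 4 * 2 ^ i := by rw [pow_succ] at e2; linarith
    simp only [hK]
    have e4 : (0 : ℝ) ≤ u.2 / y.2 := div_nonneg (by linarith [mul_pos (pow_pos (two_pos (α := ℝ)) i) hq]) hq.le
    refine mul_le_mul e3 e1
      (Real.rpow_nonneg (div_nonneg hε.le
        (by linarith [mul_pos (pow_pos (two_pos (α := ℝ)) i) hq])) _) (by positivity)
  have hKv : ∀ k, |offs k y v₀| ≤ K k := by
    intro k
    refine (h₀.offs_v k).trans ?_
    have e1 : ε / y.2 = 2 ^ i * (ε / (2 ^ i * y.2)) := by field_simp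
    rw [e1, Real.mul_rpow (by positivity) (by positivity)]
    simp only [hK]
    have e2 : ((2 : ℝ) ^ i) ^ w k ≤ 2 ^ i := by
      conv_rhs => rw [← Real.rpow_one ((2 : ℝ) ^ i)]
      exact Real.rpow_le_rpow_of_exponent_le (one_le_pow₀ (by norm_num)) (hw1 k)
    rw [← mul_assoc]
    gcongr
    linarith [pow_pos (two_pos (α := ℝ)) i]
  have hcount := ncard_offsBox_le hy hprim hKpos hKv (hKu _ _ _ _ _ h₀ hi₀ hi₀') h₀.det
  have hKK : (y.2 : ℝ) * K 0 * K 1 = 16 * 2 ^ i * ε := by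
    have e : (ε / (2 ^ i * y.2)) ^ w 0 * (ε / (2 ^ i * y.2)) ^ w 1 = ε / (2 ^ i * y.2) := by
      rw [← Real.rpow_add (by positivity), hs, Real.rpow_one]
    calc (y.2 : ℝ) * K 0 * K 1 = y.2 * 16 * 2 ^ i * 2 ^ i *
          ((ε / (2 ^ i * y.2)) ^ w 0 * (ε / (2 ^ i * y.2)) ^ w 1) := by simp only [hK]; ring
      _ = _ := by rw [e]; field_simp
  have hfin := offsBox_finite y hy K
  set G : ℤ := 2 ^ (j - i + 3) with hG
  let F : RVec × ℤ × ℕ → RVec := fun p =>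
    (-((p.2.1 * p.1.2 - 2 ^ j * y.2) / y.2) + (p.2.2 : ℤ)) • y + p.2.1 • p.1
  set P : Finset (RVec × ℤ × ℕ) := hfin.toFinset ×ˢ Finset.Ioc (-G) G ×ˢ Finset.range (2 ^ j) with hP
  have hsub : dyadicSucc w ε y i j ⊆ F '' (P : Set _) := by
    rintro y' ⟨v, u, a, g, h, h1, h2, h3, h4⟩
    set z := u - (u.2 / y.2) • y with hz
    have hzmem : z ∈ offsBox y K := emod_mem_offsBox hy (hKu _ _ _ _ _ h h1 h2)
    set a' := a + g * (u.2 / y.2) with ha'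
    have hy' : y' = a' • y + g • z := by
      rw [h.eq, ha', hz, smul_sub, add_smul, mul_smul]; abel
    have hy'2 : y'.2 = a' * y.2 + g * z.2 := by rw [hy']; simp
    set m := (g * z.2 - 2 ^ j * y.2) / y.2 with hm
    have hm1 : -a' ≤ m := by
      rw [hm, Int.le_ediv_iff_mul_le hy]; linarith
    have hm2 : m * y.2 ≤ g * z.2 - 2 ^ j * y.2 := Int.ediv_mul_le _ hy.ne'
    have hlt : a' + m < 2 ^ j := by
      have : (a' + m) * y.2 < 2 ^ j * y.2 := by rw [pow_succ] at h4; linarith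
      exact lt_of_mul_lt_mul_right this hy.le
    have hg : |g| < G := by
      have e1 := h.bound
      have e2 : |g| * (2 ^ i * y.2) ≤ |g| * u.2 := mul_le_mul_of_nonneg_left h1 (abs_nonneg _)
      have e3 : (2 : ℤ) ^ (j - i + 3) * 2 ^ i = 4 * 2 ^ (j + 1) := by
        rw [← pow_add, show j - i + 3 + i = 2 + (j + 1) by omega, pow_add]; norm_num
      have e4 : |g| * (2 ^ i * y.2) < G * (2 ^ i * y.2) := by
        rw [hG, ← mul_assoc (2 ^ (j - i + 3) : ℤ), e3]; rw [pow_succ] at h4 ⊢; linarith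
      exact lt_of_mul_lt_mul_right e4 (by positivity)
    refine ⟨(z, g, (a' + m).toNat), ?_, ?_⟩
    · have hg' := abs_lt.1 hg
      simp only [hP, Finset.coe_product, Set.mem_prod, Finset.mem_coe, Set.Finite.mem_toFinset,
        Finset.mem_Ioc, Finset.mem_range]
      refine ⟨hzmem, ⟨hg'.1, hg'.2.le⟩, ?_⟩
      zify; rw [Int.toNat_of_nonneg (by linarith)]; exact hlt
    · simp only [F]
      rw [Int.toNat_of_nonneg (by linarith), hy', ← hm]
      congr 2; ring
  have hPfin : (F '' (P : Set _)).Finite := (Finset.finite_toSet P).image F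
  refine ⟨hPfin.subset hsub, ?_⟩
  have hc1 : (dyadicSucc w ε y i j).ncard ≤ P.card :=
    (Set.ncard_le_ncard hsub hPfin).trans
      ((Set.ncard_image_le (Finset.finite_toSet P)).trans (Set.ncard_coe_finset P).le)
  have hc2 : P.card = (offsBox y K).ncard * ((2 ^ (j - i + 4)) * 2 ^ j) := by
    rw [hP, Finset.card_product, Finset.card_product, Int.card_Ioc, Finset.card_range,
      Set.ncard_eq_toFinset_card _ hfin]
    congr 2
    rw [hG, sub_neg_eq_add, ← two_mul]
    have : (2 * 2 ^ (j - i + 3) : ℤ) = ((2 ^ (j - i + 4) : ℕ) : ℤ) := by push_cast; ring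
    rw [this, Int.toNat_natCast]
  have hc3 : ((dyadicSucc w ε y i j).ncard : ℝ) ≤
      (offsBox y K).ncard * ((2 ^ (j - i + 4)) * 2 ^ j) := by
    have := hc1.trans hc2.le
    exact_mod_cast this
  refine hc3.trans ?_
  have e3 : (2 : ℝ) ^ (j - i + 4) * 2 ^ i = 16 * 2 ^ j := by
    rw [← pow_add, show j - i + 4 + i = 4 + j by omega, pow_add]; norm_num
  have e4 : (4 : ℝ) ^ j = 2 ^ j * 2 ^ j := by rw [← mul_pow]; norm_num
  rw [hKK] at hcount
  calc _ ≤ (24 * (16 * 2 ^ i * ε)) * ((2 ^ (j - i + 4)) * (2 : ℝ) ^ j) := by gcongr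
    _ = 24 * 16 * ε * (2 ^ (j - i + 4) * 2 ^ i) * 2 ^ j := by ring
    _ = _ := by rw [e3, e4]; ring

/-- The relation of being consecutive turning points. -/
def Succ (w : Fin 2 → ℝ) (ε : ℝ) (y y' : RVec) : Prop := ∃ v u a g, TStep w ε y y' v u a g

lemma exists_dyadic {a b : ℤ} (ha : 0 < a) (hab : a ≤ b) :
    ∃ i : ℕ, 2 ^ i * a ≤ b ∧ b < 2 ^ (i + 1) * a := by
  have hne : (b / a).toNat ≠ 0 := by
    have : 1 ≤ b / a := (Int.le_ediv_iff_mul_le ha).2 (by linarith)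
    omega
  have hnn : (0 : ℤ) ≤ b / a := Int.ediv_nonneg (by linarith) ha.le
  refine ⟨Nat.log 2 (b / a).toNat, ?_, ?_⟩
  · have h1 := Nat.pow_log_le_self 2 hne
    have h2 : (2 : ℤ) ^ Nat.log 2 (b / a).toNat ≤ b / a := by
      rw [← Int.toNat_of_nonneg hnn]; exact_mod_cast h1
    exact (Int.le_ediv_iff_mul_le ha).1 h2
  · have h1 := Nat.lt_pow_succ_log_self (b := 2) (by norm_num) (b / a).toNat
    have h2 : b / a < (2 : ℤ) ^ (Nat.log 2 (b / a).toNat + 1) := by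
      rw [← Int.toNat_of_nonneg hnn]; exact_mod_cast h1
    exact (Int.ediv_lt_iff_lt_mul ha).1 h2

lemma succ_subset_iUnion (w : Fin 2 → ℝ) (ε : ℝ) (y : RVec) :
    {y' | Succ w ε y y'} ⊆ ⋃ j : ℕ, ⋃ i : Fin (j + 1), dyadicSucc w ε y i j := by
  rintro y' ⟨v, u, a, g, h⟩
  have hy := h.pos
  obtain ⟨i, hi1, hi2⟩ := exists_dyadic hy (by linarith [h.two] : y.2 ≤ u.2)
  obtain ⟨j, hj1, hj2⟩ := exists_dyadic hy (by linarith [h.two, h.le] : y.2 ≤ y'.2)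
  have hij : i < j + 1 := by
    have h1 : (2 : ℤ) ^ i * y.2 < 2 ^ (j + 1) * y.2 := by linarith [h.le]
    have h2 := lt_of_mul_lt_mul_right h1 hy.le
    exact (pow_lt_pow_iff_right₀ (by norm_num)).1 h2
  simp only [Set.mem_iUnion]
  exact ⟨j, ⟨i, hij⟩, v, u, a, g, h, hi1, hi2, hj1, hj2⟩

lemma two_rpow_neg_le {η : ℝ} (h0 : 0 ≤ η) (h1 : η ≤ 1) : (2 : ℝ) ^ (-η) ≤ 1 - η / 2 := by
  have h := convexOn_exp.2 (Set.mem_univ (-Real.log 2)) (Set.mem_univ 0) h0 (sub_nonneg.2 h1)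
    (by ring)
  simp only [smul_eq_mul, mul_zero, add_zero, Real.exp_zero, mul_one, Real.exp_neg,
    Real.exp_log (two_pos (α := ℝ))] at h
  rw [Real.rpow_def_of_pos two_pos]
  calc _ = Real.exp (η * -Real.log 2) := by ring_nf
    _ ≤ _ := h
    _ = _ := by ring

open ENNReal in
lemma tsum_succ_le {w : Fin 2 → ℝ} {ε η : ℝ} (hw : ∀ j, 0 < w j) (hw1 : ∀ j, w j ≤ 1)
    (hs : w 0 + w 1 = 1) (hε : 0 < ε) (hη : 0 < η) (hη1 : η ≤ 1) (hεη : 24576 * ε ≤ η ^ 2)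
    {y : RVec} (hprim : IsPrim y) (hy : 0 < y.2) :
    ∑' y' : {y' | Succ w ε y y'}, ENNReal.ofReal (((y'.1.2 : ℝ) / y.2) ^ (-(2 + η))) ≤ 1 := by
  have hq : (0 : ℝ) < y.2 := by exact_mod_cast hy
  set F : RVec → ℝ≥0∞ := fun y' => ENNReal.ofReal (((y'.2 : ℝ) / y.2) ^ (-(2 + η))) with hF
  set r : ℝ := 2 ^ (-η) with hr
  have hr0 : 0 < r := by positivity
  have hr1 : r ≤ 1 - η / 2 := two_rpow_neg_le hη.le hη1
  have hblock : ∀ j (i : Fin (j + 1)), ∑' y' : dyadicSucc w ε y i j, F y' ≤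
      ENNReal.ofReal (6144 * ε * r ^ j) := by
    intro j i
    obtain ⟨hfin, hcard⟩ := dyadicSucc_bound hw hw1 hs hε hprim (Nat.lt_succ_iff.1 i.2)
    have hle : ∀ y' ∈ dyadicSucc w ε y i j, F y' ≤ ENNReal.ofReal ((4 ^ j : ℝ)⁻¹ * r ^ j) := by
      rintro y' ⟨v, u, a, g, h, h1, h2, h3, h4⟩
      apply ENNReal.ofReal_le_ofReal
      have e1 : (2 : ℝ) ^ j ≤ y'.2 / y.2 := by
        rw [le_div_iff₀ hq]; exact_mod_cast h3
      calc _ ≤ ((2 : ℝ) ^ j) ^ (-(2 + η)) :=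
            Real.rpow_le_rpow_of_nonpos (by positivity) e1 (by linarith)
        _ = _ := by
          rw [hr, neg_add, Real.rpow_add (by positivity), ← Real.rpow_natCast 2 j,
            ← Real.rpow_natCast (2 ^ (-η)) j, ← Real.rpow_mul (by norm_num),
            ← Real.rpow_mul (by norm_num), ← Real.rpow_mul (by norm_num),
            show (4 : ℝ) = 2 ^ (2 : ℝ) by norm_num, ← Real.rpow_natCast (2 ^ (2 : ℝ)) j,
            ← Real.rpow_mul (by norm_num), ← Real.rpow_neg (by norm_num)]
          ring_nf
    have := hfin.fintype
    rw [tsum_fintype]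
    calc _ ≤ ∑ _y' : dyadicSucc w ε y i j, ENNReal.ofReal ((4 ^ j : ℝ)⁻¹ * r ^ j) :=
          Finset.sum_le_sum fun y' _ => hle y'.1 y'.2
      _ = ENNReal.ofReal ((dyadicSucc w ε y i j).ncard * ((4 ^ j : ℝ)⁻¹ * r ^ j)) := by
        rw [Finset.sum_const, nsmul_eq_mul, ENNReal.ofReal_mul (Nat.cast_nonneg _),
          ENNReal.ofReal_natCast, Finset.card_univ, Set.ncard_eq_toFinset_card', Set.toFinset_card]
      _ ≤ _ := by
        apply ENNReal.ofReal_le_ofReal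
        calc _ ≤ (6144 * ε * 4 ^ j) * ((4 ^ j : ℝ)⁻¹ * r ^ j) := by gcongr
          _ = _ := by field_simp
  have hr1' : r < 1 := by linarith
  have hsum : HasSum (fun j : ℕ => 6144 * ε * ((j + 1) * r ^ j)) (6144 * ε * (1 / (1 - r) ^ 2)) := by
    apply HasSum.mul_left
    have h1 := hasSum_coe_mul_geometric_of_norm_lt_one (r := r) (by
      rw [Real.norm_eq_abs, abs_of_pos hr0]; exact hr1')
    have h2 := hasSum_geometric_of_lt_one hr0.le hr1'
    have h3 : (fun j : ℕ => ((j : ℝ) + 1) * r ^ j) = fun j : ℕ => j * r ^ j + r ^ j := by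
      ext j; ring
    have h4 : 1 / (1 - r) ^ 2 = r / (1 - r) ^ 2 + (1 - r)⁻¹ := by
      have : 1 - r ≠ 0 := by linarith
      field_simp; ring
    rw [h3, h4]; exact h1.add h2
  calc _ ≤ ∑' y' : (⋃ j : ℕ, ⋃ i : Fin (j + 1), dyadicSucc w ε y i j : Set RVec), F y' :=
        ENNReal.tsum_mono_subtype F (succ_subset_iUnion w ε y)
    _ ≤ ∑' j : ℕ, ∑' y' : (⋃ i : Fin (j + 1), dyadicSucc w ε y i j : Set RVec), F y' :=
        ENNReal.tsum_iUnion_le_tsum F _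
    _ ≤ ∑' j : ℕ, ∑' i : Fin (j + 1), ∑' y' : dyadicSucc w ε y i j, F y' :=
        ENNReal.tsum_le_tsum fun j => ENNReal.tsum_iUnion_le_tsum F _
    _ ≤ ∑' j : ℕ, ENNReal.ofReal (6144 * ε * ((j + 1) * r ^ j)) := by
        refine ENNReal.tsum_le_tsum fun j => ?_
        calc _ ≤ ∑' _i : Fin (j + 1), ENNReal.ofReal (6144 * ε * r ^ j) :=
              ENNReal.tsum_le_tsum fun i => hblock j i
          _ = ((j + 1 : ℕ) : ℝ≥0∞) * ENNReal.ofReal (6144 * ε * r ^ j) := by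
            rw [tsum_fintype, Finset.sum_const, nsmul_eq_mul, Finset.card_univ, Fintype.card_fin]
          _ = _ := by
            rw [← ENNReal.ofReal_natCast, ← ENNReal.ofReal_mul (by positivity)]
            congr 1; push_cast; ring
    _ = ENNReal.ofReal (6144 * ε * (1 / (1 - r) ^ 2)) := by
        rw [← ENNReal.ofReal_tsum_of_nonneg (fun j => by positivity) hsum.summable, hsum.tsum_eq]
    _ ≤ 1 := by
        rw [← ENNReal.ofReal_one]
        apply ENNReal.ofReal_le_ofReal
        have e1 : η / 2 ≤ 1 - r := by linarith
        have e2 : (η / 2) ^ 2 ≤ (1 - r) ^ 2 := by gcongr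
        rw [mul_one_div, div_le_one (by nlinarith)]
        nlinarith

section

open ENNReal

/-- The box of points approximated by `y`. -/
def apxBox (w : Fin 2 → ℝ) (ε : ℝ) (y : RVec) : Set (EuclideanSpace ℝ (Fin 2)) :=
  {x | ∀ j, |serr (fun i => x i) y j| ≤ (ε / y.2) ^ w j}

noncomputable def apxRad (w : Fin 2 → ℝ) (ε : ℝ) (y : RVec) (j : Fin 2) : ℝ :=
  (ε / y.2) ^ w j / y.2

/-- The `k`-th slice of `apxBox`. -/
noncomputable def apxSlice (w : Fin 2 → ℝ) (ε : ℝ) (y : RVec) (k : ℕ) :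
    Set (EuclideanSpace ℝ (Fin 2)) :=
  {x | x ∈ apxBox w ε y ∧ k = ⌊(x 1 - y.1 1 / y.2 + apxRad w ε y 1) / (2 * apxRad w ε y 0)⌋₊}

lemma apxBox_eq_iUnion (w : Fin 2 → ℝ) (ε : ℝ) (y : RVec) :
    apxBox w ε y ⊆ ⋃ k, apxSlice w ε y k := fun _ hx => Set.mem_iUnion.2 ⟨_, hx, rfl⟩

lemma abs_sub_le_of_mem_apxBox {w : Fin 2 → ℝ} {ε : ℝ} {y : RVec} (hy : 0 < y.2)
    {x : EuclideanSpace ℝ (Fin 2)} (hx : x ∈ apxBox w ε y) (j : Fin 2) :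
    |x j - y.1 j / y.2| ≤ apxRad w ε y j := by
  have hq : (0 : ℝ) < y.2 := by exact_mod_cast hy
  have h := hx j
  simp only [serr] at h
  rw [apxRad, le_div_iff₀ hq]
  have : |x j - y.1 j / y.2| * y.2 = |(y.2 : ℝ) * x j - y.1 j| := by
    conv_lhs => rw [← abs_of_pos hq]
    rw [← abs_mul]; congr 1; rw [abs_of_pos hq]; field_simp
  rw [this]; exact h

lemma euclidean_edist_le {x x' : EuclideanSpace ℝ (Fin 2)} {r : ℝ} (hr : 0 ≤ r)
    (h : ∀ j, |x j - x' j| ≤ r) : edist x x' ≤ ENNReal.ofReal (2 * r) := by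
  rw [edist_dist]
  apply ENNReal.ofReal_le_ofReal
  rw [EuclideanSpace.dist_eq, Fin.sum_univ_two]
  apply Real.sqrt_le_iff.2 ⟨by linarith, ?_⟩
  rw [Real.dist_eq, Real.dist_eq]
  have h0 := pow_le_pow_left₀ (abs_nonneg _) (h 0) 2
  have h1 := pow_le_pow_left₀ (abs_nonneg _) (h 1) 2
  nlinarith

lemma apxRad_pos {w : Fin 2 → ℝ} {ε : ℝ} (hε : 0 < ε) {y : RVec} (hy : 0 < y.2) (j : Fin 2) :
    0 < apxRad w ε y j := by
  have hq : (0 : ℝ) < y.2 := by exact_mod_cast hy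
  unfold apxRad; positivity

lemma apxRad_le {w : Fin 2 → ℝ} {ε : ℝ} (hε : 0 < ε) (hε1 : ε ≤ 1) (hww : w 1 ≤ w 0) {y : RVec}
    (hy : 0 < y.2) : apxRad w ε y 0 ≤ apxRad w ε y 1 := by
  have hq : (1 : ℝ) ≤ y.2 := by exact_mod_cast hy
  unfold apxRad
  refine div_le_div_of_nonneg_right ?_ (by linarith)
  exact Real.rpow_le_rpow_of_exponent_ge (by positivity) ((div_le_one (by linarith)).2 (by linarith)) hww

lemma ediam_apxSlice_le {w : Fin 2 → ℝ} {ε : ℝ} (hε : 0 < ε) {y : RVec} (hy : 0 < y.2) (k : ℕ) :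
    Metric.ediam (apxSlice w ε y k) ≤ ENNReal.ofReal (4 * apxRad w ε y 0) := by
  refine Metric.ediam_le fun x hx x' hx' => ?_
  have hr := apxRad_pos (w := w) hε hy 0
  have hr1 := apxRad_pos (w := w) hε hy 1
  rw [show 4 * apxRad w ε y 0 = 2 * (2 * apxRad w ε y 0) by ring]
  refine euclidean_edist_le (by linarith) ?_
  rw [Fin.forall_fin_two]
  constructor
  · have h1 := abs_le.1 (abs_sub_le_of_mem_apxBox hy hx.1 0)
    have h2 := abs_le.1 (abs_sub_le_of_mem_apxBox hy hx'.1 0)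
    rw [abs_le]; constructor <;> linarith
  · have h1 := abs_le.1 (abs_sub_le_of_mem_apxBox hy hx.1 1)
    have h2 := abs_le.1 (abs_sub_le_of_mem_apxBox hy hx'.1 1)
    have e1 := hx.2
    have e2 := hx'.2
    have n1 : 0 ≤ (x 1 - y.1 1 / y.2 + apxRad w ε y 1) / (2 * apxRad w ε y 0) :=
      div_nonneg (by linarith) (by linarith)
    have n2 : 0 ≤ (x' 1 - y.1 1 / y.2 + apxRad w ε y 1) / (2 * apxRad w ε y 0) :=
      div_nonneg (by linarith) (by linarith)
    have a1 := Nat.floor_le n1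
    have a2 := Nat.lt_floor_add_one ((x 1 - y.1 1 / y.2 + apxRad w ε y 1) / (2 * apxRad w ε y 0))
    have b1 := Nat.floor_le n2
    have b2 := Nat.lt_floor_add_one ((x' 1 - y.1 1 / y.2 + apxRad w ε y 1) / (2 * apxRad w ε y 0))
    rw [← e1] at a1 a2
    rw [← e2] at b1 b2
    rw [le_div_iff₀ (by linarith)] at a1 b1
    rw [div_lt_iff₀ (by linarith)] at a2 b2
    rw [abs_le]; constructor <;> linarith

lemma tsum_ediam_apxSlice_le {w : Fin 2 → ℝ} {ε s : ℝ} (hε : 0 < ε) (hε1 : ε ≤ 1) (hs : 0 < s)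
    (hww : w 1 ≤ w 0) (he : 0 ≤ w 1 + w 0 * (s - 1)) {y : RVec} (hy : 0 < y.2) :
    ∑' k, Metric.ediam (apxSlice w ε y k) ^ s ≤
      ENNReal.ofReal (2 * 4 ^ s) * ENNReal.ofReal ((y.2 : ℝ) ^ (-(s + (w 1 + w 0 * (s - 1))))) := by
  have hq : (0 : ℝ) < y.2 := by exact_mod_cast hy
  have hr := apxRad_pos (w := w) hε hy 0
  have hr1 := apxRad_pos (w := w) hε hy 1
  have hrr := apxRad_le hε hε1 hww hy
  set M := ⌊apxRad w ε y 1 / apxRad w ε y 0⌋₊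
  have hzero : ∀ k ∉ Finset.range (M + 1), Metric.ediam (apxSlice w ε y k) ^ s = 0 := by
    intro k hk
    have : apxSlice w ε y k = ∅ := by
      rw [Set.eq_empty_iff_forall_notMem]
      rintro x ⟨hx, hxk⟩
      apply hk
      rw [Finset.mem_range, Nat.lt_succ_iff, hxk]
      apply Nat.floor_le_floor
      have h1 := abs_le.1 (abs_sub_le_of_mem_apxBox hy hx 1)
      rw [div_le_div_iff₀ (by linarith) hr]
      nlinarith
    rw [this, Metric.ediam_empty, ENNReal.zero_rpow_of_pos hs]
  rw [tsum_eq_sum hzero]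
  calc _ ≤ ∑ _k ∈ Finset.range (M + 1), ENNReal.ofReal ((4 * apxRad w ε y 0) ^ s) := by
        refine Finset.sum_le_sum fun k _ => ?_
        rw [← ENNReal.ofReal_rpow_of_nonneg (by linarith) hs.le]
        exact ENNReal.rpow_le_rpow (ediam_apxSlice_le hε hy k) hs.le
    _ = ENNReal.ofReal ((M + 1 : ℕ) * (4 * apxRad w ε y 0) ^ s) := by
        rw [Finset.sum_const, Finset.card_range, nsmul_eq_mul, ENNReal.ofReal_mul (Nat.cast_nonneg _),
          ENNReal.ofReal_natCast]
    _ ≤ ENNReal.ofReal ((2 * (apxRad w ε y 1 / apxRad w ε y 0)) * (4 * apxRad w ε y 0) ^ s) := by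
        apply ENNReal.ofReal_le_ofReal
        gcongr
        have h1 : (M : ℝ) ≤ apxRad w ε y 1 / apxRad w ε y 0 := Nat.floor_le (by positivity)
        have h2 : 1 ≤ apxRad w ε y 1 / apxRad w ε y 0 := (one_le_div hr).2 hrr
        push_cast; linarith
    _ ≤ _ := by
        rw [← ENNReal.ofReal_mul (by positivity)]
        apply ENNReal.ofReal_le_ofReal
        have e1 : (2 * (apxRad w ε y 1 / apxRad w ε y 0)) * (4 * apxRad w ε y 0) ^ s =
            2 * 4 ^ s * (apxRad w ε y 1 * apxRad w ε y 0 ^ (s - 1)) := by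
          rw [Real.mul_rpow (by norm_num) hr.le, Real.rpow_sub hr, Real.rpow_one]
          field_simp
        rw [e1]
        gcongr
        obtain ⟨t, ht'⟩ : ∃ t : ℝ, t = ε / y.2 := ⟨_, rfl⟩
        have ht : 0 < t := by rw [ht']; positivity
        have e2 : apxRad w ε y 1 * apxRad w ε y 0 ^ (s - 1) =
            t ^ (w 1 + w 0 * (s - 1)) * (y.2 : ℝ) ^ (-s) := by
          simp only [apxRad, ← ht']
          rw [Real.div_rpow (by positivity) hq.le, ← Real.rpow_mul ht.le, Real.rpow_add ht,
            Real.rpow_neg hq.le, Real.rpow_sub hq, Real.rpow_one]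
          field_simp
        rw [e2, neg_add, Real.rpow_add hq, mul_comm]
        gcongr
        calc t ^ (w 1 + w 0 * (s - 1)) ≤ (1 / (y.2 : ℝ)) ^ (w 1 + w 0 * (s - 1)) := by
              apply Real.rpow_le_rpow ht.le _ he
              rw [ht']; gcongr
          _ = _ := by rw [Real.rpow_neg hq.le, one_div, Real.inv_rpow hq.le]

/-- The vectors reachable from `y₀` in `n` steps. -/
def level (w : Fin 2 → ℝ) (ε : ℝ) (y₀ : RVec) : ℕ → Set RVec
  | 0 => {y | y = y₀ ∧ IsPrim y ∧ 0 < y.2}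
  | n + 1 => {y' | IsPrim y' ∧ ∃ y ∈ level w ε y₀ n, Succ w ε y y'}

lemma level_prim {w : Fin 2 → ℝ} {ε : ℝ} {y₀ y : RVec} {n : ℕ} (h : y ∈ level w ε y₀ n) :
    IsPrim y := by
  cases n with
  | zero => exact h.2.1
  | succ n => exact h.1

lemma level_le {w : Fin 2 → ℝ} {ε : ℝ} {y₀ y : RVec} {n : ℕ} (h : y ∈ level w ε y₀ n) :
    2 ^ n ≤ y.2 := by
  induction n generalizing y with
  | zero => have := h.2.2; rw [pow_zero]; omega
  | succ n ih =>
    obtain ⟨-, y₁, hy₁, v, u, a, g, hS⟩ := h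
    have := ih hy₁
    rw [pow_succ]
    linarith [hS.two, hS.le]

lemma level_pos {w : Fin 2 → ℝ} {ε : ℝ} {y₀ y : RVec} {n : ℕ} (h : y ∈ level w ε y₀ n) :
    0 < y.2 := lt_of_lt_of_le (by positivity) (level_le h)

lemma tsum_level_le {w : Fin 2 → ℝ} {ε η : ℝ} (hw : ∀ j, 0 < w j) (hw1 : ∀ j, w j ≤ 1)
    (hs : w 0 + w 1 = 1) (hε : 0 < ε) (hη : 0 < η) (hη1 : η ≤ 1) (hεη : 24576 * ε ≤ η ^ 2)
    (y₀ : RVec) (n : ℕ) :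
    ∑' y : level w ε y₀ n, ENNReal.ofReal ((y.1.2 : ℝ) ^ (-(2 + η))) ≤
      ENNReal.ofReal ((y₀.2 : ℝ) ^ (-(2 + η))) := by
  set f : RVec → ℝ≥0∞ := fun y => ENNReal.ofReal ((y.2 : ℝ) ^ (-(2 + η))) with hf
  induction n with
  | zero =>
    calc _ ≤ ∑' y : ({y₀} : Set RVec), f y :=
          ENNReal.tsum_mono_subtype f fun y hy => hy.1
      _ = _ := tsum_singleton y₀ f
  | succ n ih =>
    refine le_trans ?_ ih
    calc _ ≤ ∑' y' : (⋃ y : level w ε y₀ n, {y' | Succ w ε y.1 y'} : Set RVec), f y' :=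
          ENNReal.tsum_mono_subtype f fun y' hy' => by
            obtain ⟨-, y, hy, hS⟩ := hy'
            exact Set.mem_iUnion.2 ⟨⟨y, hy⟩, hS⟩
      _ ≤ ∑' y : level w ε y₀ n, ∑' y' : {y' | Succ w ε y.1 y'}, f y' :=
          ENNReal.tsum_iUnion_le_tsum f _
      _ ≤ ∑' y : level w ε y₀ n, f y := by
          refine ENNReal.tsum_le_tsum fun y => ?_
          have hy := level_pos y.2
          have hq : (0 : ℝ) < y.1.2 := by exact_mod_cast hy
          have key := tsum_succ_le hw hw1 hs hε hη hη1 hεη (level_prim y.2) hy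
          calc _ = ∑' y' : {y' | Succ w ε y.1 y'},
                f y * ENNReal.ofReal (((y'.1.2 : ℝ) / y.1.2) ^ (-(2 + η))) := by
                refine tsum_congr fun y' => ?_
                obtain ⟨v, u, a, g, hS⟩ := y'.2
                have h2 : 0 ≤ y'.1.2 := by linarith [hS.two, hS.le]
                have h2' : (0 : ℝ) ≤ y'.1.2 := by exact_mod_cast h2
                simp only [hf]
                rw [← ENNReal.ofReal_mul (by positivity), Real.div_rpow h2' hq.le]
                congr 1
                field_simp
            _ = f y * ∑' y' : {y' | Succ w ε y.1 y'},
                ENNReal.ofReal (((y'.1.2 : ℝ) / y.1.2) ^ (-(2 + η))) := ENNReal.tsum_mul_left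
            _ ≤ f y * 1 := by gcongr
            _ = f y := mul_one _

/-- Points followed by an infinite chain starting at `y₀`. -/
def chainSet (w : Fin 2 → ℝ) (ε : ℝ) (y₀ : RVec) : Set (EuclideanSpace ℝ (Fin 2)) :=
  {x | ∃ Y : ℕ → RVec, Y 0 = y₀ ∧ ∀ i, IsPrim (Y i) ∧ x ∈ apxBox w ε (Y i) ∧
    Succ w ε (Y i) (Y (i + 1))}

lemma dimH_chainSet_le {w : Fin 2 → ℝ} {ε η s : ℝ} (hw : ∀ j, 0 < w j) (hw1 : ∀ j, w j ≤ 1)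
    (hs : w 0 + w 1 = 1) (hww : w 1 ≤ w 0) (hε : 0 < ε) (hε1 : ε ≤ 1) (hη : 0 < η) (hη1 : η ≤ 1)
    (hεη : 24576 * ε ≤ η ^ 2) (hs0 : 0 < s) (he : 0 ≤ w 1 + w 0 * (s - 1))
    (hse : s + (w 1 + w 0 * (s - 1)) = 2 + η) (y₀ : RVec) :
    dimH (chainSet w ε y₀) ≤ ENNReal.ofReal s := by
  apply dimH_le_of_hausdorffMeasure_ne_top
  have hcoe : ((s.toNNReal : NNReal) : ℝ) = s := Real.coe_toNNReal _ hs0.le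
  rw [hcoe]
  have key := Measure.hausdorffMeasure_le_liminf_tsum (X := EuclideanSpace ℝ (Fin 2))
    (ι := fun n : ℕ => level w ε y₀ n × ℕ) (l := Filter.atTop) s (chainSet w ε y₀)
    (fun n => ENNReal.ofReal (4 * (1 / 2) ^ n)) (by
      have h1 : Filter.Tendsto (fun n : ℕ => (4 * (1 / 2) ^ n : ℝ)) Filter.atTop (nhds (4 * 0)) :=
        (_root_.tendsto_pow_atTop_nhds_zero_of_lt_one (by norm_num) (by norm_num)).const_mul 4
      have h2 := ENNReal.tendsto_ofReal h1
      simpa using h2)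
    (fun n i => apxSlice w ε i.1.1 i.2) (Filter.Eventually.of_forall fun n i => by
      have hy := level_pos i.1.2
      have hq : (0 : ℝ) < i.1.1.2 := by exact_mod_cast hy
      have hqn : (2 : ℝ) ^ n ≤ i.1.1.2 := by exact_mod_cast level_le i.1.2
      refine (ediam_apxSlice_le hε hy i.2).trans (ENNReal.ofReal_le_ofReal ?_)
      have hq1 : (1 : ℝ) ≤ i.1.1.2 := by exact_mod_cast hy
      have h1 : (ε / i.1.1.2) ^ w 0 ≤ 1 :=
        Real.rpow_le_one (by positivity) ((div_le_one hq).2 (by linarith)) (hw 0).le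
      unfold apxRad
      rw [one_div, inv_pow, ← one_div]
      gcongr) (Filter.Eventually.of_forall fun n x hx => by
      obtain ⟨Y, hY0, hY⟩ := hx
      have hlev : ∀ m, Y m ∈ level w ε y₀ m := by
        intro m
        induction m with
        | zero =>
          obtain ⟨v, u, a, g, hS⟩ := (hY 0).2.2
          exact ⟨hY0, (hY 0).1, hS.pos⟩
        | succ m ih => exact ⟨(hY _).1, _, ih, (hY m).2.2⟩
      obtain ⟨k, hk⟩ := Set.mem_iUnion.1 (apxBox_eq_iUnion w ε (Y n) (hY n).2.1)
      exact Set.mem_iUnion.2 ⟨(⟨Y n, hlev n⟩, k), hk⟩)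
  have hbound : ∀ n : ℕ, ∑' i : level w ε y₀ n × ℕ, Metric.ediam (apxSlice w ε i.1.1 i.2) ^ s ≤
      ENNReal.ofReal (2 * 4 ^ s) * ENNReal.ofReal ((y₀.2 : ℝ) ^ (-(2 + η))) := by
    intro n
    rw [ENNReal.tsum_prod']
    calc _ ≤ ∑' y : level w ε y₀ n, ENNReal.ofReal (2 * 4 ^ s) *
          ENNReal.ofReal ((y.1.2 : ℝ) ^ (-(2 + η))) := by
          refine ENNReal.tsum_le_tsum fun y => ?_
          have := tsum_ediam_apxSlice_le hε hε1 hs0 hww he (level_pos y.2)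
          rwa [hse] at this
      _ ≤ _ := by
          rw [ENNReal.tsum_mul_left]
          gcongr
          exact tsum_level_le hw hw1 hs hε hη hη1 hεη y₀ n
  refine ne_top_of_le_ne_top (b := ENNReal.ofReal (2 * 4 ^ s) * ENNReal.ofReal ((y₀.2 : ℝ) ^ (-(2 + η))))
    (ENNReal.mul_ne_top ENNReal.ofReal_ne_top ENNReal.ofReal_ne_top) (key.trans ?_)
  exact (Filter.liminf_le_liminf (Filter.Eventually.of_forall hbound)).trans
    (by rw [Filter.liminf_const])

lemma dimH_line_le {a b c : ℝ} (hab : a ≠ 0 ∨ b ≠ 0) :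
    dimH {x : EuclideanSpace ℝ (Fin 2) | a * x 0 + b * x 1 + c = 0} ≤ 1 := by
  have hpos : a ^ 2 + b ^ 2 ≠ 0 := by
    rcases hab with h | h <;> positivity
  let f : ℝ → EuclideanSpace ℝ (Fin 2) := fun t =>
    !₂[-c * a / (a ^ 2 + b ^ 2) + t * (-b), -c * b / (a ^ 2 + b ^ 2) + t * a]
  have hf : ContDiff ℝ 1 f := by
    rw [contDiff_euclidean]
    intro i
    fin_cases i
    · simp [f]; fun_prop
    · simp [f]; fun_prop
  refine (dimH_mono (t := Set.range f) ?_).trans ((hf.dimH_range_le).trans (by simp))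
  intro x hx
  have hx' : a * x 0 + b * x 1 + c = 0 := hx
  refine ⟨(-b * x 0 + a * x 1) / (a ^ 2 + b ^ 2), ?_⟩
  ext i
  fin_cases i
  · simp [f]; field_simp; linear_combination (-a) * hx'
  · simp [f]; field_simp; linear_combination (-b) * hx'

end

lemma exists_approx_of_mem_DI {w₁ w₂ ε : ℝ} (hw₁ : 0 < w₁) (hw₂ : 0 < w₂) (hε : 0 < ε)
    {x : EuclideanSpace ℝ (Fin 2)} (hx : x ∈ DI w₁ w₂ ε) :
    ∃ T₀ : ℝ, ∀ T : ℝ, T₀ < T → ∃ z : RVec, 0 < z.2 ∧ (z.2 : ℝ) < T ∧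
      werr ![w₁, w₂] (fun i => x i) z < ε / T := by
  obtain ⟨T₀, hT₀⟩ := hx
  refine ⟨max T₀ 0, fun T hT => ?_⟩
  have hT0 : 0 < T := (le_max_right _ _).trans_lt hT
  obtain ⟨p₁, p₂, q, h1, h2, h3, h4⟩ := hT₀ T ((le_max_left _ _).trans_lt hT)
  refine ⟨(![p₁, p₂], q), h3, h4, ?_⟩
  rw [werr_lt_iff (by rw [Fin.forall_fin_two]; exact ⟨hw₁, hw₂⟩) _ _ (by positivity),
    Fin.forall_fin_two]
  rw [Real.rpow_neg hT0.le, ← div_eq_mul_inv, ← Real.div_rpow hε.le hT0.le] at h1 h2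
  exact ⟨by simpa [serr] using h1, by simpa [serr] using h2⟩

lemma dimH_DI_le {w₁ w₂ : ℝ} (hw₂ : 0 < w₂) (hw : w₂ ≤ w₁) (hsum : w₁ + w₂ = 1) {ε : ℝ}
    (hε : 0 < ε) :
    dimH (DI w₁ w₂ ε) ≤ ENNReal.ofReal (2 - 1 / (1 + w₁) + 300 * Real.sqrt ε) := by
  have hw₁ : 0 < w₁ := by linarith
  have h1w : 0 < 1 + w₁ := by linarith
  have hsq : 0 < Real.sqrt ε := Real.sqrt_pos.2 hε
  set η := (1 + w₁) * (300 * Real.sqrt ε) with hη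
  set s := 2 - 1 / (1 + w₁) + 300 * Real.sqrt ε with hs
  have h1w' : 1 / (1 + w₁) < 1 := by rw [div_lt_one h1w]; linarith
  rcases lt_or_ge 1 η with hη1 | hη1
  · have h2 : (2 : ℝ) ≤ s := by
      have : 1 / (1 + w₁) < 300 * Real.sqrt ε := by
        rw [div_lt_iff₀ h1w]; linarith
      linarith
    calc dimH (DI w₁ w₂ ε) ≤ dimH (Set.univ : Set (EuclideanSpace ℝ (Fin 2))) :=
          dimH_mono (Set.subset_univ _)
      _ = ENNReal.ofReal 2 := by
          rw [Real.dimH_univ_eq_finrank, finrank_euclideanSpace_fin]; simp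
      _ ≤ _ := ENNReal.ofReal_le_ofReal h2
  set w : Fin 2 → ℝ := ![w₁, w₂] with hwdef
  have hwpos : ∀ j, 0 < w j := by rw [Fin.forall_fin_two]; exact ⟨hw₁, hw₂⟩
  have hwle : ∀ j, w j ≤ 1 := by
    rw [Fin.forall_fin_two]; simp [hwdef]; constructor <;> linarith
  have hw0 : w 0 = w₁ := rfl
  have hw1 : w 1 = w₂ := rfl
  have hηsq : 90000 * ε ≤ η ^ 2 := by
    have h1 : 300 * Real.sqrt ε ≤ η := by rw [hη]; nlinarith
    have h2 : (300 * Real.sqrt ε) ^ 2 ≤ η ^ 2 := by gcongr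
    rw [mul_pow, Real.sq_sqrt hε.le] at h2
    linarith
  have hη0 : 0 < η := by positivity
  have hε16 : ε ≤ 1 / 16 := by nlinarith
  have hs1 : 1 ≤ s := by linarith
  have hse : s + (w 1 + w 0 * (s - 1)) = 2 + η := by
    rw [hw0, hw1, hη, hs]; field_simp; linear_combination (1 + w₁) * hsum
  have hsub : DI w₁ w₂ ε ⊆
      (⋃ abc ∈ {abc : ℤ × ℤ × ℤ | abc.1 ≠ 0 ∨ abc.2.1 ≠ 0},
        {x : EuclideanSpace ℝ (Fin 2) | (abc.1 : ℝ) * x 0 + (abc.2.1 : ℝ) * x 1 + (abc.2.2 : ℝ) = 0}) ∪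
      ⋃ y : RVec, chainSet w ε y := by
    intro x hx
    by_cases hline : ∀ a b c : ℤ, (a : ℝ) * x 0 + b * x 1 + c = 0 → a = 0 ∧ b = 0
    · right
      obtain ⟨U, hU⟩ := exists_bestSeq (w := w) (x := fun i => x i) hwpos hline
        (exists_approx_of_mem_DI hw₁ hw₂ hε hx)
      obtain ⟨Y, hY⟩ := hU.exists_chain hwpos hsum hε hε16 hline
      exact Set.mem_iUnion.2 ⟨Y 0, Y, rfl, hY⟩
    · left
      push Not at hline
      obtain ⟨a, b, c, h0, hne⟩ := hline
      simp only [Set.mem_iUnion]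
      exact ⟨(a, b, c), by by_cases ha : a = 0 <;> simp_all, h0⟩
  refine (dimH_mono hsub).trans ?_
  rw [dimH_union, max_le_iff, dimH_bUnion (Set.to_countable _), dimH_iUnion]
  constructor
  · refine iSup₂_le fun abc habc => (dimH_line_le ?_).trans ?_
    · simpa using habc
    · rw [← ENNReal.ofReal_one]; exact ENNReal.ofReal_le_ofReal hs1
  · refine iSup_le fun y => dimH_chainSet_le hwpos hwle hsum hw hε (by linarith) hη0 hη1
      (by linarith) (by linarith) ?_ hse y
    have := mul_nonneg (hwpos 0).le (sub_nonneg.2 hs1)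
    linarith [hwpos 1]

/-- The restriction of a sequence to its first `k` terms. -/
def seqInit {α : Type*} (k : ℕ) (ω : ℕ → α) : Fin k → α := fun i => ω i

/-- The law of a sequence of independent uniform variables on `Fin N`. -/
noncomputable def uniformSeq (N : ℕ) [NeZero N] : Measure (ℕ → Fin N) :=
  Measure.infinitePi fun _ => ProbabilityTheory.uniformOn Set.univ

instance (N : ℕ) [NeZero N] : IsProbabilityMeasure (uniformSeq N) := by
  unfold uniformSeq
  have : IsProbabilityMeasure (ProbabilityTheory.uniformOn (Set.univ : Set (Fin N))) :=
    ProbabilityTheory.isProbabilityMeasure_uniformOn Set.finite_univ ⟨0, trivial⟩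
  infer_instance

lemma uniformSeq_cylinder (N : ℕ) [NeZero N] (k : ℕ) (w : Fin k → Fin N) :
    uniformSeq N {ω | seqInit k ω = w} = ((N : ENNReal)⁻¹) ^ k := by
  have : IsProbabilityMeasure (ProbabilityTheory.uniformOn (Set.univ : Set (Fin N))) :=
    ProbabilityTheory.isProbabilityMeasure_uniformOn Set.finite_univ ⟨0, trivial⟩
  have h : {ω | seqInit k ω = w} = Set.pi (Finset.range k : Set ℕ)
      (fun i => if h : i < k then {w ⟨i, h⟩} else Set.univ) := by
    ext ω
    simp only [Set.mem_ofPred_eq, Set.mem_pi, Finset.coe_range, Set.mem_Iio]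
    constructor
    · rintro rfl i hi
      simp [hi, seqInit]
    · intro h
      funext i
      have := h i i.2
      simpa [seqInit] using this
  rw [h, uniformSeq, Measure.infinitePi_pi _ (fun i _ => MeasurableSet.of_discrete)]
  rw [Finset.prod_congr rfl (g := fun _ => (N : ENNReal)⁻¹), Finset.prod_const, Finset.card_range]
  intro i hi
  rw [dif_pos (Finset.mem_range.1 hi), ProbabilityTheory.uniformOn_univ]
  simp

lemma uniformSeq_le (N : ℕ) [NeZero N] (A : Set (ℕ → Fin N)) (k : ℕ) :
    uniformSeq N A ≤ ((seqInit k '' A).ncard : ENNReal) * ((N : ENNReal)⁻¹) ^ k := by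
  classical
  set W := (Set.toFinite (seqInit k '' A)).toFinset with hW
  have hsub : A ⊆ ⋃ w ∈ W, {ω | seqInit k ω = w} := by
    intro ω hω
    simp only [Set.mem_iUnion]
    exact ⟨seqInit k ω, by simpa [hW] using ⟨ω, hω, rfl⟩, rfl⟩
  refine (measure_mono hsub).trans ((measure_biUnion_finset_le _ _).trans ?_)
  simp_rw [uniformSeq_cylinder]
  rw [Finset.sum_const, nsmul_eq_mul, Set.ncard_eq_toFinset_card _ (Set.toFinite _)]

lemma ncard_seqInit_succ_le {N : ℕ} (A : Set (ℕ → Fin N)) (k b : ℕ)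
    (hb : ∀ w, {i | ∃ ω ∈ A, seqInit k ω = w ∧ ω k = i}.ncard ≤ b) :
    (seqInit (k + 1) '' A).ncard ≤ b * (seqInit k '' A).ncard := by
  classical
  set W := (Set.toFinite (seqInit (k + 1) '' A)).toFinset with hW
  have himg : W.image (fun w : Fin (k + 1) → Fin N => fun i : Fin k => w i.castSucc)
      = (Set.toFinite (seqInit k '' A)).toFinset := by
    ext w
    simp only [hW, Finset.mem_image, Set.Finite.mem_toFinset, Set.mem_image]
    constructor
    · rintro ⟨_, ⟨ω, hω, rfl⟩, rfl⟩
      exact ⟨ω, hω, rfl⟩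
    · rintro ⟨ω, hω, rfl⟩
      exact ⟨_, ⟨ω, hω, rfl⟩, rfl⟩
  rw [Set.ncard_eq_toFinset_card _ (Set.toFinite (seqInit (k + 1) '' A)),
    Set.ncard_eq_toFinset_card _ (Set.toFinite (seqInit k '' A)), ← himg]
  refine Finset.card_le_mul_card_image _ _ fun w _ => ?_
  refine le_trans ?_ (hb w)
  rw [← Set.ncard_coe_finset]
  refine Set.ncard_le_ncard_of_injOn (fun w' => w' (Fin.last k)) ?_ ?_ (Set.toFinite _)
  · intro w' hw'
    simp only [Finset.coe_filter, Set.Finite.mem_toFinset, Set.mem_ofPred_eq] at hw'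
    obtain ⟨⟨ω, hω, rfl⟩, h⟩ := hw'
    exact ⟨ω, hω, h, rfl⟩
  · intro w₁ h₁ w₂ h₂ h
    simp only [Finset.coe_filter, Set.mem_ofPred_eq] at h₁ h₂
    funext i
    refine Fin.lastCases h (fun i => ?_) i
    exact congrFun (h₁.2.trans h₂.2.symm) i

section tree

variable {N : ℕ} {S : ℕ → Type*}

/-- The branch of a tree prescribed by a sequence of choices. -/
def branch (s₀ : S 0) (child : ∀ k, S k → Fin N → S (k + 1)) (ω : ℕ → Fin N) : ∀ k, S k
  | 0 => s₀
  | k + 1 => child k (branch s₀ child ω k) (ω k)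

lemma branch_congr (s₀ : S 0) (child : ∀ k, S k → Fin N → S (k + 1)) {ω ω' : ℕ → Fin N} {k : ℕ}
    (h : seqInit k ω = seqInit k ω') : branch s₀ child ω k = branch s₀ child ω' k := by
  induction k with
  | zero => rfl
  | succ k ih =>
    have h1 : seqInit k ω = seqInit k ω' := funext fun i => congrFun h i.castSucc
    have h2 : ω k = ω' k := congrFun h (Fin.last k)
    simp only [branch, ih h1, h2]

variable {X : Type*}

lemma exists_limit_point [MetricSpace X] [CompleteSpace X] (s₀ : S 0) (child : ∀ k, S k → Fin N → S (k + 1))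
    (R : ∀ k, S k → Set X) (hcl : ∀ k s, IsClosed (R k s)) (hne : ∀ k s, (R k s).Nonempty)
    {r : ℕ → ℝ} (hr : Filter.Tendsto r Filter.atTop (nhds 0))
    (hdiam : ∀ k s, ∀ x ∈ R k s, ∀ y ∈ R k s, dist x y ≤ r k)
    (hsub : ∀ k s i, R (k + 1) (child k s i) ⊆ R k s) (ω : ℕ → Fin N) :
    ∃ x, ∀ k, x ∈ R k (branch s₀ child ω k) := by
  have hanti : Antitone fun k => R k (branch s₀ child ω k) :=
    antitone_nat_of_succ_le fun k => hsub k _ _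
  have hr0 : ∀ k, 0 ≤ r k := fun k => by
    obtain ⟨x, hx⟩ := hne k (branch s₀ child ω k)
    exact dist_nonneg.trans (hdiam k _ x hx x hx)
  have := Metric.nonempty_iInter_of_nonempty_biInter (s := fun k => R k (branch s₀ child ω k))
    (fun k => hcl k _) (fun k => Metric.isBounded_iff.2 ⟨r k, fun x hx y hy => hdiam k _ x hx y hy⟩)
    (fun n => ?_) (squeeze_zero (fun _ => Metric.diam_nonneg)
      (fun k => Metric.diam_le_of_forall_dist_le (hr0 k) (hdiam k _)) hr)
  · obtain ⟨x, hx⟩ := this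
    exact ⟨x, fun k => Set.mem_iInter.1 hx k⟩
  · obtain ⟨x, hx⟩ := hne n (branch s₀ child ω n)
    exact ⟨x, Set.mem_iInter₂.2 fun k hk => hanti hk hx⟩

lemma measurable_limit_point [MetricSpace X] [MeasurableSpace X] [BorelSpace X] [NeZero N]
    (s₀ : S 0) (child : ∀ k, S k → Fin N → S (k + 1))
    (R : ∀ k, S k → Set X) (hne : ∀ k s, (R k s).Nonempty)
    {r : ℕ → ℝ} (hr : Filter.Tendsto r Filter.atTop (nhds 0))
    (hdiam : ∀ k s, ∀ x ∈ R k s, ∀ y ∈ R k s, dist x y ≤ r k)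
    (f : (ℕ → Fin N) → X) (hf : ∀ ω k, f ω ∈ R k (branch s₀ child ω k)) : Measurable f := by
  let ext (k : ℕ) (w : Fin k → Fin N) : ℕ → Fin N := fun i => if h : i < k then w ⟨i, h⟩ else 0
  let g (k : ℕ) (w : Fin k → Fin N) : X := (hne k (branch s₀ child (ext k w) k)).some
  have hg : ∀ k, Measurable fun ω : ℕ → Fin N => g k (seqInit k ω) := fun k =>
    (measurable_of_finite (g k)).comp (measurable_pi_lambda _ fun i => measurable_pi_apply _)
  refine measurable_of_tendsto_metrizable hg ?_
  rw [tendsto_pi_nhds]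
  intro ω
  rw [tendsto_iff_dist_tendsto_zero]
  refine squeeze_zero (fun _ => dist_nonneg) (fun k =>
    hdiam k (branch s₀ child ω k) _ ?_ _ (hf ω k)) hr
  have h : branch s₀ child (ext k (seqInit k ω)) k = branch s₀ child ω k := by
    refine branch_congr s₀ child ?_
    funext i
    simp [seqInit, ext]
  have := (hne k (branch s₀ child (ext k (seqInit k ω)) k)).some_mem
  rw [← h]
  exact this

lemma uniformSeq_preimage_le [NeZero N] (s₀ : S 0)
    (child : ∀ k, S k → Fin N → S (k + 1)) (R : ∀ k, S k → Set X)
    (f : (ℕ → Fin N) → X) (hf : ∀ ω k, f ω ∈ R k (branch s₀ child ω k)) (n : ℕ)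
    (U : Set X) (k m : ℕ)
    (hsep : ∀ l < k, ∀ s, {i | (R (l + 1) (child l s i) ∩ U).Nonempty}.ncard ≤ 1)
    (hstrip : ∀ l < k + m, ∀ s, {i | (R (l + 1) (child l s i) ∩ U).Nonempty}.ncard ≤ n) :
    uniformSeq N (f ⁻¹' U) ≤ (n : ENNReal) ^ m * ((N : ENNReal)⁻¹) ^ (k + m) := by
  have key : ∀ l b : ℕ, (∀ s, {i | (R (l + 1) (child l s i) ∩ U).Nonempty}.ncard ≤ b) →
      (seqInit (l + 1) '' (f ⁻¹' U)).ncard ≤ b * (seqInit l '' (f ⁻¹' U)).ncard := by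
    intro l b hb
    refine ncard_seqInit_succ_le _ _ _ fun w => ?_
    by_cases h : ∃ ω : ℕ → Fin N, seqInit l ω = w
    · obtain ⟨ω₀, rfl⟩ := h
      refine (Set.ncard_le_ncard ?_ (Set.toFinite _)).trans (hb (branch s₀ child ω₀ l))
      rintro i ⟨ω, hω, h1, rfl⟩
      refine ⟨f ω, ?_, hω⟩
      have := hf ω (l + 1)
      rwa [branch, branch_congr s₀ child h1] at this
    · have : {i | ∃ ω ∈ f ⁻¹' U, seqInit l ω = w ∧ ω l = i} = ∅ := by
        ext i
        simp only [Set.mem_ofPred_eq, Set.mem_empty_iff_false, iff_false]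
        rintro ⟨ω, -, h1, -⟩
        exact h ⟨ω, h1⟩
      rw [this]; simp
  have h1 : ∀ l ≤ k, (seqInit l '' (f ⁻¹' U)).ncard ≤ 1 := by
    intro l
    induction l with
    | zero => intro _; exact Set.ncard_le_one_of_subsingleton _
    | succ l ih => intro hl; have := key l 1 (hsep l (by omega)); have := ih (by omega); omega
  have h2 : ∀ j ≤ m, (seqInit (k + j) '' (f ⁻¹' U)).ncard ≤ n ^ j := by
    intro j
    induction j with
    | zero => intro _; simpa using h1 k le_rfl
    | succ j ih =>
      intro hj
      refine (key (k + j) n (hstrip _ (by omega))).trans ?_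
      rw [pow_succ, mul_comm]
      exact Nat.mul_le_mul_right _ (ih (by omega))
  refine (uniformSeq_le N _ (k + m)).trans ?_
  gcongr
  exact_mod_cast h2 m le_rfl

end tree

lemma pow_mul_inv_pow_le {N n : ℕ} {M w₁ w₂ a x : ℝ} (hM : 1 < M) (hw₁ : 0 < w₁) (hw₂ : 0 < w₂)
    (hsum : w₁ + w₂ = 1) (ha : 0 < a) (ha1 : 2 * a < 1)
    (hN : M ^ (2 - a) ≤ N) (hn : (n : ℝ) ≤ M ^ (w₁ + a)) {k m : ℕ}
    (hk : (M ^ (-(1 + w₁))) ^ (k + 1) < x) (hm : (M ^ (-(1 + w₂))) ^ (k + m + 1) < x) :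
    (n : ℝ) ^ m * ((N : ℝ)⁻¹) ^ (k + m) ≤
      M ^ (2 - a) * x ^ ((w₁ + a) / (1 + w₁) + (1 + w₂ - 2 * a) / (1 + w₂)) := by
  have hM0 : 0 < M := by linarith
  have hx : 0 < x := lt_trans (by positivity) hk
  have hMp : 0 < M ^ (2 - a) := Real.rpow_pos_of_pos hM0 _
  have hN0 : (0 : ℝ) < N := hMp.trans_le hN
  have h1 : (n : ℝ) ^ m ≤ M ^ ((w₁ + a) * m) := by
    rw [Real.rpow_mul_natCast hM0.le]; gcongr
  have h2 : ((N : ℝ)⁻¹) ^ (k + m) ≤ M ^ (-(2 - a) * (k + m : ℕ)) := by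
    rw [Real.rpow_mul_natCast hM0.le, Real.rpow_neg hM0.le]; gcongr
  have h3 : M ^ (-(1 + w₁) * (k : ℕ)) ≤ M ^ (1 + w₁) * x := by
    calc M ^ (-(1 + w₁) * (k : ℕ)) = M ^ (1 + w₁) * (M ^ (-(1 + w₁))) ^ (k + 1) := by
          rw [← Real.rpow_mul_natCast hM0.le, ← Real.rpow_add hM0]; push_cast; ring_nf
      _ ≤ _ := by gcongr
  have h4 : M ^ (-(1 + w₂) * (k + m : ℕ)) ≤ M ^ (1 + w₂) * x := by
    calc M ^ (-(1 + w₂) * (k + m : ℕ)) = M ^ (1 + w₂) * (M ^ (-(1 + w₂))) ^ (k + m + 1) := by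
          rw [← Real.rpow_mul_natCast hM0.le, ← Real.rpow_add hM0]; push_cast; ring_nf
      _ ≤ _ := by gcongr
  set A := (w₁ + a) / (1 + w₁) with hA
  set B := (1 + w₂ - 2 * a) / (1 + w₂) with hB
  have hA0 : 0 ≤ A := by positivity
  have hB0 : 0 ≤ B := div_nonneg (by linarith) (by linarith)
  have hA1 : (1 + w₁) * A = w₁ + a := by rw [hA]; field_simp
  have hB1 : (1 + w₂) * B = 1 + w₂ - 2 * a := by rw [hB]; field_simp
  calc (n : ℝ) ^ m * ((N : ℝ)⁻¹) ^ (k + m)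
      ≤ M ^ ((w₁ + a) * m) * M ^ (-(2 - a) * (k + m : ℕ)) := by gcongr
    _ = (M ^ (-(1 + w₁) * (k : ℕ))) ^ A * (M ^ (-(1 + w₂) * (k + m : ℕ))) ^ B := by
        rw [← Real.rpow_mul hM0.le, ← Real.rpow_mul hM0.le, ← Real.rpow_add hM0,
          ← Real.rpow_add hM0]
        congr 1
        rw [show -(1 + w₁) * (k : ℝ) * A = -((1 + w₁) * A) * k by ring,
          show -(1 + w₂) * ((k + m : ℕ) : ℝ) * B = -((1 + w₂) * B) * (k + m : ℕ) by ring, hA1, hB1]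
        push_cast
        rw [show w₂ = 1 - w₁ by linarith]; ring
    _ ≤ (M ^ (1 + w₁) * x) ^ A * (M ^ (1 + w₂) * x) ^ B := by gcongr
    _ = M ^ (2 - a) * x ^ (A + B) := by
        rw [Real.mul_rpow (by positivity) hx.le, Real.mul_rpow (by positivity) hx.le,
          ← Real.rpow_mul hM0.le, ← Real.rpow_mul hM0.le, hA1, hB1, Real.rpow_add hx,
          show (2 : ℝ) - a = (w₁ + a) + (1 + w₂ - 2 * a) by linarith,
          Real.rpow_add hM0 (w₁ + a)]
        ring

/-- A mass distribution principle for trees of nested closed sets: at step `k` sets of diameter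
`≤ c M ^ (-(1 + w₁) k)` meet at most one child, sets of diameter `≤ c M ^ (-(1 + w₂) k)` meet at
most `n` of the `N` children. -/
lemma le_dimH_of_tree {X : Type*} [MetricSpace X] [CompleteSpace X] [MeasurableSpace X]
    [BorelSpace X] {N n : ℕ} [NeZero N] {M c w₁ w₂ a : ℝ} (hM : 1 < M) (hc : 0 < c)
    (hw₂ : 0 < w₂) (hw : w₂ ≤ w₁) (hsum : w₁ + w₂ = 1) (ha : 0 < a) (ha1 : 2 * a < 1)
    (hN : M ^ (2 - a) ≤ N) (hn : (n : ℝ) ≤ M ^ (w₁ + a))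
    {S : ℕ → Type*} (s₀ : S 0) (child : ∀ k, S k → Fin N → S (k + 1))
    (R : ∀ k, S k → Set X) (hcl : ∀ k s, IsClosed (R k s)) (hne : ∀ k s, (R k s).Nonempty)
    {r : ℕ → ℝ} (hr : Filter.Tendsto r Filter.atTop (nhds 0))
    (hdiam : ∀ k s, ∀ x ∈ R k s, ∀ y ∈ R k s, dist x y ≤ r k)
    (hsub : ∀ k s i, R (k + 1) (child k s i) ⊆ R k s)
    (hsep : ∀ k s (U : Set X), (∀ x ∈ U, ∀ y ∈ U, dist x y ≤ c * (M ^ (-(1 + w₁))) ^ (k + 1)) →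
      {i | (R (k + 1) (child k s i) ∩ U).Nonempty}.ncard ≤ 1)
    (hstrip : ∀ k s (U : Set X), (∀ x ∈ U, ∀ y ∈ U, dist x y ≤ c * (M ^ (-(1 + w₂))) ^ (k + 1)) →
      {i | (R (k + 1) (child k s i) ∩ U).Nonempty}.ncard ≤ n)
    (A : Set X) (hA : ∀ x, (∀ k, ∃ s, x ∈ R k s) → x ∈ A) :
    ENNReal.ofReal ((w₁ + a) / (1 + w₁) + (1 + w₂ - 2 * a) / (1 + w₂)) ≤ dimH A := by
  have hw₁ : 0 < w₁ := by linarith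
  have hM0 : 0 < M := by linarith
  choose f hf using exists_limit_point s₀ child R hcl hne hr hdiam hsub
  have hfm : Measurable f := measurable_limit_point s₀ child R hne hr hdiam f hf
  set s := (w₁ + a) / (1 + w₁) + (1 + w₂ - 2 * a) / (1 + w₂) with hs
  have hs0 : 0 < s := add_pos (by positivity) (div_pos (by linarith) (by linarith))
  set K := M ^ (2 - a) * c⁻¹ ^ s with hK
  have hK0 : 0 < K := by positivity
  set y₁ := M ^ (-(1 + w₁)) with hy₁
  set y₂ := M ^ (-(1 + w₂)) with hy₂
  have hy₁0 : 0 < y₁ := Real.rpow_pos_of_pos hM0 _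
  have hy₂0 : 0 < y₂ := Real.rpow_pos_of_pos hM0 _
  have hy12 : y₁ ≤ y₂ := Real.rpow_le_rpow_of_exponent_le hM.le (by linarith)
  have hy₁1 : y₁ < 1 := Real.rpow_lt_one_of_one_lt_of_neg hM (by linarith)
  have hy₂1 : y₂ < 1 := Real.rpow_lt_one_of_one_lt_of_neg hM (by linarith)
  have main : ∀ ρ : ℝ, 0 < ρ → ρ ≤ c → ∀ U : Set X, (∀ x ∈ U, ∀ y ∈ U, dist x y ≤ ρ) →
      uniformSeq N (f ⁻¹' U) ≤ ENNReal.ofReal (K * ρ ^ s) := by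
    intro ρ hρ hρc U hU
    have hx0 : 0 < ρ / c := by positivity
    have hx1 : ρ / c ≤ 1 := (div_le_one hc).2 hρc
    obtain ⟨k, hk1, hk2⟩ := exists_nat_pow_near_of_lt_one hx0 hx1 hy₁0 hy₁1
    obtain ⟨l, hl1, hl2⟩ := exists_nat_pow_near_of_lt_one hx0 hx1 hy₂0 hy₂1
    have hkl : k ≤ l := by
      by_contra! h
      have h1 : y₂ ^ k ≤ y₂ ^ (l + 1) := pow_le_pow_of_le_one hy₂0.le hy₂1.le h
      have h2 : y₁ ^ k ≤ y₂ ^ k := pow_le_pow_left₀ hy₁0.le hy12 k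
      linarith
    obtain ⟨m, rfl⟩ := Nat.exists_eq_add_of_le hkl
    rw [div_le_iff₀ hc] at hk2 hl2
    refine (uniformSeq_preimage_le s₀ child R f hf n U k m (fun j hj t => hsep j t U fun x hx y hy =>
      ?_) (fun j hj t => hstrip j t U fun x hx y hy => ?_)).trans ?_
    · refine (hU x hx y hy).trans (hk2.trans ?_)
      rw [mul_comm]
      exact mul_le_mul_of_nonneg_left (pow_le_pow_of_le_one hy₁0.le hy₁1.le hj) hc.le
    · refine (hU x hx y hy).trans (hl2.trans ?_)
      rw [mul_comm]
      exact mul_le_mul_of_nonneg_left (pow_le_pow_of_le_one hy₂0.le hy₂1.le hj) hc.le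
    · have := pow_mul_inv_pow_le hM hw₁ hw₂ hsum ha ha1 hN hn hk1 hl1
      rw [← hs, div_eq_inv_mul, Real.mul_rpow (by positivity) hρ.le, ← mul_assoc, ← hK] at this
      refine le_trans (le_of_eq ?_) (ENNReal.ofReal_le_ofReal this)
      have hN0 : (0 : ℝ) < N := by exact_mod_cast Nat.pos_of_ne_zero (NeZero.ne N)
      rw [ENNReal.ofReal_mul (by positivity), ENNReal.ofReal_pow (by positivity),
        ENNReal.ofReal_pow (by positivity), ENNReal.ofReal_inv_of_pos hN0, ENNReal.ofReal_natCast,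
        ENNReal.ofReal_natCast]
  set μ := (uniformSeq N).map f with hμ
  have hle : (ENNReal.ofReal K)⁻¹ • μ ≤ μH[s] := by
    refine Measure.le_hausdorffMeasure s _ (ENNReal.ofReal (c / 2)) (by simpa using hc) fun U hU => ?_
    have hfin : Metric.ediam U ≠ ⊤ := (hU.trans_lt ENNReal.ofReal_lt_top).ne
    have hcU : (uniformSeq N).map f U ≤ uniformSeq N (f ⁻¹' closure U) := by
      rw [← Measure.map_apply hfm isClosed_closure.measurableSet]
      exact measure_mono subset_closure
    set D := (Metric.ediam U).toReal with hD
    have hDc : D ≤ c / 2 := ENNReal.toReal_le_of_le_ofReal (by linarith) hU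
    have hdist : ∀ x ∈ closure U, ∀ y ∈ closure U, dist x y ≤ D := by
      intro x hx y hy
      rw [dist_edist, hD, ← Metric.ediam_closure]
      exact ENNReal.toReal_mono (by rwa [Metric.ediam_closure]) (Metric.edist_le_ediam_of_mem hx hy)
    have hlim : uniformSeq N (f ⁻¹' closure U) ≤ ENNReal.ofReal (K * D ^ s) := by
      have ht : Filter.Tendsto (fun ρ : ℝ => ENNReal.ofReal (K * ρ ^ s)) (nhdsWithin D (Set.Ioi D))
          (nhds (ENNReal.ofReal (K * D ^ s))) := by
        refine ENNReal.tendsto_ofReal (Filter.Tendsto.const_mul K ?_)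
        exact ((Real.continuousAt_rpow_const D s (Or.inr hs0.le)).tendsto).mono_left
          nhdsWithin_le_nhds
      refine ge_of_tendsto ht ?_
      filter_upwards [Ioo_mem_nhdsGT (show D < c by linarith)] with ρ hρ
      exact main ρ (ENNReal.toReal_nonneg.trans_lt hρ.1) hρ.2.le _
        fun x hx y hy => (hdist x hx y hy).trans hρ.1.le
    rw [Measure.smul_apply, smul_eq_mul, mul_comm, ← div_eq_mul_inv]
    refine ENNReal.div_le_of_le_mul ?_
    refine (hcU.trans hlim).trans (le_of_eq ?_)
    rw [ENNReal.ofReal_mul hK0.le, mul_comm, ← ENNReal.ofReal_rpow_of_nonneg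
      ENNReal.toReal_nonneg hs0.le, ENNReal.ofReal_toReal hfin]
  have hpos : μH[s] A ≠ 0 := by
    have h1 : (1 : ENNReal) ≤ μ A := by
      refine le_trans ?_ (Measure.le_map_apply hfm.aemeasurable A)
      rw [← measure_univ (μ := uniformSeq N)]
      refine measure_mono fun ω _ => ?_
      exact hA _ fun k => ⟨_, hf ω k⟩
    intro h0
    have h2 := hle A
    rw [h0, Measure.smul_apply, smul_eq_mul, nonpos_iff_eq_zero, mul_eq_zero] at h2
    rcases h2 with h2 | h2
    · exact ENNReal.ofReal_ne_top (ENNReal.inv_eq_zero.1 h2)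
    · rw [h2] at h1; simp at h1
  have := le_dimH_of_hausdorffMeasure_ne_zero (s := A) (d := s.toNNReal)
    (by rwa [Real.coe_toNNReal _ hs0.le])
  exact this

lemma card_filter_dvd_add_le (b : ℤ) (B g : ℕ) :
    (((Finset.range B).filter fun i : ℕ => (g : ℤ) ∣ b + i).card : ℝ) ≤ B / g + 1 := by
  have h : ((Finset.range B).filter fun i : ℕ => (g : ℤ) ∣ b + i).card ≤ B / g + 1 := by
    rw [← Finset.card_range (B / g + 1)]
    refine Finset.card_le_card_of_injOn (fun i => i / g) ?_ ?_
    · intro i hi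
      simp only [Finset.coe_filter, Finset.mem_range, Set.mem_ofPred_eq] at hi
      simp only [Finset.coe_range, Set.mem_Iio]
      exact Nat.lt_succ_of_le (Nat.div_le_div_right hi.1.le)
    · intro i hi j hj hij
      simp only [Finset.coe_filter, Finset.mem_range, Set.mem_ofPred_eq] at hi hj
      have h1 : (g : ℤ) ∣ (i : ℤ) - j := by
        have := dvd_sub hi.2 hj.2
        rwa [add_sub_add_left_eq_sub] at this
      have h2 : i % g = j % g := by
        have : (j : ℤ) ≡ i [ZMOD g] := (Int.modEq_iff_dvd).2 h1
        exact (Int.natCast_modEq_iff.1 this).symm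
      have hij' : i / g = j / g := hij
      rw [← Nat.div_add_mod i g, ← Nat.div_add_mod j g, h2, hij']
  calc (((Finset.range B).filter fun i : ℕ => (g : ℤ) ∣ b + i).card : ℝ) ≤ ((B / g + 1 : ℕ) : ℝ) := by
        exact_mod_cast h
    _ ≤ _ := by push_cast; gcongr; exact Nat.cast_div_le

lemma sum_inv_sq_le (n : ℕ) : ∑ g ∈ Finset.Icc 2 n, (1 : ℝ) / (g : ℝ) ^ 2 ≤ 3 / 4 := by
  rcases Nat.lt_or_ge n 2 with h | h
  · rw [Finset.Icc_eq_empty (by omega)]; norm_num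
  · suffices ∑ g ∈ Finset.Icc 2 n, (1 : ℝ) / (g : ℝ) ^ 2 ≤ 3 / 4 - 1 / n by
      have : (0 : ℝ) ≤ 1 / n := by positivity
      linarith
    induction n, h using Nat.le_induction with
    | base => norm_num
    | succ n hn ih =>
      rw [Finset.sum_Icc_succ_top (by omega)]
      have hn0 : (0 : ℝ) < n := by exact_mod_cast (by omega : 0 < n)
      have : (1 : ℝ) / ((n + 1 : ℕ) : ℝ) ^ 2 ≤ 1 / n - 1 / ((n + 1 : ℕ) : ℝ) := by
        push_cast
        rw [div_sub_div _ _ hn0.ne' (by positivity), div_le_div_iff₀ (by positivity) (by positivity)]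
        nlinarith
      linarith

lemma sum_inv_le (n : ℕ) : ∑ g ∈ Finset.Icc 2 n, (1 : ℝ) / (g : ℝ) ≤ 1 + Real.log n := by
  refine le_trans ?_ (harmonic_le_one_add_log n)
  rw [harmonic_eq_sum_Icc]
  push_cast
  simp only [one_div]
  exact Finset.sum_le_sum_of_subset_of_nonneg
    (Finset.Icc_subset_Icc_left (by omega)) fun i _ _ => by positivity

lemma card_coprime_pairs (c₀ : ℤ) (L B G : ℕ) (b₀ : ℕ → ℤ) (hG : ∀ l < L, |c₀ + l| ≤ G) :
    (L * B : ℝ) / 4 ≤ (((Finset.range L ×ˢ Finset.range B).filter fun p : ℕ × ℕ =>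
      c₀ + p.1 ≠ 0 ∧ IsCoprime (b₀ p.1 + p.2) (c₀ + p.1)).card : ℝ)
        + B + (L + B) * (1 + Real.log G) + G := by
  classical
  set P := Finset.range L ×ˢ Finset.range B with hP
  set good := P.filter fun p : ℕ × ℕ =>
      c₀ + p.1 ≠ 0 ∧ IsCoprime (b₀ p.1 + p.2) (c₀ + p.1) with hgood
  set zero := P.filter fun p : ℕ × ℕ => c₀ + p.1 = 0 with hzero
  let ng (g : ℕ) := P.filter fun p : ℕ × ℕ => (g : ℤ) ∣ c₀ + p.1 ∧ (g : ℤ) ∣ b₀ p.1 + p.2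
  have hcov : P ⊆ good ∪ zero ∪ (Finset.Icc 2 G).biUnion ng := by
    rintro ⟨l, i⟩ hp
    by_cases h0 : c₀ + l = 0
    · simp [hzero, hp, h0]
    by_cases h1 : IsCoprime (b₀ l + i) (c₀ + l)
    · simp [hgood, hp, h0, h1]
    · refine Finset.mem_union_right _ (Finset.mem_biUnion.2
        ⟨Int.gcd (b₀ l + i) (c₀ + l), ?_, ?_⟩)
      · rw [Int.isCoprime_iff_gcd_eq_one] at h1
        have hd : (Int.gcd (b₀ l + i) (c₀ + l) : ℤ) ∣ c₀ + l := Int.gcd_dvd_right _ _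
        have hpos : 0 < Int.gcd (b₀ l + i) (c₀ + l) := Int.gcd_pos_of_ne_zero_right _ h0
        have hl : l < L := by simp [hP] at hp; exact hp.1
        have hle := Int.le_of_dvd (abs_pos.2 h0) ((dvd_abs _ _).2 hd)
        have := hG l hl
        rw [Finset.mem_Icc]
        omega
      · simp only [ng, Finset.mem_filter]
        exact ⟨hp, Int.gcd_dvd_right _ _, Int.gcd_dvd_left _ _⟩
  have hcard := (Finset.card_le_card hcov).trans ((Finset.card_union_le _ _).trans
    (add_le_add (Finset.card_union_le _ _) Finset.card_biUnion_le))
  have hPc : P.card = L * B := by simp [hP]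
  have hzc : zero.card ≤ B := by
    rw [← Finset.card_range B]
    refine Finset.card_le_card_of_injOn Prod.snd ?_ ?_
    · rintro ⟨l, i⟩ h
      simp [hzero, hP] at h ⊢; exact h.1.2
    · rintro ⟨l, i⟩ h ⟨l', i'⟩ h' e
      simp only [hzero, Finset.coe_filter, Set.mem_ofPred_eq] at h h'
      simp only at e
      ext
      · simp only; omega
      · exact e
  have hngc : ∀ g ∈ Finset.Icc 2 G, ((ng g).card : ℝ) ≤ (L / g + 1) * (B / g + 1) := by
    intro g hg
    have hg0 : 0 < g := by have := (Finset.mem_Icc.1 hg).1; omega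
    have : ng g = ((Finset.range L).filter fun l : ℕ => (g : ℤ) ∣ c₀ + l).biUnion fun l =>
        ((Finset.range B).filter fun i : ℕ => (g : ℤ) ∣ b₀ l + i).image fun i => (l, i) := by
      ext ⟨l, i⟩
      simp [ng, hP]
      tauto
    rw [this]
    calc _ ≤ ((∑ l ∈ (Finset.range L).filter fun l : ℕ => (g : ℤ) ∣ c₀ + l,
          (((Finset.range B).filter fun i : ℕ => (g : ℤ) ∣ b₀ l + i).image fun i => (l, i)).card : ℕ) : ℝ) := by
          exact_mod_cast Finset.card_biUnion_le
      _ ≤ ∑ l ∈ (Finset.range L).filter (fun l : ℕ => (g : ℤ) ∣ c₀ + l), ((B : ℝ) / g + 1) := by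
          push_cast
          refine Finset.sum_le_sum fun l _ => ?_
          refine le_trans ?_ (card_filter_dvd_add_le (b₀ l) B g)
          exact_mod_cast Finset.card_image_le
      _ ≤ _ := by
          rw [Finset.sum_const, nsmul_eq_mul]
          gcongr
          exact card_filter_dvd_add_le c₀ L g
  have hsum : ((∑ g ∈ Finset.Icc 2 G, (ng g).card : ℕ) : ℝ)
      ≤ 3 / 4 * (L * B) + (L + B) * (1 + Real.log G) + G := by
    push_cast
    calc ∑ g ∈ Finset.Icc 2 G, ((ng g).card : ℝ)
        ≤ ∑ g ∈ Finset.Icc 2 G, ((L * B : ℝ) * (1 / (g : ℝ) ^ 2) + (L + B) * (1 / (g : ℝ)) + 1) := by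
          refine Finset.sum_le_sum fun g hg => (hngc g hg).trans (le_of_eq ?_)
          have hg0 : (g : ℝ) ≠ 0 := by
            have := (Finset.mem_Icc.1 hg).1; exact_mod_cast (by omega : g ≠ 0)
          field_simp; ring
      _ ≤ _ := by
          rw [Finset.sum_add_distrib, Finset.sum_add_distrib, ← Finset.mul_sum, ← Finset.mul_sum,
            mul_comm (3 / 4 : ℝ)]
          gcongr
          · exact sum_inv_sq_le G
          · exact sum_inv_le G
          · simp
  have hcard' : (P.card : ℝ) ≤ good.card + zero.card + (∑ g ∈ Finset.Icc 2 G, (ng g).card : ℕ) := by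
    exact_mod_cast hcard
  rw [hPc] at hcard'
  have hzc' : (zero.card : ℝ) ≤ B := by exact_mod_cast hzc
  push_cast at hcard' hsum
  linarith

/-- The size parameters of one step of the construction. -/
structure StepSize (e₁ e₂ Q m₁ m₂ : ℝ) : Prop where
  Q_pos : 0 < Q
  e₁_pos : 0 < e₁
  e_le : e₁ ≤ e₂
  mul_le : e₁ * e₂ * Q ≤ 1
  m₂_ge : 4096 ≤ m₂
  m_le : m₂ ≤ m₁

/-- A positive basis `u, v, t` of `ℤ³` whose vectors `u, v` have controlled size. -/
structure LatFlag (e₁ e₂ Q : ℝ) (u v t : RVec) : Prop where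
  q_lo : Q ≤ u.2
  q_hi : u.2 ≤ 4 * Q
  x0_lo : e₁ / 64 ≤ offs 0 u v
  x0_hi : offs 0 u v ≤ e₁ / 2
  x1_lo : e₂ / 64 ≤ offs 1 u v
  x1_hi : offs 1 u v ≤ e₂ / 2
  v_le : |v.2| ≤ u.2
  det : det3 u v t = 1

/-- The coefficients `a, b, c` produce an admissible next vector `a u + b v + c t`. -/
structure Admissible (e₁ e₂ Q m₁ m₂ : ℝ) (u v t : RVec) (a b c : ℤ) : Prop where
  cop : IsCoprime b c
  q_lo : m₁ * m₂ * Q ≤ a * u.2 + b * v.2 + c * t.2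
  q_hi : a * u.2 + b * v.2 + c * t.2 ≤ 4 * (m₁ * m₂ * Q)
  x0_lo : e₁ * m₂ / 8 * (127 / 128) ≤ b * offs 0 u v + c * offs 0 u t
  x0_hi : b * offs 0 u v + c * offs 0 u t ≤ e₁ * m₂ / 8
  x1_lo : e₂ * m₁ / 16 ≤ b * offs 1 u v + c * offs 1 u t
  x1_hi : b * offs 1 u v + c * offs 1 u t ≤ e₂ * m₁ / 8

section

variable {e₁ e₂ Q m₁ m₂ : ℝ} {u v t : RVec} {a b c : ℤ}

def comb (u v t : RVec) (a b c : ℤ) : RVec := a • u + b • v + c • t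

lemma comb_snd : ((comb u v t a b c).2 : ℝ) = a * u.2 + b * v.2 + c * t.2 := by
  simp [comb]

lemma offs_comb (j : Fin 2) (hu : u.2 ≠ 0) :
    offs j u (comb u v t a b c) = b * offs j u v + c * offs j u t := by
  rw [comb, offs_add, offs_add, offs_smul, offs_smul, offs_smul, offs_self j u hu]; ring

lemma StepSize.pos (h : StepSize e₁ e₂ Q m₁ m₂) : 0 < e₂ ∧ 0 < m₂ ∧ 0 < m₁ := by
  have := h.e₁_pos; have := h.e_le; have := h.m₂_ge; have := h.m_le
  refine ⟨?_, ?_, ?_⟩ <;> linarith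

lemma LatFlag.q_pos (h : LatFlag e₁ e₂ Q u v t) (hQ : 0 < Q) : (0 : ℝ) < u.2 := hQ.trans_le h.q_lo

lemma LatFlag.q_ne (h : LatFlag e₁ e₂ Q u v t) (hQ : 0 < Q) : u.2 ≠ 0 := by
  have := h.q_pos hQ
  exact_mod_cast this.ne'

lemma offs_neg_left (j : Fin 2) {z : RVec} (hu : u.2 ≠ 0) (hz : z.2 ≠ 0) :
    offs j z (-u) = u.2 * offs j u z / z.2 := by
  have hu' : (u.2 : ℝ) ≠ 0 := by exact_mod_cast hu
  have hz' : (z.2 : ℝ) ≠ 0 := by exact_mod_cast hz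
  simp only [offs, Prod.fst_neg, Prod.snd_neg, Pi.neg_apply]
  push_cast
  field_simp
  ring

lemma det3_comb (p r : ℤ) : det3 (comb u v t a b c) (-u) (p • v + r • t)
    = (b * r - c * p) * det3 u v t := by
  simp [comb, det3]; ring

lemma Admissible.flag (hs : StepSize e₁ e₂ Q m₁ m₂) (hf : LatFlag e₁ e₂ Q u v t)
    (h : Admissible e₁ e₂ Q m₁ m₂ u v t a b c) :
    ∃ t', LatFlag (e₁ / m₁) (e₂ / m₂) (m₁ * m₂ * Q) (comb u v t a b c) (-u) t' := by
  obtain ⟨he₂, hm₂, hm₁⟩ := hs.pos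
  have hQ := hs.Q_pos
  have he₁ := hs.e₁_pos
  have hm2 := hs.m₂_ge
  have hle := hs.m_le
  have hu := hf.q_ne hQ
  have hqp := hf.q_pos hQ
  have hMQ : 0 < m₁ * m₂ * Q := by positivity
  have hz : (0 : ℝ) < (comb u v t a b c).2 := by rw [comb_snd]; exact hMQ.trans_le h.q_lo
  have hz' : (comb u v t a b c).2 ≠ 0 := by exact_mod_cast hz.ne'
  obtain ⟨r, p, hrp⟩ := h.cop
  have hlo := h.q_lo
  have hhi := h.q_hi
  rw [← comb_snd] at hlo hhi
  have hqlo := hf.q_lo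
  have hqhi := hf.q_hi
  have lo : ∀ X e w w' : ℝ, 0 < e → 0 < w' → w * w' = m₁ * m₂ → e * w' / 16 ≤ X → 0 < w →
      e / w / 64 ≤ u.2 * X / (comb u v t a b c).2 := by
    intro X e w w' he hw' hww hX hw0
    rw [le_div_iff₀ hz]
    calc e / w / 64 * (comb u v t a b c).2 ≤ e / w / 64 * (4 * (m₁ * m₂ * Q)) := by gcongr
      _ = Q * (e * w' / 16) := by rw [← hww]; field_simp; ring
      _ ≤ u.2 * X := by gcongr
  have hi : ∀ X e w w' : ℝ, 0 < e → 0 < w' → w * w' = m₁ * m₂ → X ≤ e * w' / 8 → 0 < w →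
      u.2 * X / (comb u v t a b c).2 ≤ e / w / 2 := by
    intro X e w w' he hw' hww hX hw0
    rw [div_le_iff₀ hz]
    calc u.2 * X ≤ u.2 * (e * w' / 8) := by gcongr
      _ ≤ (4 * Q) * (e * w' / 8) := by gcongr
      _ = e / w / 2 * (m₁ * m₂ * Q) := by rw [← hww]; field_simp; ring
      _ ≤ _ := by gcongr
  have hx0 := h.x0_lo
  refine ⟨(-p) • v + r • t, hlo, hhi, ?_, ?_, ?_, ?_, ?_, ?_⟩
  · rw [offs_neg_left 0 hu hz', offs_comb 0 hu]
    exact lo _ e₁ m₁ m₂ he₁ hm₂ rfl (by nlinarith [mul_pos he₁ hm₂]) hm₁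
  · rw [offs_neg_left 0 hu hz', offs_comb 0 hu]
    exact hi _ e₁ m₁ m₂ he₁ hm₂ rfl h.x0_hi hm₁
  · rw [offs_neg_left 1 hu hz', offs_comb 1 hu]
    exact lo _ e₂ m₂ m₁ he₂ hm₁ (mul_comm _ _) h.x1_lo hm₂
  · rw [offs_neg_left 1 hu hz', offs_comb 1 hu]
    exact hi _ e₂ m₂ m₁ he₂ hm₁ (mul_comm _ _) h.x1_hi hm₂
  · have h1 : (|(-u).2| : ℝ) = u.2 := by simp [abs_of_pos hqp]
    have h2 : (u.2 : ℝ) ≤ (comb u v t a b c).2 := by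
      refine hqhi.trans (le_trans ?_ hlo)
      gcongr; nlinarith
    have h3 : |(-u).2| = u.2 := by
      have : ((|(-u).2| : ℤ) : ℝ) = u.2 := by push_cast; simpa using h1
      exact_mod_cast this
    rw [h3]; exact_mod_cast h2
  · rw [det3_comb, hf.det]
    linear_combination hrp

/-- Points approximated by `u` with errors at most `E₁`, `E₂`. -/
def rect (u : RVec) (E₁ E₂ : ℝ) : Set (EuclideanSpace ℝ (Fin 2)) :=
  {x | |u.2 * x 0 - u.1 0| ≤ E₁ ∧ |u.2 * x 1 - u.1 1| ≤ E₂}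

lemma sub_eq_offs_div (j : Fin 2) {z : RVec} (hz : z.2 ≠ 0) (x : ℝ) :
    x - u.1 j / u.2 = (z.2 * x - z.1 j) / z.2 + offs j u z / z.2 := by
  have hz' : (z.2 : ℝ) ≠ 0 := by exact_mod_cast hz
  simp only [offs]; field_simp; ring

lemma abs_sub_offs_div_le (j : Fin 2) {z : RVec} {x E q₀ : ℝ} (hq₀ : 0 < q₀) (hz : q₀ ≤ z.2)
    (h : |z.2 * x - z.1 j| ≤ E) : |x - u.1 j / u.2 - offs j u z / z.2| ≤ E / q₀ := by
  have hz0 : (0 : ℝ) < z.2 := hq₀.trans_le hz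
  have hz' : z.2 ≠ 0 := by exact_mod_cast hz0.ne'
  rw [sub_eq_offs_div j hz', add_sub_cancel_right, abs_div, abs_of_pos hz0]
  have := (abs_nonneg _).trans h
  gcongr

lemma Admissible.rect_subset (hs : StepSize e₁ e₂ Q m₁ m₂) (hf : LatFlag e₁ e₂ Q u v t)
    (h : Admissible e₁ e₂ Q m₁ m₂ u v t a b c) :
    rect (comb u v t a b c) (e₁ / m₁ / m₁) (e₂ / m₂ / m₂) ⊆ rect u (e₁ / m₁) (e₂ / m₂) := by
  obtain ⟨he₂, hm₂, hm₁⟩ := hs.pos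
  have hQ := hs.Q_pos
  have he₁ := hs.e₁_pos
  have hm2 := hs.m₂_ge
  have hle := hs.m_le
  have hu := hf.q_ne hQ
  have hqp := hf.q_pos hQ
  have hMQ : 0 < m₁ * m₂ * Q := by positivity
  have hlo := h.q_lo
  rw [← comb_snd] at hlo
  obtain ⟨t', hf'⟩ := h.flag hs hf
  have hz : (comb u v t a b c).2 ≠ 0 := hf'.q_ne hMQ
  have key : ∀ (j : Fin 2) (x e m : ℝ), 0 < e → 4096 ≤ m →
      |(comb u v t a b c).2 * x - (comb u v t a b c).1 j| ≤ e / m / m →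
      0 ≤ offs j (comb u v t a b c) (-u) → offs j (comb u v t a b c) (-u) ≤ e / m / 2 →
      |u.2 * x - u.1 j| ≤ e / m := by
    intro j x e m he hm hx h0 h1
    have hm0 : 0 < m := by linarith
    have h2 := abs_sub_offs_div_le (u := u) j hMQ hlo hx
    rw [offs_neg_left j hu hz] at h0 h1
    have h3 : (u.2 : ℝ) * x - u.1 j = u.2 * (x - u.1 j / u.2
        - offs j u (comb u v t a b c) / (comb u v t a b c).2)
        + u.2 * offs j u (comb u v t a b c) / (comb u v t a b c).2 := by field_simp; ring
    rw [h3]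
    refine (abs_add_le _ _).trans ?_
    rw [abs_mul, abs_of_pos hqp, abs_of_nonneg h0]
    have h4 : (u.2 : ℝ) * |x - u.1 j / u.2
        - offs j u (comb u v t a b c) / (comb u v t a b c).2| ≤ e / m / 2 := by
      calc _ ≤ (4 * Q) * (e / m / m / (m₁ * m₂ * Q)) := by
            have := hf.q_hi
            gcongr
        _ = e / m / 2 * (8 / (m * (m₁ * m₂))) := by field_simp; norm_num
        _ ≤ e / m / 2 * 1 := by
            gcongr
            rw [div_le_one (by positivity)]
            nlinarith [mul_pos hm₁ hm₂, mul_le_mul hm (show 1 ≤ m₁ * m₂ by nlinarith) (by norm_num) hm0.le]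
        _ = _ := mul_one _
    linarith
  rintro x ⟨h1, h2⟩
  refine ⟨key 0 _ e₁ m₁ he₁ (by linarith) h1 (le_trans (by positivity) hf'.x0_lo) hf'.x0_hi,
    key 1 _ e₂ m₂ he₂ hm2 h2 (le_trans (by positivity) hf'.x1_lo) hf'.x1_hi⟩

end

section

variable {e₁ e₂ Q m₁ m₂ : ℝ} {u v t : RVec} {a b c a' b' c' : ℤ}

lemma exists_mul_of_isCoprime (h : IsCoprime b c) (h' : IsCoprime b' c') (hd : b * c' = c * b') :
    ∃ k : ℤ, (k = 1 ∨ k = -1) ∧ b' = k * b ∧ c' = k * c := by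
  obtain ⟨r, p, hrp⟩ := h
  obtain ⟨r', p', hrp'⟩ := h'
  have h1 : b' = (r * b' + p * c') * b := by linear_combination (-b') * hrp - p * hd
  have h2 : c' = (r * b' + p * c') * c := by linear_combination (-c') * hrp + r * hd
  refine ⟨r * b' + p * c', ?_, h1, h2⟩
  refine Int.isUnit_iff.1 (isUnit_of_dvd_one ⟨r' * b + p' * c, ?_⟩)
  linear_combination (-1 : ℤ) * hrp' + r' * h1 + p' * h2

/-- The vertical position of `a u + b v + c t` relative to `u`. -/
noncomputable def relPos (j : Fin 2) (u v t : RVec) (a b c : ℤ) : ℝ :=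
  (b * offs j u v + c * offs j u t) / (a * u.2 + b * v.2 + c * t.2)

lemma abs_sub_relPos_le (hQ : 0 < m₁ * m₂ * Q) (hu : u.2 ≠ 0)
    (h : Admissible e₁ e₂ Q m₁ m₂ u v t a b c) (j : Fin 2)
    {x E : ℝ} (hx : |(comb u v t a b c).2 * x - (comb u v t a b c).1 j| ≤ E) :
    |x - u.1 j / u.2 - relPos j u v t a b c| ≤ E / (m₁ * m₂ * Q) := by
  have hlo := h.q_lo
  rw [← comb_snd] at hlo
  have := abs_sub_offs_div_le (u := u) j hQ hlo hx
  rwa [offs_comb j hu, comb_snd] at this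

lemma abs_relPos_sub_le (hQ : 0 < m₁ * m₂ * Q) (hu : u.2 ≠ 0)
    (h : Admissible e₁ e₂ Q m₁ m₂ u v t a b c) (h' : Admissible e₁ e₂ Q m₁ m₂ u v t a' b' c')
    (j : Fin 2) {x x' E ρ : ℝ} (hx : |(comb u v t a b c).2 * x - (comb u v t a b c).1 j| ≤ E)
    (hx' : |(comb u v t a' b' c').2 * x' - (comb u v t a' b' c').1 j| ≤ E) (hxx : |x - x'| ≤ ρ) :
    |relPos j u v t a b c - relPos j u v t a' b' c'| ≤ ρ + 2 * (E / (m₁ * m₂ * Q)) := by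
  have h1 := abs_le.1 (abs_sub_relPos_le hQ hu h j hx)
  have h2 := abs_le.1 (abs_sub_relPos_le hQ hu h' j hx')
  have h3 := abs_le.1 hxx
  rw [abs_le]
  constructor <;> linarith

lemma Admissible.separated (hs : StepSize e₁ e₂ Q m₁ m₂) (hf : LatFlag e₁ e₂ Q u v t)
    (h : Admissible e₁ e₂ Q m₁ m₂ u v t a b c) (h' : Admissible e₁ e₂ Q m₁ m₂ u v t a' b' c')
    {x y : EuclideanSpace ℝ (Fin 2)}
    (hx : x ∈ rect (comb u v t a b c) (e₁ / m₁ / m₁) (e₂ / m₂ / m₂))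
    (hy : y ∈ rect (comb u v t a' b' c') (e₁ / m₁ / m₁) (e₂ / m₂ / m₂))
    (h0 : |x 0 - y 0| ≤ e₁ / (512 * m₁ * (m₁ * m₂ * Q)))
    (h1 : |x 1 - y 1| ≤ e₁ / (512 * m₁ * (m₁ * m₂ * Q))) : a = a' ∧ b = b' ∧ c = c' := by
  obtain ⟨he₂, hm₂, hm₁⟩ := hs.pos
  have hQ := hs.Q_pos
  have he₁ := hs.e₁_pos
  have hee := hs.e_le
  have hm2 := hs.m₂_ge
  have hle := hs.m_le
  have hθ := hs.mul_le
  have hu := hf.q_ne hQ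
  have hqp := hf.q_pos hQ
  have hMQ : 0 < m₁ * m₂ * Q := by positivity
  have d0 := abs_relPos_sub_le hMQ hu h h' 0 hx.1 hy.1 h0
  have d1 := abs_relPos_sub_le hMQ hu h h' 1 hx.2 hy.2 h1
  have q1 := h.q_lo
  have q2 := h.q_hi
  have q1' := h'.q_lo
  have q2' := h'.q_hi
  have X0 := h.x0_hi
  have X0l := h.x0_lo
  have X0l' := h'.x0_lo
  have X1 := h.x1_hi
  have X1l := h.x1_lo
  simp only [relPos] at d0 d1
  have hdet := det3_eq_offs u v t hu
  rw [hf.det] at hdet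
  have hq4 := hf.q_hi
  by_cases hd : b * c' = c * b'
  · obtain ⟨k, hk, rfl, rfl⟩ := exists_mul_of_isCoprime h.cop h'.cop hd
    have hk1 : k = 1 := by
      rcases hk with hk | hk
      · exact hk
      · exfalso
        rw [hk] at X0l'
        push_cast at X0l'
        have : 0 < e₁ * m₂ / 8 * (127 / 128) := by positivity
        nlinarith
    subst hk1
    refine ⟨?_, (one_mul _).symm, (one_mul _).symm⟩
    by_contra hne
    simp only [one_mul] at d1 q1' q2'
    set q' := (a : ℝ) * u.2 + b * v.2 + c * t.2 with hq'
    set q'' := (a' : ℝ) * u.2 + b * v.2 + c * t.2 with hq''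
    set X := (b : ℝ) * offs 1 u v + c * offs 1 u t with hX
    have hq'0 : 0 < q' := hMQ.trans_le q1
    have hq''0 : 0 < q'' := hMQ.trans_le q1'
    have hX0 : 0 < X := lt_of_lt_of_le (by positivity) X1l
    have e1 : X / q' - X / q'' = X * ((a' - a : ℤ) : ℝ) * u.2 / (q' * q'') := by
      push_cast; field_simp; rw [hq', hq'']; ring
    have habs : (1 : ℝ) ≤ |((a' - a : ℤ) : ℝ)| := by
      rw [← Int.cast_abs]
      exact_mod_cast Int.one_le_abs (sub_ne_zero.2 (Ne.symm hne))
    have lower : e₂ / (256 * m₂ * (m₁ * m₂ * Q)) ≤ |X / q' - X / q''| := by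
      rw [e1, abs_div, abs_mul, abs_mul, abs_of_pos hX0, abs_of_pos hqp,
        abs_of_pos (mul_pos hq'0 hq''0)]
      calc e₂ / (256 * m₂ * (m₁ * m₂ * Q))
          = (e₂ * m₁ / 16) * 1 * Q / ((4 * (m₁ * m₂ * Q)) * (4 * (m₁ * m₂ * Q))) := by
            field_simp; norm_num
        _ ≤ X * |((a' - a : ℤ) : ℝ)| * u.2 / (q' * q'') := by
            have := hf.q_lo
            gcongr
    have upper : e₁ / (512 * m₁ * (m₁ * m₂ * Q)) + 2 * (e₂ / m₂ / m₂ / (m₁ * m₂ * Q))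
        < e₂ / (256 * m₂ * (m₁ * m₂ * Q)) := by
      have t1 : e₁ / (512 * m₁ * (m₁ * m₂ * Q)) ≤ e₂ / (512 * m₂ * (m₁ * m₂ * Q)) := by gcongr
      have t2 : 2 * (e₂ / m₂ / m₂ / (m₁ * m₂ * Q)) ≤ 2 * (e₂ / 4096 / m₂ / (m₁ * m₂ * Q)) := by
        gcongr
      have t3 : e₂ / (256 * m₂ * (m₁ * m₂ * Q)) - e₂ / (512 * m₂ * (m₁ * m₂ * Q))
          - 2 * (e₂ / 4096 / m₂ / (m₁ * m₂ * Q)) = 3 / 2048 * (e₂ / (m₂ * (m₁ * m₂ * Q))) := by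
        field_simp; norm_num
      have t4 : 0 < 3 / 2048 * (e₂ / (m₂ * (m₁ * m₂ * Q))) := by positivity
      linarith
    linarith
  · exfalso
    set q' := (a : ℝ) * u.2 + b * v.2 + c * t.2 with hq'
    set q'' := (a' : ℝ) * u.2 + b' * v.2 + c' * t.2 with hq''
    set Y0 := (b : ℝ) * offs 0 u v + c * offs 0 u t with hY0
    set Y1 := (b : ℝ) * offs 1 u v + c * offs 1 u t with hY1
    set Z0 := (b' : ℝ) * offs 0 u v + c' * offs 0 u t with hZ0
    set Z1 := (b' : ℝ) * offs 1 u v + c' * offs 1 u t with hZ1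
    have hq'0 : 0 < q' := hMQ.trans_le q1
    have hq''0 : 0 < q'' := hMQ.trans_le q1'
    have hY0p : 0 < Y0 := lt_of_lt_of_le (by positivity) X0l
    have hY1p : 0 < Y1 := lt_of_lt_of_le (by positivity) X1l
    have id1 : u.2 * (Y0 * Z1 - Y1 * Z0) = ((b * c' - c * b' : ℤ) : ℝ) := by
      have : u.2 * (Y0 * Z1 - Y1 * Z0) = ((b * c' - c * b' : ℤ) : ℝ) *
          (u.2 * (offs 0 u v * offs 1 u t - offs 1 u v * offs 0 u t)) := by
        rw [hY0, hY1, hZ0, hZ1]; push_cast; ring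
      rw [this, ← hdet]; simp
    have habs : (1 : ℝ) ≤ |((b * c' - c * b' : ℤ) : ℝ)| := by
      rw [← Int.cast_abs]
      exact_mod_cast Int.one_le_abs (sub_ne_zero.2 hd)
    rw [← id1, abs_mul, abs_of_pos hqp] at habs
    have id2 : Y0 * Z1 - Y1 * Z0 = q'' * (Y1 * (Y0 / q' - Z0 / q'') - Y0 * (Y1 / q' - Z1 / q'')) := by
      field_simp; ring
    have hbd : |Y0 * Z1 - Y1 * Z0| ≤ 4 * (m₁ * m₂ * Q) * (e₂ * m₁ / 8 *
        (e₁ / (512 * m₁ * (m₁ * m₂ * Q)) + 2 * (e₁ / m₁ / m₁ / (m₁ * m₂ * Q)))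
        + e₁ * m₂ / 8 * (e₁ / (512 * m₁ * (m₁ * m₂ * Q)) + 2 * (e₂ / m₂ / m₂ / (m₁ * m₂ * Q)))) := by
      rw [id2, abs_mul, abs_of_pos hq''0]
      refine mul_le_mul q2' ?_ (abs_nonneg _) (by positivity)
      refine (abs_sub _ _).trans (add_le_add ?_ ?_)
      · rw [abs_mul, abs_of_pos hY1p]
        exact mul_le_mul X1 d0 (abs_nonneg _) (by positivity)
      · rw [abs_mul, abs_of_pos hY0p]
        exact mul_le_mul X0 d1 (abs_nonneg _) (by positivity)
    have hval : 4 * Q * (4 * (m₁ * m₂ * Q) * (e₂ * m₁ / 8 *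
        (e₁ / (512 * m₁ * (m₁ * m₂ * Q)) + 2 * (e₁ / m₁ / m₁ / (m₁ * m₂ * Q)))
        + e₁ * m₂ / 8 * (e₁ / (512 * m₁ * (m₁ * m₂ * Q)) + 2 * (e₂ / m₂ / m₂ / (m₁ * m₂ * Q)))))
        = e₁ * e₂ * Q * (1 / 256 + 4 / m₁ + 4 / m₂) + e₁ * e₁ * Q * (m₂ / m₁) / 256 := by
      field_simp; ring
    have hsmall : e₁ * e₂ * Q * (1 / 256 + 4 / m₁ + 4 / m₂) + e₁ * e₁ * Q * (m₂ / m₁) / 256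
        ≤ 1 * (1 / 256 + 4 / 4096 + 4 / 4096) + 1 * 1 / 256 := by
      have t1 : e₁ * e₁ * Q ≤ 1 := le_trans (by gcongr) hθ
      have t2 : m₂ / m₁ ≤ 1 := (div_le_one hm₁).2 hle
      have t3 : 4096 ≤ m₁ := hm2.trans hle
      gcongr
    have : (1 : ℝ) ≤ 4 * Q * |Y0 * Z1 - Y1 * Z0| := habs.trans (by gcongr)
    have h2 : 4 * Q * |Y0 * Z1 - Y1 * Z0| ≤ 4 * Q * _ := mul_le_mul_of_nonneg_left hbd (by positivity)
    rw [hval] at h2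
    linarith

end

lemma card_le_of_cells (F : Finset (ℤ × ℤ × ℤ)) (c₀ : ℤ) (b₀ : ℤ → ℤ) (L B D K : ℕ) (hD : 0 < D)
    (g : ℤ × ℤ × ℤ → ℝ)
    (hc : ∀ p ∈ F, c₀ ≤ p.2.2 ∧ p.2.2 < c₀ + L)
    (hb : ∀ p ∈ F, b₀ p.2.2 ≤ p.2.1 ∧ p.2.1 < b₀ p.2.2 + B)
    (hg : ∀ p ∈ F, 0 ≤ g p ∧ g p < K)
    (hinj : ∀ p ∈ F, ∀ p' ∈ F, p.2.2 = p'.2.2 → |p.2.1 - p'.2.1| < D → |g p - g p'| < 1 → p = p') :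
    F.card ≤ L * ((B / D + 1) * K) := by
  have hcard : (Finset.range L ×ˢ (Finset.range (B / D + 1) ×ˢ Finset.range K)).card
      = L * ((B / D + 1) * K) := by simp
  rw [← hcard]
  refine Finset.card_le_card_of_injOn
    (fun p => ((p.2.2 - c₀).toNat, ((p.2.1 - b₀ p.2.2).toNat / D, ⌊g p⌋₊))) ?_ ?_
  · intro p hp
    obtain ⟨h1, h2⟩ := hc p hp
    obtain ⟨h3, h4⟩ := hb p hp
    obtain ⟨h5, h6⟩ := hg p hp
    simp only [Finset.coe_product, Finset.coe_range, Set.mem_prod, Set.mem_Iio]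
    refine ⟨by omega, ?_, ?_⟩
    · exact Nat.lt_succ_of_le (Nat.div_le_div_right (by omega))
    · exact (Nat.floor_lt h5).2 h6
  · intro p hp p' hp' h
    simp only [Prod.mk.injEq] at h
    obtain ⟨e1, e2, e3⟩ := h
    obtain ⟨h1, h2⟩ := hc p hp
    obtain ⟨h3, h4⟩ := hb p hp
    obtain ⟨h5, h6⟩ := hg p hp
    obtain ⟨h1', h2'⟩ := hc p' hp'
    obtain ⟨h3', h4'⟩ := hb p' hp'
    obtain ⟨h5', h6'⟩ := hg p' hp'
    have ec : p.2.2 = p'.2.2 := by omega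
    refine hinj p hp p' hp' ec ?_ ?_
    · rw [ec] at e2 h3
      set i := (p.2.1 - b₀ p'.2.2).toNat with hi
      set i' := (p'.2.1 - b₀ p'.2.2).toNat with hi'
      have k1 := Nat.div_add_mod i D
      have k2 := Nat.div_add_mod i' D
      have k3 := Nat.mod_lt i hD
      have k4 := Nat.mod_lt i' hD
      rw [e2] at k1
      rw [abs_lt]
      constructor <;> omega
    · have k1 := Nat.floor_le h5
      have k2 := Nat.lt_floor_add_one (g p)
      have k3 := Nat.floor_le h5'
      have k4 := Nat.lt_floor_add_one (g p')
      rw [e3] at k1 k2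
      rw [abs_lt]
      constructor <;> linarith

/-- The slope of the functional cutting out the vectors at height `Y`. -/
noncomputable def heightSlope (u z : RVec) (Y : ℝ) : ℝ := (offs 1 u z - Y * z.2) / (u.2 * Y)

section

variable {e₁ e₂ Q m₁ m₂ : ℝ} {u v t : RVec} {a b c a' b' c' : ℤ}

lemma Admissible.relPos_bounds (hs : StepSize e₁ e₂ Q m₁ m₂)
    (h : Admissible e₁ e₂ Q m₁ m₂ u v t a b c) :
    0 < (a : ℝ) * u.2 + b * v.2 + c * t.2 ∧ e₂ / (64 * m₂ * Q) ≤ relPos 1 u v t a b c := by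
  obtain ⟨he₂, hm₂, hm₁⟩ := hs.pos
  have hQ := hs.Q_pos
  have hMQ : 0 < m₁ * m₂ * Q := by positivity
  have hq : 0 < (a : ℝ) * u.2 + b * v.2 + c * t.2 := hMQ.trans_le h.q_lo
  refine ⟨hq, ?_⟩
  calc e₂ / (64 * m₂ * Q) = (e₂ * m₁ / 16) / (4 * (m₁ * m₂ * Q)) := by field_simp; norm_num
    _ ≤ relPos 1 u v t a b c := by
      have hx := h.x1_lo
      have := h.q_hi
      have : 0 ≤ b * offs 1 u v + c * offs 1 u t := le_trans (by positivity) hx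
      unfold relPos
      gcongr

lemma slope_deviation (hs : StepSize e₁ e₂ Q m₁ m₂) (hf : LatFlag e₁ e₂ Q u v t)
    (h : Admissible e₁ e₂ Q m₁ m₂ u v t a b c) {Y : ℝ} (hY : e₂ / (64 * m₂ * Q) ≤ Y)
    (hd : |relPos 1 u v t a b c - Y| ≤ 3 * (e₂ / m₂ / m₂ / (m₁ * m₂ * Q))) :
    |b * heightSlope u v Y + c * heightSlope u t Y - a| ≤ 768 / m₂ := by
  obtain ⟨he₂, hm₂, hm₁⟩ := hs.pos
  have hQ := hs.Q_pos
  have hqp := hf.q_pos hQ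
  have hY0 : 0 < Y := lt_of_lt_of_le (by positivity) hY
  obtain ⟨hq', -⟩ := h.relPos_bounds hs
  have hqhi := h.q_hi
  have hqlo := hf.q_lo
  have e : b * heightSlope u v Y + c * heightSlope u t Y - a
      = (a * u.2 + b * v.2 + c * t.2) * (relPos 1 u v t a b c - Y) / (u.2 * Y) := by
    rw [mul_sub, relPos, mul_div_cancel₀ _ hq'.ne']
    unfold heightSlope
    field_simp
    ring
  rw [e, abs_div, abs_mul, abs_of_pos hq', abs_of_pos (mul_pos hqp hY0)]
  calc _ ≤ 4 * (m₁ * m₂ * Q) * (3 * (e₂ / m₂ / m₂ / (m₁ * m₂ * Q))) / (Q * (e₂ / (64 * m₂ * Q))) := by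
        gcongr
    _ = _ := by field_simp; norm_num

lemma abs_slope_le (hs : StepSize e₁ e₂ Q m₁ m₂) (hf : LatFlag e₁ e₂ Q u v t)
    {Y : ℝ} (hY : e₂ / (64 * m₂ * Q) ≤ Y) : |heightSlope u v Y| ≤ 33 * m₂ := by
  obtain ⟨he₂, hm₂, hm₁⟩ := hs.pos
  have hQ := hs.Q_pos
  have hm2 := hs.m₂_ge
  have hqp := hf.q_pos hQ
  have hY0 : 0 < Y := lt_of_lt_of_le (by positivity) hY
  have hqlo := hf.q_lo
  have e : heightSlope u v Y = offs 1 u v / (u.2 * Y) - v.2 / u.2 := by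
    unfold heightSlope; field_simp
  have h1 : |(v.2 : ℝ) / u.2| ≤ 1 := by
    rw [abs_div, abs_of_pos hqp, div_le_one hqp]
    exact_mod_cast hf.v_le
  have hx : 0 ≤ offs 1 u v := le_trans (by positivity) hf.x1_lo
  have h2 : |offs 1 u v / (u.2 * Y)| ≤ 32 * m₂ := by
    rw [abs_of_nonneg (by positivity)]
    calc _ ≤ (e₂ / 2) / (Q * (e₂ / (64 * m₂ * Q))) := by
          have := hf.x1_hi
          gcongr
      _ = _ := by field_simp; norm_num
  rw [e]
  refine (abs_sub _ _).trans ?_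
  linarith

/-- The slope at the height of a vector is close to a rational with small denominator. -/
def NearRat (m₂ Λ f : ℝ) : Prop :=
  ∃ (d : ℕ) (m : ℤ), 1 ≤ d ∧ d * Λ ≤ m₂ ∧ |d * f - m| < 1 / (m₂ * Λ)

lemma NearRat.exists_coprime {Λ f : ℝ} (hm₂ : 1 ≤ m₂) (hΛ : 1 ≤ Λ) (hf : |f| ≤ 33 * m₂)
    (h : NearRat m₂ Λ f) : ∃ (d : ℕ) (m : ℤ), 1 ≤ d ∧ d * Λ ≤ m₂ ∧ |d * f - m| < 1 / (m₂ * Λ) ∧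
      IsCoprime (d : ℤ) m ∧ |(m : ℝ)| ≤ 34 * d * m₂ := by
  obtain ⟨d, m, hd, hdm, hlt⟩ := h
  obtain ⟨g, hg⟩ : ∃ g : ℕ, g = Int.gcd d m := ⟨_, rfl⟩
  have hg0 : 0 < g := by
    rw [hg]; exact Int.gcd_pos_of_ne_zero_left _ (by omega)
  obtain ⟨m', hm'⟩ : (g : ℤ) ∣ m := by rw [hg]; exact Int.gcd_dvd_right _ _
  obtain ⟨d', hd'⟩ : g ∣ d := by
    have : (g : ℤ) ∣ d := by rw [hg]; exact Int.gcd_dvd_left _ _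
    exact_mod_cast this
  have hcop : IsCoprime (d' : ℤ) m' := by
    rw [Int.isCoprime_iff_gcd_eq_one]
    have : Int.gcd ((g : ℤ) * d') (g * m') = g * Int.gcd d' m' := by
      rw [Int.gcd_mul_left]; simp
    rw [← hm', show (g : ℤ) * d' = d by rw [hd']; push_cast; ring, ← hg] at this
    exact Nat.eq_of_mul_eq_mul_left hg0 (by omega)
  have hg1 : (1 : ℝ) ≤ g := by exact_mod_cast hg0
  have hd'1 : 1 ≤ d' := by
    rcases Nat.eq_zero_or_pos d' with h0 | h0
    · subst h0; omega
    · exact h0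
  have hlt' : |d' * f - m'| < 1 / (m₂ * Λ) := by
    refine lt_of_le_of_lt ?_ hlt
    have : (d : ℝ) * f - m = g * (d' * f - m') := by
      rw [hd', hm']; push_cast; ring
    rw [this, abs_mul, abs_of_pos (by linarith : (0 : ℝ) < g)]
    nlinarith [abs_nonneg (d' * f - m')]
  have hd'r : (1 : ℝ) ≤ d' := by exact_mod_cast hd'1
  refine ⟨d', m', hd'1, ?_, hlt', hcop, ?_⟩
  · refine le_trans ?_ hdm
    have : (d' : ℝ) ≤ d := by
      rw [hd']; push_cast; nlinarith
    gcongr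
  · have h1 : (1 : ℝ) / (m₂ * Λ) ≤ 1 := by
      rw [div_le_one (by positivity)]; nlinarith
    have h2 := abs_lt.1 hlt'
    have h3 := abs_le.1 hf
    rw [abs_le]
    constructor <;> nlinarith

lemma abs_lt_of_near (hs : StepSize e₁ e₂ Q m₁ m₂) (hf : LatFlag e₁ e₂ Q u v t)
    (h : Admissible e₁ e₂ Q m₁ m₂ u v t a b c) {Λ : ℝ} (hΛ : 1 ≤ Λ) {d : ℕ} {m : ℤ}
    (hd : |d * heightSlope u v (relPos 1 u v t a b c) - m| < 1 / (m₂ * Λ)) :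
    |((d * a - m * b : ℤ) : ℝ) + c * ((d * (offs 1 u v * t.2 - offs 1 u t * v.2)
      - m * u.2 * offs 1 u t) / (offs 1 u v * u.2))| < 8 * m₁ / (m₂ * Λ) := by
  obtain ⟨he₂, hm₂, hm₁⟩ := hs.pos
  have hQ := hs.Q_pos
  have hqp := hf.q_pos hQ
  obtain ⟨hq', hY⟩ := h.relPos_bounds hs
  have hβ : 0 < offs 1 u v := lt_of_lt_of_le (by positivity) hf.x1_lo
  have hX : 0 < b * offs 1 u v + c * offs 1 u t :=
    lt_of_lt_of_le (by have := hs.m₂_ge; positivity) h.x1_lo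
  have e : ((d * a - m * b : ℤ) : ℝ) + c * ((d * (offs 1 u v * t.2 - offs 1 u t * v.2)
      - m * u.2 * offs 1 u t) / (offs 1 u v * u.2))
      = (d * heightSlope u v (relPos 1 u v t a b c) - m) *
        ((b * offs 1 u v + c * offs 1 u t) / offs 1 u v) := by
    unfold heightSlope relPos
    push_cast
    field_simp
    ring
  rw [e, abs_mul, abs_of_pos (div_pos hX hβ)]
  calc _ < 1 / (m₂ * Λ) * ((b * offs 1 u v + c * offs 1 u t) / offs 1 u v) := by
        have := div_pos hX hβ
        gcongr
    _ ≤ 1 / (m₂ * Λ) * ((e₂ * m₁ / 8) / (e₂ / 64)) := by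
        have := h.x1_hi
        have := hf.x1_lo
        gcongr
    _ = _ := by field_simp; norm_num

end

lemma ceil_window {y : ℝ} {n : ℤ} {B : ℕ} (h1 : ⌈y⌉ ≤ n) (h2 : n < ⌈y⌉ + B) :
    y ≤ n ∧ n ≤ y + B := by
  have h3 := Int.ceil_lt_add_one y
  have h4 := Int.le_ceil y
  have h5 : ((⌈y⌉ : ℤ) : ℝ) ≤ n := by exact_mod_cast h1
  have h6 : (n : ℝ) + 1 ≤ ⌈y⌉ + B := by exact_mod_cast h2
  constructor <;> linarith

lemma height_eq {q α β σ τ b c : ℝ} (hq : q ≠ 0) (hα : α ≠ 0) (h : 1 = q * (α * τ - β * σ)) :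
    b * β + c * τ = β / α * (b * α + c * σ) + c / (q * α) := by
  field_simp
  linear_combination (-c) * h

section

variable {e₁ e₂ Q m₁ m₂ : ℝ} {u v t : RVec}

set_option maxHeartbeats 1000000 in
lemma exists_windows (hs : StepSize e₁ e₂ Q m₁ m₂) (hf : LatFlag e₁ e₂ Q u v t) {L B A : ℕ}
    (hL : L ≤ e₁ * e₂ * Q * m₁ / 2048) (hB : B ≤ m₂ / 512) (hA : A ≤ m₁ * m₂ / 2) :
    ∃ (c₀ : ℤ) (b₀ : ℤ → ℤ) (a₀ : ℤ → ℤ → ℤ),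
      (∀ c, c₀ ≤ c → c < c₀ + L → |(c : ℝ)| ≤ 8 * m₁) ∧
      ∀ c, c₀ ≤ c → c < c₀ + L → ∀ b, b₀ c ≤ b → b < b₀ c + B →
        ∀ a, a₀ c b ≤ a → a < a₀ c b + A → IsCoprime b c →
          Admissible e₁ e₂ Q m₁ m₂ u v t a b c := by
  obtain ⟨he₂, hm₂, hm₁⟩ := hs.pos
  have hQ := hs.Q_pos
  have he₁ := hs.e₁_pos
  have hle := hs.m_le
  have hθ := hs.mul_le
  have hqp := hf.q_pos hQ
  have hu := hf.q_ne hQ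
  have hqlo := hf.q_lo
  have hqhi := hf.q_hi
  have hα : 0 < offs 0 u v := lt_of_lt_of_le (by positivity) hf.x0_lo
  have hβ : 0 < offs 1 u v := lt_of_lt_of_le (by positivity) hf.x1_lo
  have hdet := det3_eq_offs u v t hu
  rw [hf.det] at hdet
  have hαlo := hf.x0_lo
  have hαhi := hf.x0_hi
  have hβhi := hf.x1_hi
  obtain ⟨α, hαe⟩ : ∃ α, α = offs 0 u v := ⟨_, rfl⟩
  obtain ⟨β, hβe⟩ : ∃ β, β = offs 1 u v := ⟨_, rfl⟩
  obtain ⟨σ, hσe⟩ : ∃ σ, σ = offs 0 u t := ⟨_, rfl⟩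
  obtain ⟨τ, hτe⟩ : ∃ τ, τ = offs 1 u t := ⟨_, rfl⟩
  rw [← hαe] at hα hαlo hαhi
  rw [← hβe] at hβ hβhi
  rw [← hαe, ← hβe, ← hσe, ← hτe] at hdet
  push_cast at hdet
  obtain ⟨ρ, hρ⟩ : ∃ ρ, ρ = β / α := ⟨_, rfl⟩
  have hρ0 : 0 < ρ := by rw [hρ]; positivity
  have hρK : ρ * (e₁ * m₂ / 8) ≤ 4 * e₂ * m₂ := by
    rw [hρ]
    calc _ ≤ (e₂ / 2) / (e₁ / 64) * (e₁ * m₂ / 8) := by gcongr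
      _ = _ := by field_simp; norm_num
  have hK : 4 * e₂ * m₂ ≤ 4 * e₂ * m₁ := by gcongr
  have hqα : (u.2 : ℝ) * α ≤ 2 * (e₁ * Q) := by nlinarith
  have hqα0 : 0 < (u.2 : ℝ) * α := by positivity
  have hqαlo : e₁ * Q / 64 ≤ (u.2 : ℝ) * α := by
    calc e₁ * Q / 64 = Q * (e₁ / 64) := by ring
      _ ≤ _ := by gcongr
  have hLα : L ≤ u.2 * α * (e₂ * m₁ / 32) := by
    calc (L : ℝ) ≤ e₁ * e₂ * Q * m₁ / 2048 := hL
      _ = e₁ * Q / 64 * (e₂ * m₁ / 32) := by ring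
      _ ≤ _ := by gcongr
  obtain ⟨y, hy⟩ : ∃ y, y = u.2 * α * (e₂ * m₁ / 16 - ρ * (e₁ * m₂ / 8 * (127 / 128))) := ⟨_, rfl⟩
  refine ⟨⌈y⌉, fun c => ⌈(e₁ * m₂ / 8 * (127 / 128) - c * σ) / α⌉,
    fun c b => ⌈(m₁ * m₂ * Q - b * v.2 - c * t.2) / u.2⌉, ?_, ?_⟩
  · intro c h1 h2
    obtain ⟨h3, h4⟩ := ceil_window h1 h2
    have k1 : (u.2 * α) * (4 * e₂ * m₁) ≤ 8 * m₁ := by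
      calc _ ≤ 2 * (e₁ * Q) * (4 * e₂ * m₁) := by gcongr
        _ = 8 * m₁ * (e₁ * e₂ * Q) := by ring
        _ ≤ 8 * m₁ * 1 := by gcongr
        _ = _ := by ring
    have k2 : u.2 * α * -(4 * e₂ * m₁) ≤ y := by
      rw [hy]
      gcongr
      nlinarith [mul_pos he₂ hm₁, mul_pos hρ0 (mul_pos he₁ hm₂)]
    have k3 : y ≤ u.2 * α * (e₂ * m₁ / 16) := by
      rw [hy]
      gcongr
      nlinarith [mul_pos hρ0 (mul_pos he₁ hm₂)]
    have k4 := mul_pos hqα0 (mul_pos he₂ hm₁)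
    rw [abs_le]
    constructor <;> nlinarith
  · intro c hc1 hc2 b hb1 hb2 a ha1 ha2 hcop
    obtain ⟨c1, c2⟩ := ceil_window hc1 hc2
    obtain ⟨b1, b2⟩ := ceil_window hb1 hb2
    obtain ⟨a1, a2⟩ := ceil_window ha1 ha2
    rw [div_le_iff₀ hα] at b1
    rw [div_add' _ _ _ hα.ne', le_div_iff₀ hα] at b2
    rw [div_le_iff₀ hqp] at a1
    rw [div_add' _ _ _ hqp.ne', le_div_iff₀ hqp] at a2
    have hBα : B * α ≤ e₁ * m₂ / 8 * (1 / 128) := by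
      calc B * α ≤ m₂ / 512 * (e₁ / 2) := by gcongr
        _ = _ := by ring
    have hAq : A * (u.2 : ℝ) ≤ 2 * (m₁ * m₂ * Q) := by
      calc A * (u.2 : ℝ) ≤ m₁ * m₂ / 2 * (4 * Q) := by gcongr
        _ = _ := by ring
    have hMQ : 0 < m₁ * m₂ * Q := by positivity
    have x0l : e₁ * m₂ / 8 * (127 / 128) ≤ b * α + c * σ := by linarith
    have x0h : b * α + c * σ ≤ e₁ * m₂ / 8 := by linarith
    have x1 : b * β + c * τ = ρ * (b * α + c * σ) + c / (u.2 * α) := by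
      rw [hρ]; exact height_eq hqp.ne' hα.ne' hdet
    have cl : e₂ * m₁ / 16 - ρ * (e₁ * m₂ / 8 * (127 / 128)) ≤ c / (u.2 * α) := by
      rw [le_div_iff₀ hqα0]; rw [hy] at c1; linarith
    have ch : c / (u.2 * α) ≤ e₂ * m₁ / 16 - ρ * (e₁ * m₂ / 8 * (127 / 128)) + e₂ * m₁ / 32 := by
      rw [div_le_iff₀ hqα0]; rw [hy] at c2; linarith
    have r1 := mul_le_mul_of_nonneg_left x0l hρ0.le
    have r2 := mul_le_mul_of_nonneg_left x0h hρ0.le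
    refine ⟨hcop, ?_, ?_, ?_, ?_, ?_, ?_⟩
    · linarith
    · linarith
    · rw [← hαe, ← hσe]; exact x0l
    · rw [← hαe, ← hσe]; exact x0h
    · rw [← hβe, ← hτe, x1]; linarith
    · rw [← hβe, ← hτe, x1]; linarith

end

section

variable {e₁ e₂ Q m₁ m₂ : ℝ} {u v t : RVec}

lemma card_window_image (c₀ : ℤ) (b₀ : ℤ → ℤ) (a₀ : ℤ → ℤ → ℤ) (P : Finset (ℕ × ℕ)) (A : ℕ) :
    ((P ×ˢ Finset.range A).image fun p : (ℕ × ℕ) × ℕ =>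
      ((a₀ (c₀ + p.1.1) (b₀ (c₀ + p.1.1) + p.1.2) + p.2, b₀ (c₀ + p.1.1) + p.1.2,
        c₀ + p.1.1) : ℤ × ℤ × ℤ)).card = P.card * A := by
  rw [Finset.card_image_of_injective, Finset.card_product, Finset.card_range]
  rintro ⟨⟨l, i⟩, m⟩ ⟨⟨l', i'⟩, m'⟩ h
  simp only [Prod.mk.injEq] at h
  obtain ⟨h1, h2, h3⟩ := h
  have e1 : l = l' := by omega
  subst e1
  have e2 : i = i' := by omega
  subst e2
  have e3 : m = m' := by omega
  subst e3
  rfl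

lemma eq_of_det_eq {d : ℕ} {m a b a' b' : ℤ} (hd : 1 ≤ d) (hcop : IsCoprime (d : ℤ) m)
    (hb : |b - b'| < d) (h : |((d * a - m * b : ℤ) : ℝ) - ((d * a' - m * b' : ℤ) : ℝ)| < 1) :
    a = a' ∧ b = b' := by
  have h1 : (d : ℤ) * a - m * b = d * a' - m * b' := by
    have h' : |(d * a - m * b) - (d * a' - m * b' : ℤ)| < 1 := by exact_mod_cast h
    have := Int.abs_lt_one_iff.1 h'
    linarith
  have h2 : (d : ℤ) ∣ m * (b - b') := ⟨a - a', by linarith⟩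
  have h3 : b - b' = 0 := Int.eq_zero_of_abs_lt_dvd (hcop.dvd_of_dvd_mul_left h2) hb
  have h4 : b = b' := by omega
  refine ⟨?_, h4⟩
  subst h4
  have : (d : ℤ) * a = d * a' := by linarith
  exact mul_left_cancel₀ (by positivity) this

lemma card_nearRat_le (hs : StepSize e₁ e₂ Q m₁ m₂) (hf : LatFlag e₁ e₂ Q u v t)
    {Λ : ℝ} (hΛ : 1 ≤ Λ) {L B : ℕ} (hB : B ≤ m₂ / 512) (c₀ : ℤ) (b₀ : ℤ → ℤ)
    (F : Finset (ℤ × ℤ × ℤ))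
    (hc : ∀ p ∈ F, c₀ ≤ p.2.2 ∧ p.2.2 < c₀ + L)
    (hb : ∀ p ∈ F, b₀ p.2.2 ≤ p.2.1 ∧ p.2.1 < b₀ p.2.2 + B)
    (hF : ∀ p ∈ F, Admissible e₁ e₂ Q m₁ m₂ u v t p.1 p.2.1 p.2.2)
    (hN : ∀ p ∈ F, NearRat m₂ Λ (heightSlope u v (relPos 1 u v t p.1 p.2.1 p.2.2))) :
    (F.card : ℝ) ≤ 2346 * (m₁ * m₂ * m₂ * L) / Λ := by
  classical
  obtain ⟨he₂, hm₂, hm₁⟩ := hs.pos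
  have hm2 := hs.m₂_ge
  have hle := hs.m_le
  have hΛ0 : 0 < Λ := by linarith
  set W : ℝ := 8 * m₁ / (m₂ * Λ) with hW
  have hW0 : 0 < W := by positivity
  set h : ℕ → ℤ → ℝ := fun d m => (d * (offs 1 u v * t.2 - offs 1 u t * v.2)
      - m * u.2 * offs 1 u t) / (offs 1 u v * u.2) with hh
  set P : ℕ → ℤ → ℤ × ℤ × ℤ → Prop := fun d m p => IsCoprime (d : ℤ) m ∧
    |((d * p.1 - m * p.2.1 : ℤ) : ℝ) + p.2.2 * h d m| < W with hP
  set K : ℕ → ℕ := fun d => ⌊34 * d * m₂⌋₊ with hK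
  set D := ⌊m₂ / Λ⌋₊ with hD
  have hsub : F ⊆ (Finset.Icc 1 D).biUnion fun d =>
      (Finset.Icc (-(K d : ℤ)) (K d)).biUnion fun m => F.filter (P d m) := by
    intro p hp
    have hadm := hF p hp
    obtain ⟨-, hY⟩ := hadm.relPos_bounds hs
    obtain ⟨d, m, h1, h2, h3, h4, h5⟩ :=
      (hN p hp).exists_coprime (by linarith) hΛ (abs_slope_le hs hf hY)
    simp only [Finset.mem_biUnion, Finset.mem_Icc, Finset.mem_filter]
    refine ⟨d, ⟨h1, Nat.le_floor ((le_div_iff₀ hΛ0).2 h2)⟩, m, ?_, hp, h4,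
      abs_lt_of_near hs hf hadm hΛ h3⟩
    have h6 : m.natAbs ≤ K d := by
      refine Nat.le_floor ?_
      rw [Nat.cast_natAbs, Int.cast_abs]; exact h5
    omega
  have hcell : ∀ d m, 1 ≤ d → (F.filter (P d m)).card ≤ L * ((B / d + 1) * ⌈2 * W⌉₊) := by
    intro d m hd
    refine card_le_of_cells _ c₀ b₀ L B d ⌈2 * W⌉₊ hd
      (fun p => ((d * p.1 - m * p.2.1 : ℤ) : ℝ) + p.2.2 * h d m + W)
      (fun p hp => hc p (Finset.mem_filter.1 hp).1) (fun p hp => hb p (Finset.mem_filter.1 hp).1)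
      ?_ ?_
    · intro p hp
      have h1 := abs_lt.1 (Finset.mem_filter.1 hp).2.2
      have h2 := Nat.le_ceil (2 * W)
      constructor <;> linarith
    · rintro ⟨a, b, c⟩ hp ⟨a', b', c'⟩ hp' hcc hbb hg
      simp only at hcc hbb hg
      subst hcc
      have hcop := (Finset.mem_filter.1 hp).2.1
      have := eq_of_det_eq (a := a) (a' := a') hd hcop hbb (by
        refine lt_of_eq_of_lt ?_ hg
        congr 1; ring)
      rw [this.1, this.2]
  have hcellR : ∀ d m, 1 ≤ d → ((F.filter (P d m)).card : ℝ)
      ≤ L * ((B / d + 1) * (17 * m₁ / m₂)) := by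
    intro d m hd
    have h1 : ((F.filter (P d m)).card : ℝ) ≤ (L * ((B / d + 1) * ⌈2 * W⌉₊) : ℕ) := by
      exact_mod_cast hcell d m hd
    refine h1.trans ?_
    push_cast
    have h2 : ((B / d : ℕ) : ℝ) ≤ B / d := Nat.cast_div_le
    have h3 : (⌈2 * W⌉₊ : ℝ) ≤ 17 * m₁ / m₂ := by
      refine (Nat.ceil_lt_add_one (by positivity)).le.trans ?_
      have h4 : W ≤ 8 * m₁ / (m₂ * 1) := by rw [hW]; gcongr
      have h5 : 1 ≤ m₁ / m₂ := (one_le_div hm₂).2 hle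
      have h6 : 17 * m₁ / m₂ = 2 * (8 * m₁ / (m₂ * 1)) + m₁ / m₂ := by field_simp; norm_num
      linarith
    gcongr
  have hD0 : (D : ℝ) ≤ m₂ / Λ := Nat.floor_le (by positivity)
  have hDm : m₂ / Λ ≤ m₂ := div_le_self hm₂.le hΛ
  have hrow : ∀ d ∈ Finset.Icc 1 D,
      ((((Finset.Icc (-(K d : ℤ)) (K d)).biUnion fun m => F.filter (P d m)).card : ℕ) : ℝ)
      ≤ 2346 * (m₁ * m₂ * L) := by
    intro d hd
    obtain ⟨hd1, hdD⟩ := Finset.mem_Icc.1 hd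
    have hd1' : (1 : ℝ) ≤ d := by exact_mod_cast hd1
    have hdD' : (d : ℝ) ≤ D := by exact_mod_cast hdD
    calc ((((Finset.Icc (-(K d : ℤ)) (K d)).biUnion fun m => F.filter (P d m)).card : ℕ) : ℝ)
        ≤ ∑ m ∈ Finset.Icc (-(K d : ℤ)) (K d), ((F.filter (P d m)).card : ℝ) := by
          exact_mod_cast Finset.card_biUnion_le
      _ ≤ ∑ m ∈ Finset.Icc (-(K d : ℤ)) (K d), L * ((B / d + 1) * (17 * m₁ / m₂)) :=
          Finset.sum_le_sum fun m _ => hcellR d m hd1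
      _ = (2 * K d + 1) * (L * ((B / d + 1) * (17 * m₁ / m₂))) := by
          rw [Finset.sum_const, Int.card_Icc, nsmul_eq_mul]
          congr 1
          have : ((K d : ℤ) + 1 - -(K d : ℤ)).toNat = 2 * K d + 1 := by omega
          rw [this]; push_cast; ring
      _ ≤ (69 * d * m₂) * (L * ((B / d + 1) * (17 * m₁ / m₂))) := by
          have : (K d : ℝ) ≤ 34 * d * m₂ := Nat.floor_le (by positivity)
          gcongr
          nlinarith
      _ = 69 * (L * ((B + d) * (17 * m₁))) := by field_simp
      _ ≤ 69 * (L * ((m₂ + m₂) * (17 * m₁))) := by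
          gcongr
          · linarith
          · linarith
      _ = _ := by ring
  calc (F.card : ℝ) ≤ (((Finset.Icc 1 D).biUnion fun d =>
      (Finset.Icc (-(K d : ℤ)) (K d)).biUnion fun m => F.filter (P d m)).card : ℝ) := by
        exact_mod_cast Finset.card_le_card hsub
    _ ≤ ∑ d ∈ Finset.Icc 1 D,
        (((Finset.Icc (-(K d : ℤ)) (K d)).biUnion fun m => F.filter (P d m)).card : ℝ) := by
        exact_mod_cast Finset.card_biUnion_le
    _ ≤ ∑ d ∈ Finset.Icc 1 D, 2346 * (m₁ * m₂ * L) := Finset.sum_le_sum hrow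
    _ = D * (2346 * (m₁ * m₂ * L)) := by simp
    _ ≤ m₂ / Λ * (2346 * (m₁ * m₂ * L)) := by gcongr
    _ = _ := by ring

lemma card_strip_le (hs : StepSize e₁ e₂ Q m₁ m₂) (hf : LatFlag e₁ e₂ Q u v t)
    {Λ : ℝ} (hΛ : 1 ≤ Λ) (hΛm : 2 * Λ ≤ m₂) {L B : ℕ} (hB : B ≤ m₂ / 512) (c₀ : ℤ) (b₀ : ℤ → ℤ)
    (F : Finset (ℤ × ℤ × ℤ))
    (hc : ∀ p ∈ F, c₀ ≤ p.2.2 ∧ p.2.2 < c₀ + L)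
    (hb : ∀ p ∈ F, b₀ p.2.2 ≤ p.2.1 ∧ p.2.1 < b₀ p.2.2 + B)
    (hF : ∀ p ∈ F, Admissible e₁ e₂ Q m₁ m₂ u v t p.1 p.2.1 p.2.2)
    {Y : ℝ} (hY : e₂ / (64 * m₂ * Q) ≤ Y) (hN : ¬ NearRat m₂ Λ (heightSlope u v Y))
    (hd : ∀ p ∈ F, |relPos 1 u v t p.1 p.2.1 p.2.2 - Y| ≤ 3 * (e₂ / m₂ / m₂ / (m₁ * m₂ * Q))) :
    (F.card : ℝ) ≤ 3100 * Λ ^ 2 * L := by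
  obtain ⟨he₂, hm₂, hm₁⟩ := hs.pos
  have hm2 := hs.m₂_ge
  have hΛ0 : 0 < Λ := by linarith
  set D := ⌊m₂ / Λ⌋₊ with hD
  have hDlo : m₂ / (2 * Λ) ≤ D := by
    have h1 : m₂ / Λ < D + 1 := Nat.lt_floor_add_one _
    have h2 : 1 ≤ m₂ / (2 * Λ) := (one_le_div (by positivity)).2 hΛm
    have h3 : m₂ / Λ = 2 * (m₂ / (2 * Λ)) := by field_simp
    linarith
  have hDhi : (D : ℝ) * Λ ≤ m₂ := by
    have : (D : ℝ) ≤ m₂ / Λ := Nat.floor_le (by positivity)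
    rwa [le_div_iff₀ hΛ0] at this
  have hD1 : (1 : ℝ) ≤ D := le_trans ((one_le_div (by positivity)).2 hΛm) hDlo
  have hD0 : 0 < D := by
    have : (0 : ℝ) < D := by linarith
    exact_mod_cast this
  set f := heightSlope u v Y with hfdef
  set g := heightSlope u t Y with hg
  have hmΛ : 0 < m₂ * Λ := by positivity
  have hcells := card_le_of_cells F c₀ b₀ L B D (⌊1536 * Λ⌋₊ + 1) hD0
    (fun p => (p.2.1 * f + p.2.2 * g - p.1 + 768 / m₂) * (m₂ * Λ)) hc hb ?_ ?_
  · have h1 : (F.card : ℝ) ≤ (L * ((B / D + 1) * (⌊1536 * Λ⌋₊ + 1)) : ℕ) := by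
      exact_mod_cast hcells
    refine h1.trans ?_
    push_cast
    have h2 : ((B / D : ℕ) : ℝ) ≤ Λ / 256 := by
      refine Nat.cast_div_le.trans ?_
      calc (B : ℝ) / D ≤ (m₂ / 512) / (m₂ / (2 * Λ)) := by gcongr
        _ = _ := by field_simp; norm_num
    have h3 : (⌊1536 * Λ⌋₊ : ℝ) ≤ 1536 * Λ := Nat.floor_le (by positivity)
    calc (L : ℝ) * (((B / D : ℕ) + 1) * (⌊1536 * Λ⌋₊ + 1))
        ≤ L * ((Λ / 256 + Λ) * (1536 * Λ + Λ)) := by gcongr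
      _ ≤ 3100 * Λ ^ 2 * L := by nlinarith [mul_nonneg (sq_nonneg Λ) (Nat.cast_nonneg (α := ℝ) L)]
  · intro p hp
    have h1 := abs_le.1 (slope_deviation hs hf (hF p hp) hY (hd p hp))
    have h2 : 1536 * Λ < (⌊1536 * Λ⌋₊ + 1 : ℕ) := by
      push_cast; exact Nat.lt_floor_add_one _
    refine ⟨mul_nonneg (by linarith) hmΛ.le, lt_of_le_of_lt ?_ h2⟩
    calc _ ≤ (768 / m₂ + 768 / m₂) * (m₂ * Λ) := by gcongr; linarith
      _ = _ := by field_simp; norm_num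
  · rintro ⟨a, b, c⟩ hp ⟨a', b', c'⟩ hp' hcc hbb hgg
    simp only at hcc hbb hgg
    subst hcc
    have key : |((b - b' : ℤ) : ℝ) * f - (a - a' : ℤ)| < 1 / (m₂ * Λ) := by
      rw [lt_div_iff₀ hmΛ, ← abs_of_pos hmΛ, ← abs_mul]
      refine lt_of_eq_of_lt ?_ hgg
      congr 1; push_cast; ring
    have hbe : b = b' := by
      by_contra hne
      refine hN ⟨(b - b').natAbs, (b - b').sign * (a - a'), by omega, ?_, ?_⟩
      · refine le_trans ?_ hDhi
        gcongr
        have : ((b - b').natAbs : ℤ) ≤ D := by rw [Int.natCast_natAbs]; exact hbb.le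
        exact_mod_cast this
      · have hsg : (((b - b').natAbs : ℕ) : ℝ) = ((b - b').sign : ℝ) * ((b - b' : ℤ) : ℝ) := by
          rw [Nat.cast_natAbs]
          exact_mod_cast (Int.sign_mul_self_eq_abs _).symm
        have hs1 : |((b - b').sign : ℝ)| = 1 := by
          have : (b - b').sign.natAbs = 1 := by
            rw [Int.natAbs_sign_of_ne_zero (by omega)]
          rw [← Int.cast_abs, Int.abs_eq_natAbs, this]; simp
        have e : (((b - b').natAbs : ℕ) : ℝ) * f - (((b - b').sign * (a - a') : ℤ) : ℝ)
            = ((b - b').sign : ℝ) * (((b - b' : ℤ) : ℝ) * f - (a - a' : ℤ)) := by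
          rw [hsg]; push_cast; ring
        rw [e, abs_mul, hs1, one_mul]
        exact key
    subst hbe
    have h1 : |((a - a' : ℤ) : ℝ)| < 1 := by
      have h2 : (1 : ℝ) / (m₂ * Λ) ≤ 1 := by
        rw [div_le_one hmΛ]; nlinarith
      refine lt_of_lt_of_le ?_ h2
      refine lt_of_eq_of_lt ?_ key
      rw [← abs_neg]; congr 1; push_cast; ring
    have h3 : |a - a'| < 1 := by exact_mod_cast h1
    have h4 := Int.abs_lt_one_iff.1 h3
    have h5 : a = a' := by omega
    rw [h5]

end

section

variable {e₁ e₂ Q m₁ m₂ : ℝ} {u v t : RVec}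

lemma half_le_floor {x : ℝ} (hx : 1 ≤ x) : x / 2 ≤ (⌊x⌋₊ : ℝ) := by
  have h1 : x < ⌊x⌋₊ + 1 := Nat.lt_floor_add_one x
  have h2 : (1 : ℝ) ≤ ⌊x⌋₊ := by exact_mod_cast Nat.le_floor (by simpa using hx)
  linarith

lemma exists_children (hs : StepSize e₁ e₂ Q m₁ m₂) (hf : LatFlag e₁ e₂ Q u v t)
    (hbig : 24 * (1 + Real.log (9 * m₁)) ≤ e₁ * e₂ * Q * m₂ / 2 ^ 25) :
    ∃ F : Finset (ℤ × ℤ × ℤ), (∀ p ∈ F, Admissible e₁ e₂ Q m₁ m₂ u v t p.1 p.2.1 p.2.2) ∧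
      e₁ * e₂ * Q * (m₁ * m₂) ^ 2 / 2 ^ 28 ≤ F.card ∧
      ∀ p₀ ∈ F, ∀ G ⊆ F, (∀ p ∈ G, |relPos 1 u v t p.1 p.2.1 p.2.2
          - relPos 1 u v t p₀.1 p₀.2.1 p₀.2.2| ≤ 3 * (e₂ / m₂ / m₂ / (m₁ * m₂ * Q))) →
        (G.card : ℝ) ≤ 2 ^ 57 * m₁ := by
  classical
  obtain ⟨he₂, hm₂, hm₁⟩ := hs.pos
  have hm2 := hs.m₂_ge
  have hle := hs.m_le
  have hQ := hs.Q_pos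
  have he₁ := hs.e₁_pos
  have hθ1 := hs.mul_le
  obtain ⟨θ, hθ⟩ : ∃ θ, θ = e₁ * e₂ * Q := ⟨_, rfl⟩
  have hθ0 : 0 < θ := by rw [hθ]; positivity
  rw [← hθ] at hθ1 hbig
  have hlog : 0 ≤ Real.log (9 * m₁) := Real.log_nonneg (by linarith)
  have hθm : 24 * 2 ^ 25 ≤ θ * m₂ := by
    rw [le_div_iff₀ (by positivity)] at hbig; nlinarith
  have hm₂big : 24 * 2 ^ 25 ≤ m₂ := hθm.trans (by nlinarith)
  have hθm₁ : 24 * 2 ^ 25 ≤ θ * m₁ := hθm.trans (by gcongr)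
  obtain ⟨L, hL⟩ : ∃ L, L = ⌊θ * m₁ / 2048⌋₊ := ⟨_, rfl⟩
  obtain ⟨B, hB⟩ : ∃ B, B = ⌊m₂ / 512⌋₊ := ⟨_, rfl⟩
  obtain ⟨A, hA⟩ : ∃ A, A = ⌊m₁ * m₂ / 2⌋₊ := ⟨_, rfl⟩
  have hLhi : (L : ℝ) ≤ θ * m₁ / 2048 := by rw [hL]; exact Nat.floor_le (by positivity)
  have hBhi : (B : ℝ) ≤ m₂ / 512 := by rw [hB]; exact Nat.floor_le (by positivity)
  have hAhi : (A : ℝ) ≤ m₁ * m₂ / 2 := by rw [hA]; exact Nat.floor_le (by positivity)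
  have hLlo : θ * m₁ / 2048 / 2 ≤ L := by rw [hL]; exact half_le_floor (by linarith)
  have hBlo : m₂ / 512 / 2 ≤ B := by rw [hB]; exact half_le_floor (by linarith)
  have hAlo : m₁ * m₂ / 2 / 2 ≤ A := by rw [hA]; exact half_le_floor (by nlinarith)
  obtain ⟨c₀, b₀, a₀, hcabs, hadm⟩ := exists_windows hs hf (by rwa [hθ] at hLhi) hBhi hAhi
  obtain ⟨G, hG⟩ : ∃ G, G = ⌈8 * m₁⌉₊ := ⟨_, rfl⟩
  have hGlo : 8 * m₁ ≤ G := by rw [hG]; exact Nat.le_ceil _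
  have hGhi : (G : ℝ) ≤ 9 * m₁ := by
    rw [hG]; refine (Nat.ceil_lt_add_one (by positivity)).le.trans ?_; linarith
  set P := (Finset.range L ×ˢ Finset.range B).filter fun p : ℕ × ℕ =>
      c₀ + p.1 ≠ 0 ∧ IsCoprime (b₀ (c₀ + p.1) + p.2) (c₀ + p.1) with hP
  have hPcard : (L * B : ℝ) / 8 ≤ P.card := by
    have h1 := card_coprime_pairs c₀ L B G (fun l => b₀ (c₀ + l)) (by
      intro l hl
      have h2 : |((c₀ + l : ℤ) : ℝ)| ≤ G := (hcabs (c₀ + l) (by omega) (by omega)).trans hGlo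
      exact_mod_cast h2)
    have h3 : Real.log G ≤ Real.log (9 * m₁) := Real.log_le_log (by linarith) hGhi
    have h4 : (B : ℝ) + (L + B) * (1 + Real.log G) + G
        ≤ m₁ + (m₁ + m₁) * (1 + Real.log (9 * m₁)) + 9 * m₁ := by
      have : (B : ℝ) ≤ m₁ := by linarith
      have : (L : ℝ) ≤ m₁ := by nlinarith
      have : 0 ≤ 1 + Real.log G := by
        have := Real.log_natCast_nonneg G
        linarith
      gcongr
    have h5 : m₁ * (24 * (1 + Real.log (9 * m₁))) ≤ m₁ * (θ * m₂ / 2 ^ 25) := by gcongr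
    have h6 : m₁ * (θ * m₂ / 2 ^ 25) ≤ (L * B : ℝ) / 8 := by
      calc m₁ * (θ * m₂ / 2 ^ 25) = (θ * m₁ / 2048 / 2) * (m₂ / 512 / 2) / 8 := by ring
        _ ≤ _ := by gcongr
    have h7 := mul_nonneg hm₁.le hlog
    nlinarith
  set F₀ := (P ×ˢ Finset.range A).image fun p : (ℕ × ℕ) × ℕ =>
      ((a₀ (c₀ + p.1.1) (b₀ (c₀ + p.1.1) + p.1.2) + p.2, b₀ (c₀ + p.1.1) + p.1.2,
        c₀ + p.1.1) : ℤ × ℤ × ℤ) with hF₀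
  have hF₀card : (F₀.card : ℝ) = P.card * A := by
    rw [hF₀, card_window_image]; push_cast; ring
  have hF₀adm : ∀ p ∈ F₀, Admissible e₁ e₂ Q m₁ m₂ u v t p.1 p.2.1 p.2.2 ∧
      (c₀ ≤ p.2.2 ∧ p.2.2 < c₀ + L) ∧ (b₀ p.2.2 ≤ p.2.1 ∧ p.2.1 < b₀ p.2.2 + B) := by
    intro p hp
    obtain ⟨⟨⟨l, i⟩, m⟩, hx, rfl⟩ := Finset.mem_image.1 hp
    simp only [hP, Finset.mem_product, Finset.mem_filter, Finset.mem_range] at hx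
    obtain ⟨⟨⟨hl, hi⟩, -, hcop⟩, hm⟩ := hx
    refine ⟨?_, ⟨by simp, by simpa using hl⟩, ⟨by simp, by simpa using hi⟩⟩
    exact hadm (c₀ + l) (by omega) (by omega) _ (by simp) (by simpa using hi) _ (by simp)
      (by simpa using hm) hcop
  set bad : ℤ × ℤ × ℤ → Prop := fun p =>
    NearRat m₂ (2 ^ 28) (heightSlope u v (relPos 1 u v t p.1 p.2.1 p.2.2)) with hbad
  have hbadcard : ((F₀.filter bad).card : ℝ) ≤ 2346 * (m₁ * m₂ * m₂ * L) / 2 ^ 28 :=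
    card_nearRat_le hs hf (by norm_num) hBhi c₀ b₀ _
      (fun p hp => (hF₀adm p (Finset.mem_filter.1 hp).1).2.1)
      (fun p hp => (hF₀adm p (Finset.mem_filter.1 hp).1).2.2)
      (fun p hp => (hF₀adm p (Finset.mem_filter.1 hp).1).1)
      (fun p hp => (Finset.mem_filter.1 hp).2)
  have hsplit : ((F₀.filter bad).card : ℝ) + (F₀.filter fun p => ¬ bad p).card = F₀.card := by
    exact_mod_cast Finset.card_filter_add_card_filter_not (s := F₀) bad
  refine ⟨F₀.filter fun p => ¬ bad p, fun p hp => (hF₀adm p (Finset.mem_filter.1 hp).1).1, ?_, ?_⟩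
  · have h1 : L * (m₁ * m₂ * m₂) / 32768 ≤ F₀.card := by
      rw [hF₀card]
      calc L * (m₁ * m₂ * m₂) / 32768 = L * (m₂ / 512 / 2) / 8 * (m₁ * m₂ / 2 / 2) := by ring
        _ ≤ (L * B : ℝ) / 8 * A := by gcongr
        _ ≤ _ := by gcongr
    have h2 : 2346 * (m₁ * m₂ * m₂ * L) / 2 ^ 28 ≤ L * (m₁ * m₂ * m₂) / 65536 := by
      have : 0 ≤ m₁ * m₂ * m₂ * L := by positivity
      norm_num; linarith
    have h3 : θ * (m₁ * m₂) ^ 2 / 2 ^ 28 ≤ L * (m₁ * m₂ * m₂) / 65536 := by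
      calc θ * (m₁ * m₂) ^ 2 / 2 ^ 28 = (θ * m₁ / 2048 / 2) * (m₁ * m₂ * m₂) / 65536 := by ring
        _ ≤ _ := by gcongr
    rw [← hθ]
    linarith
  · intro p₀ hp₀ G hGF hd
    have hp := (Finset.mem_filter.1 hp₀)
    have hsub : ∀ p ∈ G, p ∈ F₀ := fun p hp => (Finset.mem_filter.1 (hGF hp)).1
    have h1 := card_strip_le hs hf (Λ := 2 ^ 28) (by norm_num) (by linarith) hBhi c₀ b₀ G
      (fun p hp => (hF₀adm p (hsub p hp)).2.1) (fun p hp => (hF₀adm p (hsub p hp)).2.2)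
      (fun p hp => (hF₀adm p (hsub p hp)).1) ((hF₀adm _ hp.1).1.relPos_bounds hs).2 hp.2 hd
    refine h1.trans ?_
    have : (L : ℝ) ≤ 1 * m₁ / 2048 := hLhi.trans (by gcongr)
    calc 3100 * ((2 : ℝ) ^ 28) ^ 2 * L ≤ 3100 * ((2 : ℝ) ^ 28) ^ 2 * (1 * m₁ / 2048) := by gcongr
      _ ≤ _ := by norm_num; linarith

/-- The region attached to the child with coefficients `p`. -/
def childRect (e₁ e₂ m₁ m₂ : ℝ) (u v t : RVec) (p : ℤ × ℤ × ℤ) : Set (EuclideanSpace ℝ (Fin 2)) :=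
  rect (comb u v t p.1 p.2.1 p.2.2) (e₁ / m₁ / m₁) (e₂ / m₂ / m₂)

lemma exists_branches (hs : StepSize e₁ e₂ Q m₁ m₂) (hf : LatFlag e₁ e₂ Q u v t)
    (hbig : 24 * (1 + Real.log (9 * m₁)) ≤ e₁ * e₂ * Q * m₂ / 2 ^ 25) {N n : ℕ}
    (hN : N ≤ e₁ * e₂ * Q * (m₁ * m₂) ^ 2 / 2 ^ 28) (hn : 2 ^ 57 * m₁ ≤ n) :
    ∃ φ : Fin N → ℤ × ℤ × ℤ,
      (∀ i, Admissible e₁ e₂ Q m₁ m₂ u v t (φ i).1 (φ i).2.1 (φ i).2.2) ∧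
      (∀ U : Set (EuclideanSpace ℝ (Fin 2)),
        (∀ x ∈ U, ∀ y ∈ U, dist x y ≤ e₁ / (512 * m₁ * (m₁ * m₂ * Q))) →
        {i | (childRect e₁ e₂ m₁ m₂ u v t (φ i) ∩ U).Nonempty}.ncard ≤ 1) ∧
      (∀ U : Set (EuclideanSpace ℝ (Fin 2)),
        (∀ x ∈ U, ∀ y ∈ U, dist x y ≤ e₂ / m₂ / m₂ / (m₁ * m₂ * Q)) →
        {i | (childRect e₁ e₂ m₁ m₂ u v t (φ i) ∩ U).Nonempty}.ncard ≤ n) := by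
  classical
  obtain ⟨he₂, hm₂, hm₁⟩ := hs.pos
  have hQ := hs.Q_pos
  have hMQ : 0 < m₁ * m₂ * Q := by positivity
  obtain ⟨F, hF, hcard, hstrip⟩ := exists_children hs hf hbig
  have hNF : N ≤ F.card := by exact_mod_cast hN.trans hcard
  obtain ⟨ψ⟩ : Nonempty (Fin N ↪ F) :=
    Function.Embedding.nonempty_of_card_le (by simpa using hNF)
  have hcoord : ∀ (x y : EuclideanSpace ℝ (Fin 2)) j, |x j - y j| ≤ dist x y := by
    intro x y j
    rw [dist_eq_norm]
    exact PiLp.norm_apply_le (x - y) j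
  refine ⟨fun i => ψ i, fun i => hF _ (ψ i).2, ?_, ?_⟩
  · intro U hU
    rw [Set.ncard_le_one]
    rintro i ⟨x, hx, hxU⟩ j ⟨y, hy, hyU⟩
    have hxy := hU x hxU y hyU
    obtain ⟨h1, h2, h3⟩ := (hF _ (ψ i).2).separated hs hf (hF _ (ψ j).2) hx hy
      ((hcoord x y 0).trans hxy) ((hcoord x y 1).trans hxy)
    exact ψ.injective (Subtype.ext (Prod.ext h1 (Prod.ext h2 h3)))
  · intro U hU
    set I := {i | (childRect e₁ e₂ m₁ m₂ u v t (ψ i) ∩ U).Nonempty} with hI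
    rcases I.eq_empty_or_nonempty with h0 | ⟨i₀, hi₀⟩
    · rw [h0]; simp
    · have h1 := hstrip (ψ i₀) (ψ i₀).2 (I.toFinset.image fun i => (ψ i : ℤ × ℤ × ℤ)) (by
          intro p hp
          obtain ⟨i, -, rfl⟩ := Finset.mem_image.1 hp
          exact (ψ i).2) (by
          intro p hp
          obtain ⟨i, hi, rfl⟩ := Finset.mem_image.1 hp
          obtain ⟨x, hx, hxU⟩ := Set.mem_toFinset.1 hi
          obtain ⟨y, hy, hyU⟩ := hi₀
          have := abs_relPos_sub_le hMQ (hf.q_ne hQ) (hF _ (ψ i).2) (hF _ (ψ i₀).2) 1 hx.2 hy.2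
            ((hcoord x y 1).trans (hU x hxU y hyU))
          linarith)
      rw [Finset.card_image_of_injective I.toFinset
          (f := fun i => (ψ i : ℤ × ℤ × ℤ)) (Subtype.val_injective.comp ψ.injective),
        ← Set.ncard_eq_toFinset_card'] at h1
      exact_mod_cast h1.trans hn

end

lemma isClosed_rect (u : RVec) (E₁ E₂ : ℝ) : IsClosed (rect u E₁ E₂) := by
  have h : ∀ j, Continuous fun x : EuclideanSpace ℝ (Fin 2) => |(u.2 : ℝ) * x j - u.1 j| :=
    fun j => by fun_prop
  exact (isClosed_le (h 0) continuous_const).inter (isClosed_le (h 1) continuous_const)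

lemma rect_nonempty {u : RVec} (hu : u.2 ≠ 0) {E₁ E₂ : ℝ} (h₁ : 0 ≤ E₁) (h₂ : 0 ≤ E₂) :
    (rect u E₁ E₂).Nonempty := by
  have hu' : (u.2 : ℝ) ≠ 0 := by exact_mod_cast hu
  refine ⟨!₂[(u.1 0 : ℝ) / u.2, (u.1 1 : ℝ) / u.2], ?_, ?_⟩
  · simpa [mul_div_cancel₀ _ hu'] using h₁
  · simpa [mul_div_cancel₀ _ hu'] using h₂

lemma dist_le_abs_add_abs (x y : EuclideanSpace ℝ (Fin 2)) :
    dist x y ≤ |x 0 - y 0| + |x 1 - y 1| := by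
  rw [EuclideanSpace.dist_eq, Fin.sum_univ_two, Real.sqrt_le_left (by positivity)]
  simp only [Real.dist_eq]
  nlinarith [abs_nonneg (x 0 - y 0), abs_nonneg (x 1 - y 1)]

lemma dist_le_of_mem_rect {u : RVec} {E₁ E₂ Q : ℝ} (hQ : 0 < Q) (hu : Q ≤ u.2)
    {x y : EuclideanSpace ℝ (Fin 2)} (hx : x ∈ rect u E₁ E₂) (hy : y ∈ rect u E₁ E₂) :
    dist x y ≤ 2 * (E₁ + E₂) / Q := by
  have key : ∀ j E, |(u.2 : ℝ) * x j - u.1 j| ≤ E → |(u.2 : ℝ) * y j - u.1 j| ≤ E →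
      |x j - y j| ≤ 2 * E / Q := by
    intro j E h1 h2
    rw [le_div_iff₀ hQ]
    have h3 : (u.2 : ℝ) * |x j - y j| ≤ 2 * E := by
      nth_rewrite 1 [← abs_of_pos (hQ.trans_le hu)]
      rw [← abs_mul]
      have h1' := abs_le.1 h1
      have h2' := abs_le.1 h2
      rw [abs_le]
      constructor <;> linarith
    nlinarith [abs_nonneg (x j - y j)]
  refine (dist_le_abs_add_abs x y).trans ?_
  have := key 0 E₁ hx.1 hy.1
  have := key 1 E₂ hx.2 hy.2
  have e : 2 * (E₁ + E₂) / Q = 2 * E₁ / Q + 2 * E₂ / Q := by ring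
  linarith

lemma StepSize.iterate {E₁ E₂ Q m₁ m₂ : ℝ} (hs : StepSize E₁ E₂ Q m₁ m₂) (k : ℕ) :
    StepSize (E₁ / m₁ ^ k) (E₂ / m₂ ^ k) (Q * (m₁ * m₂) ^ k) m₁ m₂ ∧
      E₁ / m₁ ^ k * (E₂ / m₂ ^ k) * (Q * (m₁ * m₂) ^ k) = E₁ * E₂ * Q := by
  obtain ⟨he₂, hm₂, hm₁⟩ := hs.pos
  have hQ := hs.Q_pos
  have he₁ := hs.e₁_pos
  have hle := hs.m_le
  have hee := hs.e_le
  have e : E₁ / m₁ ^ k * (E₂ / m₂ ^ k) * (Q * (m₁ * m₂) ^ k) = E₁ * E₂ * Q := by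
    rw [mul_pow]; field_simp
  exact ⟨⟨by positivity, by positivity, by gcongr, e.trans_le hs.mul_le, hs.m₂_ge, hle⟩, e⟩

theorem le_dimH_of_flag {w₁ w₂ a M E₁ E₂ Q : ℝ} (hw₂ : 0 < w₂) (hw : w₂ ≤ w₁)
    (hsum : w₁ + w₂ = 1) (ha : 0 < a) (ha1 : 2 * a < 1) (hM : 1 < M)
    (hs : StepSize E₁ E₂ Q (M ^ w₁) (M ^ w₂))
    (hbig : 24 * (1 + Real.log (9 * M ^ w₁)) ≤ E₁ * E₂ * Q * M ^ w₂ / 2 ^ 25)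
    (hN : M ^ (2 - a) + 1 ≤ E₁ * E₂ * Q * M ^ 2 / 2 ^ 28)
    (hn : 2 ^ 57 * M ^ w₁ + 1 ≤ M ^ (w₁ + a))
    {u v t : RVec} (hf : LatFlag E₁ E₂ Q u v t) (A : Set (EuclideanSpace ℝ (Fin 2)))
    (hA : ∀ x, (∀ k : ℕ, ∃ z : RVec, Q * M ^ k ≤ z.2 ∧ z.2 ≤ 4 * (Q * M ^ k) ∧
      x ∈ rect z (E₁ / (M ^ w₁) ^ (k + 1)) (E₂ / (M ^ w₂) ^ (k + 1))) → x ∈ A) :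
    ENNReal.ofReal ((w₁ + a) / (1 + w₁) + (1 + w₂ - 2 * a) / (1 + w₂)) ≤ dimH A := by
  have hM0 : 0 < M := by linarith
  have hmm : M ^ w₁ * M ^ w₂ = M := by rw [← Real.rpow_add hM0, hsum, Real.rpow_one]
  have hp₁ : M ^ (-(1 + w₁)) = (M ^ w₁ * M)⁻¹ := by
    rw [Real.rpow_neg hM0.le, Real.rpow_add hM0, Real.rpow_one, mul_comm]
  have hp₂ : M ^ (-(1 + w₂)) = (M ^ w₂ * M)⁻¹ := by
    rw [Real.rpow_neg hM0.le, Real.rpow_add hM0, Real.rpow_one, mul_comm]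
  obtain ⟨m₁, hm₁e⟩ : ∃ m₁, m₁ = M ^ w₁ := ⟨_, rfl⟩
  obtain ⟨m₂, hm₂e⟩ : ∃ m₂, m₂ = M ^ w₂ := ⟨_, rfl⟩
  rw [← hm₁e] at hp₁ hmm hs hbig hn
  rw [← hm₂e] at hp₂ hmm hs hbig
  simp only [← hm₁e, ← hm₂e] at hA
  obtain ⟨he₂, hm₂, hm₁⟩ := hs.pos
  have hQ := hs.Q_pos
  have he₁ := hs.e₁_pos
  set N := ⌊E₁ * E₂ * Q * M ^ 2 / 2 ^ 28⌋₊ with hNdef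
  set n := ⌈2 ^ 57 * m₁⌉₊ with hndef
  have hNlo : M ^ (2 - a) ≤ N := by
    have : E₁ * E₂ * Q * M ^ 2 / 2 ^ 28 < N + 1 := Nat.lt_floor_add_one _
    linarith
  have hN0 : N ≠ 0 := by
    have : (0 : ℝ) < N := lt_of_lt_of_le (by positivity) hNlo
    exact_mod_cast this.ne'
  have : NeZero N := ⟨hN0⟩
  have hnhi : (n : ℝ) ≤ M ^ (w₁ + a) := (Nat.ceil_lt_add_one (by positivity)).le.trans hn
  let S : ℕ → Type := fun k => {p : RVec × RVec × RVec //
    LatFlag (E₁ / m₁ ^ k) (E₂ / m₂ ^ k) (Q * (m₁ * m₂) ^ k) p.1 p.2.1 p.2.2}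
  let R : ∀ k, S k → Set (EuclideanSpace ℝ (Fin 2)) := fun k s =>
    rect s.1.1 (E₁ / m₁ ^ (k + 1)) (E₂ / m₂ ^ (k + 1))
  have hsucc : ∀ (E m : ℝ) (k : ℕ), E / m ^ (k + 1) = E / m ^ k / m := fun E m k => by
    rw [pow_succ, div_mul_eq_div_div]
  have hQk : ∀ k : ℕ, Q * M ^ k = Q * (m₁ * m₂) ^ k := fun k => by rw [hmm]
  have hbr : ∀ k (s : S k), _ := fun k s =>
    exists_branches (N := N) (n := n) (hs.iterate k).1 s.2 (by rw [(hs.iterate k).2]; exact hbig)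
      (by rw [(hs.iterate k).2, hmm]; exact Nat.floor_le (by positivity)) (Nat.le_ceil _)
  choose φ hφ₁ hφ₂ hφ₃ using hbr
  have hchild : ∀ k (s : S k) (i : Fin N), ∃ s' : S (k + 1),
      R (k + 1) s' = childRect (E₁ / m₁ ^ k) (E₂ / m₂ ^ k) m₁ m₂ s.1.1 s.1.2.1 s.1.2.2 (φ k s i) := by
    intro k s i
    obtain ⟨t', ht'⟩ := (hφ₁ k s i).flag (hs.iterate k).1 s.2
    refine ⟨⟨⟨comb s.1.1 s.1.2.1 s.1.2.2 (φ k s i).1 (φ k s i).2.1 (φ k s i).2.2, -s.1.1, t'⟩,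
      ?_⟩, ?_⟩
    · rw [hsucc, hsucc, pow_succ, show Q * ((m₁ * m₂) ^ k * (m₁ * m₂))
        = m₁ * m₂ * (Q * (m₁ * m₂) ^ k) by ring]
      exact ht'
    · simp only [R, childRect, hsucc]
  choose child hchildR using hchild
  obtain ⟨c, hc⟩ : ∃ c, c = min (E₁ / (512 * Q)) (E₂ / (m₂ * Q)) := ⟨_, rfl⟩
  have hc0 : 0 < c := by rw [hc]; exact lt_min (by positivity) (by positivity)
  refine le_dimH_of_tree (S := S) hM hc0 hw₂ hw hsum ha ha1 hNlo hnhi ⟨⟨u, v, t⟩, by simpa using hf⟩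
    child R (fun k s => isClosed_rect _ _ _) ?_ (r := fun k => 2 * (E₁ + E₂) / (Q * M ^ k)) ?_ ?_ ?_
    ?_ ?_ A ?_
  · intro k s
    exact rect_nonempty (s.2.q_ne (hs.iterate k).1.Q_pos) (by positivity) (by positivity)
  · refine Filter.Tendsto.const_div_atTop ?_ _
    exact (tendsto_pow_atTop_atTop_of_one_lt hM).const_mul_atTop hQ
  · intro k s x hx y hy
    have h1 := (hQk k).trans_le s.2.q_lo
    refine (dist_le_of_mem_rect (by positivity) h1 hx hy).trans ?_
    have hm1 : 1 ≤ m₂ := by have := hs.m₂_ge; linarith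
    have hm2 : 1 ≤ m₁ := hm1.trans hs.m_le
    gcongr
    · exact div_le_self he₁.le (one_le_pow₀ hm2)
    · exact div_le_self he₂.le (one_le_pow₀ hm1)
  · intro k s i
    rw [hchildR]
    have := (hφ₁ k s i).rect_subset (hs.iterate k).1 s.2
    simpa only [R, childRect, hsucc] using this
  · intro k s U hU
    simp only [hchildR]
    refine hφ₂ k s U fun x hx y hy => (hU x hx y hy).trans ?_
    calc c * (M ^ (-(1 + w₁))) ^ (k + 1) ≤ E₁ / (512 * Q) * (M ^ (-(1 + w₁))) ^ (k + 1) := by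
          gcongr; rw [hc]; exact min_le_left _ _
      _ = _ := by
          rw [hp₁, hmm, inv_pow, mul_pow, pow_succ m₁, pow_succ M]; field_simp
  · intro k s U hU
    simp only [hchildR]
    refine hφ₃ k s U fun x hx y hy => (hU x hx y hy).trans ?_
    calc c * (M ^ (-(1 + w₂))) ^ (k + 1) ≤ E₂ / (m₂ * Q) * (M ^ (-(1 + w₂))) ^ (k + 1) := by
          gcongr; rw [hc]; exact min_le_right _ _
      _ = _ := by
          rw [hp₂, hmm, inv_pow, mul_pow, pow_succ m₂, pow_succ M]; field_simp
  · intro x hx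
    refine hA x fun k => ?_
    obtain ⟨s, hxs⟩ := hx k
    exact ⟨s.1.1, (hQk k).trans_le s.2.q_lo, by rw [hQk k]; exact s.2.q_hi, hxs⟩

lemma exists_initial_flag {w₁ w₂ ε : ℝ} (hw₂ : 0 < w₂) (hw : w₂ ≤ w₁) (hsum : w₁ + w₂ = 1)
    (hε : 0 < ε) (hε1 : ε ≤ 1) : ∃ Q : ℝ, 1 ≤ Q ∧ ∃ u v t,
      LatFlag (1 / 2 * (ε / (4 * Q)) ^ w₁) (1 / 2 * (ε / (4 * Q)) ^ w₂) Q u v t := by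
  obtain ⟨q, hq, hq1⟩ : ∃ q : ℕ, 128 / (ε / 4) ^ w₁ ≤ (q : ℝ) ^ w₂ ∧ 1 ≤ q := by
    have h := (tendsto_rpow_atTop hw₂).comp (tendsto_natCast_atTop_atTop (R := ℝ))
    exact ((h.eventually_ge_atTop (128 / (ε / 4) ^ w₁)).and
      (Filter.eventually_ge_atTop 1)).exists
  have hq1' : (1 : ℝ) ≤ q := by exact_mod_cast hq1
  have hq0 : (0 : ℝ) < q := by linarith
  obtain ⟨δ, hδ⟩ : ∃ δ, δ = ε / (4 * (q : ℝ)) := ⟨_, rfl⟩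
  have hδ0 : 0 < δ := by rw [hδ]; positivity
  have hδ1 : δ ≤ 1 := by rw [hδ, div_le_one (by positivity)]; linarith
  obtain ⟨X, hX⟩ : ∃ X, X = 1 / 2 * δ ^ w₁ * q := ⟨_, rfl⟩
  obtain ⟨Y, hY⟩ : ∃ Y, Y = 1 / 2 * δ ^ w₂ * q := ⟨_, rfl⟩
  have hXY : X ≤ Y := by
    rw [hX, hY]
    have := Real.rpow_le_rpow_of_exponent_ge hδ0 hδ1 hw
    gcongr
  have hX64 : 64 ≤ X := by
    have h1 : δ ^ w₁ * q = (ε / 4) ^ w₁ * (q : ℝ) ^ w₂ := by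
      have h2 : (q : ℝ) = (q : ℝ) ^ w₁ * (q : ℝ) ^ w₂ := by
        rw [← Real.rpow_add hq0, hsum, Real.rpow_one]
      have h3 : (q : ℝ) ^ w₁ ≠ 0 := by positivity
      rw [hδ, ← div_div, Real.div_rpow (by positivity) hq0.le]
      nth_rewrite 2 [h2]
      field_simp
    rw [div_le_iff₀ (by positivity)] at hq
    rw [hX]; linarith
  obtain ⟨p, hp⟩ : ∃ p : ℕ, p = ⌈X / 64⌉₊ := ⟨_, rfl⟩
  have hplo : X / 64 ≤ p := by rw [hp]; exact Nat.le_ceil _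
  have hphi : (p : ℝ) ≤ X / 64 + 1 := by
    rw [hp]; exact (Nat.ceil_lt_add_one (by linarith)).le
  have hp1 : (1 : ℝ) ≤ p := by linarith
  obtain ⟨s, hs⟩ : ∃ s : ℕ, s = ⌈Y / (64 * p)⌉₊ := ⟨_, rfl⟩
  have hslo : Y / 64 ≤ p * s := by
    have h1 : Y / (64 * p) ≤ s := by rw [hs]; exact Nat.le_ceil _
    rw [div_le_iff₀ (by positivity)] at h1
    linarith
  have hshi : (p : ℝ) * s ≤ Y / 64 + p := by
    have h1 : (s : ℝ) ≤ Y / (64 * p) + 1 := by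
      rw [hs]; exact (Nat.ceil_lt_add_one (div_nonneg (by linarith) (by positivity))).le
    calc (p : ℝ) * s ≤ p * (Y / (64 * p) + 1) := by gcongr
      _ = _ := by field_simp
  refine ⟨q, hq1', (![p, p * s + 1], q), (0, -1), (![-1, -s], 0), ?_⟩
  rw [← hδ]
  have o0 : offs 0 (![(p : ℤ), p * s + 1], (q : ℤ)) (0, -1) = p / q := by simp [offs]
  have o1 : offs 1 (![(p : ℤ), p * s + 1], (q : ℤ)) (0, -1) = (p * s + 1) / q := by simp [offs]
  refine ⟨by simp, by simp; linarith, ?_, ?_, ?_, ?_, ?_, ?_⟩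
  · rw [o0, le_div_iff₀ hq0]; linarith
  · rw [o0, div_le_iff₀ hq0]; linarith
  · rw [o1, le_div_iff₀ hq0]; linarith
  · rw [o1, div_le_iff₀ hq0]; linarith
  · simpa using hq1
  · simp [det3]

lemma eventually_step_large {w₁ w₂ a C : ℝ} (hw₁ : 0 < w₁) (hw₂ : 0 < w₂) (ha : 0 < a)
    (h2 : a ≤ 2) (hC : 0 < C) : ∀ᶠ M : ℝ in Filter.atTop, 1 < M ∧ 4096 ≤ M ^ w₂ ∧
      24 * (1 + Real.log (9 * M ^ w₁)) ≤ C * M ^ w₂ / 2 ^ 25 ∧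
      M ^ (2 - a) + 1 ≤ C * M ^ 2 / 2 ^ 28 ∧ 2 ^ 57 * M ^ w₁ + 1 ≤ M ^ (w₁ + a) := by
  have hlog : (fun M : ℝ => 24 * (1 + Real.log 9) + 24 * w₁ * Real.log M)
      =o[Filter.atTop] fun M : ℝ => M ^ w₂ := by
    refine Asymptotics.IsLittleO.add ?_ ((isLittleO_log_rpow_atTop hw₂).const_mul_left _)
    rw [Asymptotics.isLittleO_const_left]
    right
    exact Filter.tendsto_abs_atTop_atTop.comp (tendsto_rpow_atTop hw₂)
  filter_upwards [Filter.eventually_gt_atTop 1,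
    (tendsto_rpow_atTop hw₂).eventually_ge_atTop 4096,
    hlog.def (show 0 < C / 2 ^ 25 by positivity),
    (tendsto_rpow_atTop ha).eventually_ge_atTop (2 * 2 ^ 28 / C),
    (tendsto_rpow_atTop ha).eventually_ge_atTop (2 ^ 58)] with M hM h1 h3 h4 h5
  have hM0 : 0 < M := by linarith
  refine ⟨hM, h1, ?_, ?_, ?_⟩
  · rw [Real.log_mul (by norm_num) (by positivity), Real.log_rpow hM0]
    have h6 := (le_abs_self _).trans h3
    rw [Real.norm_eq_abs, abs_of_pos (by positivity : 0 < M ^ w₂)] at h6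
    linarith
  · rw [div_le_iff₀ hC] at h4
    have e : M ^ 2 = M ^ (2 - a) * M ^ a := by
      rw [← Real.rpow_add hM0, ← Real.rpow_natCast]; norm_num
    have h7 : 1 ≤ M ^ (2 - a) := Real.one_le_rpow hM.le (by linarith)
    rw [e, le_div_iff₀ (by positivity)]
    nlinarith
  · have h7 : 1 ≤ M ^ w₁ := Real.one_le_rpow hM.le hw₁.le
    rw [Real.rpow_add hM0]
    nlinarith

lemma exists_pow_bracket {c M T : ℝ} (hc : 0 < c) (hM : 1 < M) (hT : c < T) :
    ∃ k : ℕ, c * M ^ k < T ∧ T ≤ c * M ^ (k + 1) := by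
  classical
  have hex : ∃ k : ℕ, T ≤ c * M ^ (k + 1) := by
    obtain ⟨k, hk⟩ := pow_unbounded_of_one_lt (T / c) hM
    refine ⟨k, ?_⟩
    rw [div_lt_iff₀ hc] at hk
    have : M ^ k ≤ M ^ (k + 1) := pow_le_pow_right₀ hM.le (Nat.le_succ k)
    nlinarith
  refine ⟨Nat.find hex, ?_, Nat.find_spec hex⟩
  rcases h : Nat.find hex with _ | k
  · simpa using hT
  · exact not_le.1 (Nat.find_min hex (m := k) (by omega))

lemma mem_DI_of_rect {w₁ w₂ ε Q M : ℝ} (hw₁ : 0 < w₁) (hw₂ : 0 < w₂) (hε : 0 < ε) (hQ : 0 < Q)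
    (hM : 1 < M) {x : EuclideanSpace ℝ (Fin 2)}
    (hx : ∀ k : ℕ, ∃ z : RVec, Q * M ^ k ≤ z.2 ∧ z.2 ≤ 4 * (Q * M ^ k) ∧
      x ∈ rect z (1 / 2 * (ε / (4 * Q)) ^ w₁ / (M ^ w₁) ^ (k + 1))
        (1 / 2 * (ε / (4 * Q)) ^ w₂ / (M ^ w₂) ^ (k + 1))) : x ∈ DI w₁ w₂ ε := by
  refine ⟨4 * Q, fun T hT => ?_⟩
  have hM0 : 0 < M := by linarith
  have hT0 : 0 < T := by linarith
  obtain ⟨k, hk1, hk2⟩ := exists_pow_bracket (by positivity) hM hT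
  obtain ⟨z, hz1, hz2, hx1, hx2⟩ := hx k
  have key : ∀ w : ℝ, 0 < w →
      1 / 2 * (ε / (4 * Q)) ^ w / (M ^ w) ^ (k + 1) < ε ^ w * T ^ (-w) := by
    intro w hw
    have e : 1 / 2 * (ε / (4 * Q)) ^ w / (M ^ w) ^ (k + 1)
        = 1 / 2 * (ε / (4 * Q * M ^ (k + 1))) ^ w := by
      rw [← Real.rpow_natCast, ← Real.rpow_mul hM0.le, mul_comm w, Real.rpow_mul hM0.le,
        Real.rpow_natCast, mul_div_assoc, ← Real.div_rpow (by positivity) (by positivity), div_div]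
    have e' : ε ^ w * T ^ (-w) = (ε / T) ^ w := by
      rw [Real.rpow_neg hT0.le, Real.div_rpow hε.le hT0.le, div_eq_mul_inv]
    rw [e, e']
    have h1 : (ε / (4 * Q * M ^ (k + 1))) ^ w ≤ (ε / T) ^ w := by gcongr
    have h2 : 0 < (ε / (4 * Q * M ^ (k + 1))) ^ w := by positivity
    linarith
  refine ⟨z.1 0, z.1 1, z.2, hx1.trans_lt (key w₁ hw₁), hx2.trans_lt (key w₂ hw₂), ?_, ?_⟩
  · have : (0 : ℝ) < z.2 := lt_of_lt_of_le (by positivity) hz1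
    exact_mod_cast this
  · linarith

theorem le_dimH_DI {w₁ w₂ ε : ℝ} (hw₂ : 0 < w₂) (hw : w₂ ≤ w₁) (hsum : w₁ + w₂ = 1)
    (hε : 0 < ε) (hε1 : ε ≤ 1) : ENNReal.ofReal (2 - 1 / (1 + w₁)) ≤ dimH (DI w₁ w₂ ε) := by
  have hw₁ : 0 < w₁ := by linarith
  have key : ∀ a : ℝ, 0 < a → 2 * a < 1 →
      ENNReal.ofReal ((w₁ + a) / (1 + w₁) + (1 + w₂ - 2 * a) / (1 + w₂)) ≤ dimH (DI w₁ w₂ ε) := by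
    intro a ha ha1
    obtain ⟨Q, hQ1, u, v, t, hf⟩ := exists_initial_flag hw₂ hw hsum hε hε1
    have hQ : 0 < Q := by linarith
    obtain ⟨M, hM⟩ := (eventually_step_large (C := ε / 16) hw₁ hw₂ ha (by linarith)
      (by positivity)).exists
    obtain ⟨hM1, hM2, hM3, hM4, hM5⟩ := hM
    have hθ : 1 / 2 * (ε / (4 * Q)) ^ w₁ * (1 / 2 * (ε / (4 * Q)) ^ w₂) * Q = ε / 16 := by
      have h1 : (ε / (4 * Q)) ^ w₁ * (ε / (4 * Q)) ^ w₂ = ε / (4 * Q) := by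
        rw [← Real.rpow_add (by positivity), hsum, Real.rpow_one]
      calc _ = (ε / (4 * Q)) ^ w₁ * (ε / (4 * Q)) ^ w₂ * Q / 4 := by ring
        _ = _ := by rw [h1]; field_simp; norm_num
    have hs : StepSize (1 / 2 * (ε / (4 * Q)) ^ w₁) (1 / 2 * (ε / (4 * Q)) ^ w₂) Q
        (M ^ w₁) (M ^ w₂) := by
      refine ⟨hQ, by positivity, ?_, by rw [hθ]; linarith, hM2,
        Real.rpow_le_rpow_of_exponent_le hM1.le hw⟩
      have h1 : ε / (4 * Q) ≤ 1 := by rw [div_le_one (by positivity)]; linarith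
      have := Real.rpow_le_rpow_of_exponent_ge (by positivity) h1 hw
      gcongr
    exact le_dimH_of_flag hw₂ hw hsum ha ha1 hM1 hs (by rwa [hθ]) (by rwa [hθ]) hM5 hf _
      fun x hx => mem_DI_of_rect hw₁ hw₂ hε hQ hM1 hx
  have hcont : Continuous fun a : ℝ =>
      ENNReal.ofReal ((w₁ + a) / (1 + w₁) + (1 + w₂ - 2 * a) / (1 + w₂)) :=
    ENNReal.continuous_ofReal.comp (by fun_prop)
  have hlim := (hcont.tendsto 0).mono_left (nhdsWithin_le_nhds (s := Set.Ioi 0))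
  have h0 : (w₁ + 0) / (1 + w₁) + (1 + w₂ - 2 * 0) / (1 + w₂) = 2 - 1 / (1 + w₁) := by
    field_simp; ring
  rw [h0] at hlim
  refine le_of_tendsto hlim ?_
  filter_upwards [Ioo_mem_nhdsGT (show (0 : ℝ) < 1 / 2 by norm_num)] with a ha
  exact key a ha.1 (by linarith [ha.2])

/-- There is a constant `C > 0` such that for all `0 < ε ≤ 2^(-5/w₂)` the Hausdorff
dimension of `DI(w, ε)` lies between `2 - 1/(1+w₁)` and `2 - 1/(1+w₁) + C√ε`. -/
theorem dimH_DI (w₁ w₂ : ℝ) (hw₂ : 0 < w₂) (hw : w₂ ≤ w₁) (hsum : w₁ + w₂ = 1) :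
    ∃ C : ℝ, 0 < C ∧ ∀ ε : ℝ, 0 < ε → ε ≤ (2 : ℝ) ^ (-(5 / w₂)) →
      ENNReal.ofReal (2 - 1 / (1 + w₁)) ≤ dimH (DI w₁ w₂ ε) ∧
      dimH (DI w₁ w₂ ε) ≤ ENNReal.ofReal (2 - 1 / (1 + w₁) + C * Real.sqrt ε) := by
  refine ⟨300, by norm_num, fun ε hε hε1 => ⟨le_dimH_DI hw₂ hw hsum hε (hε1.trans ?_),
    dimH_DI_le hw₂ hw hsum hε⟩⟩
  exact Real.rpow_le_one_of_one_le_of_nonpos (by norm_num) (by simpa using by positivity)
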